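/- For every squarefree positive integer d, the outer automorphism group of the Bianchi group PSL₂(O_d) is an elementary abelian 2-group; in particular, for every automorphism φ of PSL₂(O_d), the automorphism φ ∘ φ is inner, i.e., there exists g ∈ PSL₂(O_d) such that φ(φ(x)) = g x g⁻¹ for all x. -/

import Mathlib

open IntermediateField

/-- The imaginary quadratic field `ℚ(√-d)`, realized inside `ℂ`. -/
noncomputable abbrev Qd (d : ℕ) : IntermediateField ℚ ℂ :=
  ℚ⟮(Complex.I * (Real.sqrt d : ℂ) : ℂ)⟯

/-- `O_d`: the ring of integers of the imaginary quadratic field `ℚ(√-d)`. -/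
noncomputable abbrev Od (d : ℕ) : Type :=
  NumberField.RingOfIntegers (Qd d)

/-- `SL₂(R)`: the special linear group of 2×2 matrices over `R` of determinant 1. -/
abbrev SL2 (R : Type*) [CommRing R] : Type _ :=
  Matrix.SpecialLinearGroup (Fin 2) R

/-- `PSL₂(R)`: the quotient of `SL₂(R)` by its center. -/
abbrev PSL2 (R : Type*) [CommRing R] : Type _ :=
  SL2 R ⧸ Subgroup.center (SL2 R)

def dt (x y : ℂ × ℂ) : ℂ := x.1 * y.2 - x.2 * y.1

lemma dt_swap (x y : ℂ × ℂ) : dt x y = - dt y x := by simp only [dt]; ring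
lemma norm_dt_swap (x y : ℂ × ℂ) : ‖dt x y‖ = ‖dt y x‖ := by rw [dt_swap, norm_neg]
lemma dt_ne_swap {x y : ℂ × ℂ} (h : dt x y ≠ 0) : dt y x ≠ 0 := by
  rw [dt_swap]; exact neg_ne_zero.mpr h
lemma dt_self (x : ℂ × ℂ) : dt x x = 0 := by simp only [dt]; ring
lemma dt_smul_left (c : ℂ) (x y : ℂ × ℂ) : dt (c • x) y = c * dt x y := by
  simp only [dt, Prod.smul_fst, Prod.smul_snd, smul_eq_mul]; ring
lemma dt_smul_right (c : ℂ) (x y : ℂ × ℂ) : dt x (c • y) = c * dt x y := by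
  simp only [dt, Prod.smul_fst, Prod.smul_snd, smul_eq_mul]; ring
lemma dt_add_left (x x' y : ℂ × ℂ) : dt (x + x') y = dt x y + dt x' y := by
  simp only [dt, Prod.fst_add, Prod.snd_add]; ring
lemma dt_add_right (x y y' : ℂ × ℂ) : dt x (y + y') = dt x y + dt x y' := by
  simp only [dt, Prod.fst_add, Prod.snd_add]; ring
lemma plucker (a b c d : ℂ × ℂ) :
    dt a b * dt c d = dt a c * dt b d - dt a d * dt b c := by
  simp only [dt]; ring

structure SideSys {I : Type} (v : I → ℂ × ℂ) (C : ℝ) : Prop where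
  V1 : ∀ i j, dt (v i) (v j) ≠ 0 → 1 ≤ ‖dt (v i) (v j)‖
  V2 : ∀ i k, dt (v i) (v k) = 0 → ∀ y, ‖dt (v i) y‖ ≤ C * ‖dt (v k) y‖
  V3 : ∀ x y, dt x y = 1 → ∃ k, ‖dt x (v k)‖ ≤ C ∧ ‖dt y (v k)‖ ≤ C
  V4 : ∀ k y, dt (v k) y = 1 → ∃ l, dt (v k) (v l) ≠ 0 ∧ ‖dt (v k) (v l)‖ ≤ C ∧ ‖dt y (v l)‖ ≤ C
  V0 : ∀ i, v i ≠ 0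

structure JointSys {I : Type} (v w : I → ℂ × ℂ) : Prop where
  J0 : ∀ i j, dt (v i) (v j) = 0 → dt (w i) (w j) = 0
  J2 : ∀ R : ℝ, ∃ R' : ℝ, ∀ i j, ‖dt (v i) (v j)‖ ≤ R → ‖dt (w i) (w j)‖ ≤ R'
  J3 : ∀ R : ℝ, ∃ R' : ℝ, ∀ i j k, dt (v i) (v j) ≠ 0 → dt (v i) (v k) ≠ 0 →
    ‖dt (v i) (v j)‖ ≤ R → ‖dt (v i) (v k)‖ ≤ R →
    ‖dt (w j) (w k)‖ ≤ R' * (1 + ‖dt (v j) (v k)‖)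

structure FullSys {I : Type} (v w : I → ℂ × ℂ) (C : ℝ) : Prop where
  hC : 1 ≤ C
  Sv : SideSys v C
  Sw : SideSys w C
  Jvw : JointSys v w
  Jwv : JointSys w v

lemma FullSys.symm {I : Type} {v w : I → ℂ × ℂ} {C : ℝ} (h : FullSys v w C) : FullSys w v C :=
  ⟨h.hC, h.Sw, h.Sv, h.Jwv, h.Jvw⟩

lemma growth_step {I : Type} {v w : I → ℂ × ℂ} {C : ℝ} (h : FullSys v w C) {B R1 M : ℝ} {κ : ℕ}
    (hB : B = C ^ 2 + C ^ 4) (hR1 : R1 = 4 * B)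
    (ih : ∀ i j x, R1 ≤ x → x ≤ M → ‖dt (v i) (v j)‖ ≤ x →
      ‖dt (w i) (w j)‖ ≤ 1 / 2 * (x / B) ^ κ)
    {i j k : I} {S : ℝ} (hS : R1 < S) (hΔ : ‖dt (v i) (v j)‖ = S ^ 2) (hM : S ^ 2 ≤ 2 * M)
    (hak : ‖dt (v i) (v k)‖ ≤ C * S) (hab : ‖dt (v j) (v k)‖ ≤ ‖dt (v i) (v k)‖)
    (hE : R1 < ‖dt (v i) (v k)‖) :
    ‖dt (w i) (w j)‖ ≤ 1 / 2 * (S ^ 2 / B) ^ κ := by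
  have hC := h.hC
  have hC2 : 1 ≤ C ^ 2 := one_le_pow₀ hC
  have hC4 : 1 ≤ C ^ 4 := one_le_pow₀ hC
  have hC3 : C ^ 2 ≤ C ^ 3 := pow_le_pow_right₀ hC (by norm_num)
  have hC34 : C ^ 3 ≤ C ^ 4 := pow_le_pow_right₀ hC (by norm_num)
  have hC12 : C ≤ C ^ 2 := by nlinarith
  have hBpos : 0 < B := by linarith
  have hR1pos : 0 < R1 := by linarith
  set E := ‖dt (v i) (v k)‖ with hEdef
  have hEpos : 0 < E := by linarith
  have hne : dt (v k) (v i) ≠ 0 := by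
    rw [← norm_pos_iff, norm_dt_swap]; exact hEpos
  obtain ⟨l, hl0, hl1, hl2⟩ := h.Sv.V4 k ((dt (v k) (v i))⁻¹ • v i) (by
    rw [dt_smul_right, inv_mul_cancel₀ hne])
  rw [dt_smul_left, norm_mul, norm_inv, norm_dt_swap (v k) (v i), inv_mul_le_iff₀ hEpos] at hl2
  set X := C * E with hX
  set Y := (C + C ^ 3) * S ^ 2 / E with hY
  have hSpos : 0 < S := by linarith
  have hE2 : E ^ 2 ≤ C ^ 2 * S ^ 2 := by
    have := pow_le_pow_left₀ hEpos.le hak 2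
    nlinarith
  have hjl : ‖dt (v j) (v l)‖ ≤ Y := by
    rw [hY, le_div_iff₀ hEpos]
    have hp := plucker (v i) (v k) (v j) (v l)
    have hp2 : ‖dt (v i) (v k) * dt (v j) (v l)‖ ≤ S ^ 2 * C + E * C * E := by
      rw [hp]
      refine (norm_sub_le _ _).trans ?_
      rw [norm_mul, norm_mul, hΔ]
      gcongr
      rw [norm_dt_swap]; exact hab
    rw [norm_mul, ← hEdef] at hp2
    nlinarith
  have hjk : ‖dt (v j) (v k)‖ ≤ Y := by
    rw [hY, le_div_iff₀ hEpos]
    have : ‖dt (v j) (v k)‖ * E ≤ E * E := by gcongr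
    have h3 : C ^ 2 * S ^ 2 ≤ (C + C ^ 3) * S ^ 2 := by gcongr; linarith
    nlinarith
  have hXE : E ≤ X := by rw [hX]; nlinarith
  have hX1 : R1 ≤ X := by linarith
  have hXM : X ≤ M := by
    have : X ≤ C ^ 2 * S := by rw [hX]; nlinarith
    have h2 : 2 * C ^ 2 * S ≤ S * S := by gcongr; linarith
    nlinarith
  have hY1 : R1 ≤ Y := by
    rw [hY, le_div_iff₀ hEpos]
    have h1 : R1 * E ≤ S * (C * S) := by gcongr
    have h2 : 0 ≤ C ^ 3 * S ^ 2 := by positivity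
    nlinarith
  have hYM : Y ≤ M := by
    rw [hY, div_le_iff₀ hEpos]
    have h1 : 2 * (C + C ^ 3) ≤ E := by linarith
    have h2 : 2 * (C + C ^ 3) * S ^ 2 ≤ E * S ^ 2 := by gcongr
    have h3 : E * S ^ 2 ≤ E * (2 * M) := by gcongr
    nlinarith
  have e1 := ih i k X hX1 hXM hXE
  have e2 := ih i l X hX1 hXM (by rw [hX]; linarith)
  have e3 := ih j k Y hY1 hYM hjk
  have e4 := ih j l Y hY1 hYM hjl
  have hkl : 1 ≤ ‖dt (w k) (w l)‖ := h.Sw.V1 _ _ (fun hh => hl0 (h.Jwv.J0 _ _ hh))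
  have hp := plucker (w i) (w j) (w k) (w l)
  have hXY : (S ^ 2 / B) ^ κ = (X / B) ^ κ * (Y / B) ^ κ := by
    rw [← mul_pow]; congr 1
    rw [hX, hY, hB]
    have : (C ^ 2 + C ^ 4) ≠ 0 := by positivity
    have hCC : C ≠ 0 := by positivity
    field_simp
  have hX0 : 0 ≤ (X / B) ^ κ := by apply pow_nonneg; exact div_nonneg (by linarith) hBpos.le
  have hY0 : 0 ≤ (Y / B) ^ κ := by apply pow_nonneg; exact div_nonneg (by linarith) hBpos.le
  calc ‖dt (w i) (w j)‖ ≤ ‖dt (w i) (w j)‖ * ‖dt (w k) (w l)‖ :=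
        le_mul_of_one_le_right (norm_nonneg _) hkl
    _ = ‖dt (w i) (w k) * dt (w j) (w l) - dt (w i) (w l) * dt (w j) (w k)‖ := by
        rw [← norm_mul, hp]
    _ ≤ (1 / 2 * (X / B) ^ κ) * (1 / 2 * (Y / B) ^ κ) + (1 / 2 * (X / B) ^ κ) * (1 / 2 * (Y / B) ^ κ) := by
        refine (norm_sub_le _ _).trans ?_
        rw [norm_mul, norm_mul]
        gcongr
    _ = 1 / 2 * (S ^ 2 / B) ^ κ := by rw [hXY]; ring

lemma growth_small {B R1 b2 S T : ℝ} {m : ℕ} (hB : 0 < B) (hR1 : R1 = 4 * B)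
    (hm : 4 * b2 * B ≤ 4 ^ m) (hS : R1 < S) (hT : T ≤ b2 * (1 + S ^ 2)) (h1 : 1 ≤ R1) :
    T ≤ 1 / 2 * (S ^ 2 / B) ^ (m + 1) := by
  have hS2 : S ≤ S ^ 2 := by nlinarith
  have h4 : 4 ≤ S ^ 2 / B := by rw [le_div_iff₀ hB]; linarith
  have h5 : (4:ℝ) ^ m ≤ (S ^ 2 / B) ^ m := by gcongr
  have h6 : 4 * b2 * S ^ 2 ≤ (S ^ 2 / B) ^ (m + 1) := by
    rw [pow_succ]
    calc 4 * b2 * S ^ 2 = (4 * b2 * B) * (S ^ 2 / B) := by field_simp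
      _ ≤ (S ^ 2 / B) ^ m * (S ^ 2 / B) := by gcongr; exact hm.trans h5
  have h0 : 0 ≤ (S ^ 2 / B) ^ (m + 1) := by positivity
  rcases le_or_gt b2 0 with hb | hb
  · nlinarith [sq_nonneg S]
  · nlinarith

theorem growth {I : Type} {v w : I → ℂ × ℂ} {C : ℝ} (h : FullSys v w C) :
    ∃ A : ℝ, ∃ κ : ℕ, 0 < A ∧ 0 < κ ∧ ∀ i j x, 1 ≤ x → ‖dt (v i) (v j)‖ ≤ x →
      ‖dt (w i) (w j)‖ ≤ A * x ^ κ := by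
  have hC := h.hC
  have hC2 : 1 ≤ C ^ 2 := one_le_pow₀ hC
  have hC4 : 1 ≤ C ^ 4 := one_le_pow₀ hC
  obtain ⟨B, hB⟩ : ∃ B, B = C ^ 2 + C ^ 4 := ⟨_, rfl⟩
  obtain ⟨R1, hR1⟩ : ∃ R1, R1 = 4 * B := ⟨_, rfl⟩
  have hBpos : 0 < B := by linarith
  have hR1pos : 1 ≤ R1 := by linarith
  obtain ⟨b1, hb1⟩ := h.Jvw.J2 (R1 ^ 2)
  obtain ⟨b2, hb2⟩ := h.Jvw.J3 R1
  obtain ⟨m, hm⟩ := pow_unbounded_of_one_lt (max (2 * b1) (max (4 * b2 * B) 0)) (by norm_num : (1:ℝ) < 4)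
  have hm1 : 2 * b1 ≤ 4 ^ m := (le_max_left _ _).trans hm.le
  have hm2 : 4 * b2 * B ≤ 4 ^ m := ((le_max_left _ _).trans (le_max_right _ _)).trans hm.le
  have small : ∀ i j x, R1 ≤ x → ‖dt (v i) (v j)‖ ≤ R1 ^ 2 →
      ‖dt (w i) (w j)‖ ≤ 1 / 2 * (x / B) ^ (m + 1) := by
    intro i j x hx hs
    have h1 := hb1 i j hs
    have h4 : 4 ≤ x / B := by rw [le_div_iff₀ hBpos]; linarith
    have : (4:ℝ) ^ (m + 1) ≤ (x / B) ^ (m + 1) := by gcongr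
    have h5 : (4:ℝ) ^ (m + 1) = 4 * 4 ^ m := by ring
    have h6 : (0:ℝ) < 4 ^ m := by positivity
    linarith
  have main : ∀ n : ℕ, ∀ i j x, R1 ≤ x → x ≤ R1 ^ 2 * 2 ^ n → ‖dt (v i) (v j)‖ ≤ x →
      ‖dt (w i) (w j)‖ ≤ 1 / 2 * (x / B) ^ (m + 1) := by
    intro n
    induction n with
    | zero =>
      intro i j x h1 h2 h3
      exact small i j x h1 (h3.trans (by simpa using h2))
    | succ n ih =>
      intro i j x h1 h2 h3
      by_cases hs : ‖dt (v i) (v j)‖ ≤ R1 ^ 2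
      · exact small i j x h1 hs
      push Not at hs
      obtain ⟨σ, hσ⟩ := IsAlgClosed.exists_pow_nat_eq (dt (v i) (v j)) (n := 2) (by norm_num)
      set S := ‖σ‖ with hSdef
      have hΔ : ‖dt (v i) (v j)‖ = S ^ 2 := by rw [← hσ, norm_pow]
      have hS : R1 < S := by
        rw [hΔ] at hs
        exact lt_of_pow_lt_pow_left₀ 2 (norm_nonneg _) hs
      have hSpos : 0 < S := by linarith
      have hσ0 : σ ≠ 0 := norm_pos_iff.mp hSpos
      obtain ⟨k, hk1, hk2⟩ := h.Sv.V3 (σ⁻¹ • v i) (σ⁻¹ • v j) (by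
        rw [dt_smul_left, dt_smul_right, ← hσ]; field_simp)
      rw [dt_smul_left, norm_mul, norm_inv, inv_mul_le_iff₀ hSpos, mul_comm] at hk1 hk2
      have hM : S ^ 2 ≤ 2 * (R1 ^ 2 * 2 ^ n) := by
        rw [← hΔ]; refine h3.trans (h2.trans (le_of_eq ?_)); ring
      have fin : ‖dt (w i) (w j)‖ ≤ 1 / 2 * (S ^ 2 / B) ^ (m + 1) := by
        have hik : dt (v i) (v k) ≠ 0 := by
          intro h0
          have := h.Sv.V2 i k h0 (v j)
          rw [hΔ, norm_dt_swap] at this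
          have h8 : C * ‖dt (v j) (v k)‖ ≤ C * (C * S) := by gcongr
          have h9 : C ^ 2 < S := by linarith
          nlinarith
        have hjk : dt (v j) (v k) ≠ 0 := by
          intro h0
          have := h.Sv.V2 j k h0 (v i)
          rw [norm_dt_swap, hΔ, norm_dt_swap] at this
          have h8 : C * ‖dt (v i) (v k)‖ ≤ C * (C * S) := by gcongr
          have h9 : C ^ 2 < S := by linarith
          nlinarith
        rcases le_total ‖dt (v j) (v k)‖ ‖dt (v i) (v k)‖ with hab | hab
        · by_cases hE : R1 < ‖dt (v i) (v k)‖
          · exact growth_step h hB hR1 ih hS hΔ hM hk1 hab hE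
          push Not at hE
          have h5 := hb2 k i j (dt_ne_swap hik) (dt_ne_swap hjk) (by rw [norm_dt_swap]; exact hE)
            (by rw [norm_dt_swap]; exact hab.trans hE)
          rw [hΔ] at h5
          exact growth_small hBpos hR1 hm2 hS h5 hR1pos
        · by_cases hE : R1 < ‖dt (v j) (v k)‖
          · rw [norm_dt_swap]
            exact growth_step h hB hR1 ih hS (by rw [norm_dt_swap]; exact hΔ) hM hk2 hab hE
          push Not at hE
          have h5 := hb2 k i j (dt_ne_swap hik) (dt_ne_swap hjk) (by rw [norm_dt_swap]; exact hab.trans hE)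
            (by rw [norm_dt_swap]; exact hE)
          rw [hΔ] at h5
          exact growth_small hBpos hR1 hm2 hS h5 hR1pos
      refine fin.trans ?_
      rw [← hΔ]
      gcongr
  refine ⟨(R1 / B) ^ (m + 1), m + 1, by have : 0 < R1 := by linarith
                                        positivity, by omega, fun i j x hx hd => ?_⟩
  obtain ⟨n, hn⟩ := pow_unbounded_of_one_lt (R1 * x) (by norm_num : (1:ℝ) < 2)
  have := main n i j (R1 * x) (by nlinarith) (by
    have : (2:ℝ) ^ n ≤ R1 ^ 2 * 2 ^ n := le_mul_of_one_le_left (by positivity) (one_le_pow₀ hR1pos)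
    linarith) (hd.trans (by nlinarith))
  refine this.trans ?_
  rw [← mul_pow, show R1 / B * x = R1 * x / B by ring]
  have : 0 ≤ (R1 * x / B) ^ (m + 1) := by positivity
  linarith

open Filter Topology

/-- coordinate of `x` relative to base `(p, y)` -/
noncomputable def zc (p y x : ℂ × ℂ) : ℂ := dt x y / dt p x

lemma dt_coord {p y : ℂ × ℂ} (h : dt p y = 1) (a b : ℂ × ℂ) :
    dt a b = dt a y * dt p b - dt b y * dt p a := by
  have : dt a b * dt p y = dt a y * dt p b - dt b y * dt p a := by simp only [dt]; ring
  rw [h, mul_one] at this; exact this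

lemma zc_sub {p y : ℂ × ℂ} (h : dt p y = 1) {a b : ℂ × ℂ} (ha : dt p a ≠ 0) (hb : dt p b ≠ 0) :
    zc p y a - zc p y b = dt a b / (dt p a * dt p b) := by
  rw [dt_coord h a b, zc, zc]; field_simp

def Near (p y : ℂ × ℂ) (C1 : ℝ) (n : ℕ) (z : ℂ) (x : ℂ × ℂ) : Prop :=
  ‖dt p x‖ ≤ C1 * 2 ^ n ∧ ‖dt x y - z * dt p x‖ * 2 ^ n ≤ C1

lemma near_exists {I : Type} {v : I → ℂ × ℂ} {C : ℝ} (h : SideSys v C) {p y : ℂ × ℂ}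
    (hy : dt p y = 1) (n : ℕ) (z : ℂ) : ∃ j, Near p y C n z (v j) := by
  have h2 : (0:ℝ) < 2 ^ n := by positivity
  have h2c : ((2:ℂ) ^ n) ≠ 0 := pow_ne_zero _ two_ne_zero
  obtain ⟨j, h1, h3⟩ := h.V3 (((2:ℂ) ^ n)⁻¹ • p) ((2:ℂ) ^ n • (y + z • p)) (by
    rw [dt_smul_left, dt_smul_right, dt_add_right, dt_smul_right, dt_self, hy]; field_simp; simp)
  refine ⟨j, ?_, ?_⟩
  · rw [dt_smul_left, norm_mul, norm_inv, norm_pow, Complex.norm_ofNat, inv_mul_le_iff₀ h2] at h1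
    linarith
  · rw [dt_smul_left, norm_mul, norm_pow, Complex.norm_ofNat, dt_add_left, dt_smul_left,
      dt_swap y] at h3
    rw [mul_comm, ← norm_neg]
    rwa [show -(dt (v j) y - z * dt p (v j)) = -dt (v j) y + z * dt p (v j) by ring]

lemma zc_dense {I : Type} {v : I → ℂ × ℂ} {C : ℝ} (h : SideSys v C) (hC : 1 ≤ C) {k : I}
    {y : ℂ × ℂ} (hy : dt (v k) y = 1) (z : ℂ) {ε : ℝ} (hε : 0 < ε) :
    ∃ i, dt (v k) (v i) ≠ 0 ∧ ‖zc (v k) y (v i) - z‖ < ε := by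
  obtain ⟨n, hn⟩ := pow_unbounded_of_one_lt (max (C * C) (C / ε)) (by norm_num : (1:ℝ) < 2)
  have hn1 := (le_max_left _ _).trans_lt hn
  have hn2 := (le_max_right _ _).trans_lt hn
  have h2 : (0:ℝ) < 2 ^ n := by positivity
  obtain ⟨j, h1, h3⟩ := near_exists h hy n z
  have hq : dt (v k) (v j) ≠ 0 := by
    intro h0
    have := h.V2 k j h0 y
    rw [hy, norm_one] at this
    rw [h0, mul_zero, sub_zero] at h3
    have h5 : ‖dt (v j) y‖ * 2 ^ n * C ≤ C * C := by gcongr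
    nlinarith
  refine ⟨j, hq, ?_⟩
  have hq1 := h.V1 _ _ hq
  have : zc (v k) y (v j) - z = (dt (v j) y - z * dt (v k) (v j)) / dt (v k) (v j) := by
    rw [zc]; field_simp
  rw [this, norm_div]
  refine (div_le_self (norm_nonneg _) hq1).trans_lt ?_
  rw [div_lt_iff₀ hε] at hn2
  by_contra hc
  push Not at hc
  have : ε * 2 ^ n ≤ C := (by gcongr : ε * 2 ^ n ≤ _ * 2 ^ n).trans h3
  linarith

lemma near_aux {A C1 C' x Q : ℝ} {κ n : ℕ} {θ : ℝ} (hC1 : 0 < C1) (hA : 0 < A) (hθ0 : 0 < θ)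
    (hθ : 1 / 2 ≤ θ ^ κ) (hκ : 0 < κ) (hC' : 1 ≤ C') (hC'2 : 2 * C1 * A ≤ C')
    (hx : 0 < x) (hQ : Q ≤ A * x ^ κ) (hQ2 : 2 ^ n ≤ 2 * C1 * Q) : 1 ≤ C' * θ ^ n * x := by
  by_contra hc
  push Not at hc
  have h1 : (C' * θ ^ n * x) ^ κ < 1 := pow_lt_one₀ (by positivity) hc (by omega)
  rw [mul_pow, mul_pow] at h1
  have h2 : C' ≤ C' ^ κ := le_self_pow₀ hC' (by omega)
  have h3 : (1 / 2 : ℝ) ^ n ≤ (θ ^ n) ^ κ := by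
    rw [← pow_mul, mul_comm n, pow_mul]; gcongr
  have h4 : 2 ^ n ≤ C' * x ^ κ := by
    calc (2:ℝ) ^ n ≤ 2 * C1 * (A * x ^ κ) := hQ2.trans (by gcongr)
      _ = (2 * C1 * A) * x ^ κ := by ring
      _ ≤ _ := by gcongr
  have h5 : (1:ℝ) ≤ (1 / 2 : ℝ) ^ n * (C' * x ^ κ) := by
    have : (1 / 2 : ℝ) ^ n * 2 ^ n = 1 := by rw [← mul_pow]; norm_num
    calc (1:ℝ) = (1 / 2 : ℝ) ^ n * 2 ^ n := this.symm
      _ ≤ _ := by gcongr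
  have h6 : (1 / 2 : ℝ) ^ n * (C' * x ^ κ) ≤ (θ ^ n) ^ κ * (C' ^ κ * x ^ κ) := by gcongr
  have h7 : (θ ^ n) ^ κ * (C' ^ κ * x ^ κ) = C' ^ κ * (θ ^ n) ^ κ * x ^ κ := by ring
  linarith

theorem near_pair {I : Type} {v w : I → ℂ × ℂ} {C : ℝ} (h : FullSys v w C) :
    ∃ θ : ℝ, 0 < θ ∧ θ < 1 ∧ ∀ C1 : ℝ, 0 < C1 → ∃ C3 : ℝ, ∃ n0 : ℕ, 0 < C3 ∧
      ∀ k y y', dt (v k) y = 1 → dt (w k) y' = 1 → ∀ n, n0 ≤ n → ∀ z j j',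
        Near (v k) y C1 n z (v j) → Near (v k) y C1 n z (v j') →
        dt (v k) (v j) ≠ 0 ∧ ‖zc (w k) y' (w j) - zc (w k) y' (w j')‖ ≤ C3 * θ ^ n := by
  obtain ⟨A, κ, hA, hκ, hgr⟩ := growth h.symm
  have hκr : (1:ℝ) ≤ κ := by exact_mod_cast hκ
  refine ⟨1 - 1 / (2 * κ), ?_, ?_, ?_⟩
  · have : 1 / (2 * (κ:ℝ)) ≤ 1 / 2 := by
      apply one_div_le_one_div_of_le <;> linarith
    linarith
  · have : 0 < 1 / (2 * (κ:ℝ)) := by positivity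
    linarith
  have hθ0 : 0 < 1 - 1 / (2 * (κ:ℝ)) := by
    have : 1 / (2 * (κ:ℝ)) ≤ 1 / 2 := by
      apply one_div_le_one_div_of_le <;> linarith
    linarith
  have hθ : 1 / 2 ≤ (1 - 1 / (2 * (κ:ℝ))) ^ κ := by
    have h1 : 1 / (2 * (κ:ℝ)) ≤ 1 / 2 := by
      apply one_div_le_one_div_of_le <;> linarith
    have := one_add_mul_le_pow (a := -(1 / (2 * (κ:ℝ)))) (by linarith) κ
    have h2 : (κ:ℝ) * -(1 / (2 * (κ:ℝ))) = - (1/2) := by field_simp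
    rw [h2] at this
    rw [sub_eq_add_neg]; linarith
  generalize (1 - 1 / (2 * (κ:ℝ))) = θ at hθ0 hθ
  intro C1 hC1
  obtain ⟨R', hR'⟩ := h.Jvw.J2 (2 * C1 ^ 2)
  obtain ⟨n0, hn0⟩ := pow_unbounded_of_one_lt (C * C1) (by norm_num : (1:ℝ) < 2)
  set C' := max 1 (2 * C1 * A)
  have hC' : 1 ≤ C' := le_max_left _ _
  have hC'2 : 2 * C1 * A ≤ C' := le_max_right _ _
  refine ⟨max R' 1 * C', n0, by positivity, ?_⟩
  intro k y y' hy hy' n hn z j j' hj hj'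
  have h2 : (0:ℝ) < 2 ^ n := by positivity
  have hC := h.hC
  have key : ∀ j, Near (v k) y C1 n z (v j) → dt (v k) (v j) ≠ 0 := by
    intro j hj h0
    have := h.Sv.V2 k j h0 y
    rw [hy, norm_one] at this
    obtain ⟨h1, h3⟩ := hj
    rw [h0, mul_zero, sub_zero] at h3
    have h5 : C * (‖dt (v j) y‖ * 2 ^ n) ≤ C * C1 := by gcongr
    have h6 : (2:ℝ) ^ n0 ≤ 2 ^ n := pow_le_pow_right₀ (by norm_num) hn
    have h7 : 1 * (2:ℝ) ^ n ≤ C * ‖dt (v j) y‖ * 2 ^ n := by gcongr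
    linarith
  have hq := key j hj
  have hq' := key j' hj'
  have hQ : dt (w k) (w j) ≠ 0 := fun hh => hq (h.Jwv.J0 _ _ hh)
  have hQ' : dt (w k) (w j') ≠ 0 := fun hh => hq' (h.Jwv.J0 _ _ hh)
  refine ⟨hq, ?_⟩
  rw [zc_sub hy' hQ hQ', norm_div, norm_mul]
  have hQ1 := h.Sw.V1 _ _ hQ
  have hQ1' := h.Sw.V1 _ _ hQ'
  by_cases hd : dt (v j) (v j') = 0
  · rw [h.Jvw.J0 _ _ hd, norm_zero, zero_div]; positivity
  have hd1 := h.Sv.V1 _ _ hd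
  have e : dt (v j) (v j') = (dt (v j) y - z * dt (v k) (v j)) * dt (v k) (v j')
      - (dt (v j') y - z * dt (v k) (v j')) * dt (v k) (v j) := by
    rw [dt_coord hy (v j) (v j')]; ring
  obtain ⟨a1, a2⟩ := hj
  obtain ⟨b1, b2⟩ := hj'
  have e2 : ‖dt (v j) (v j')‖ * 2 ^ n ≤ C1 * (‖dt (v k) (v j')‖ + ‖dt (v k) (v j)‖) := by
    rw [e]
    calc _ ≤ (‖dt (v j) y - z * dt (v k) (v j)‖ * ‖dt (v k) (v j')‖ +
              ‖dt (v j') y - z * dt (v k) (v j')‖ * ‖dt (v k) (v j)‖) * 2 ^ n := by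
            gcongr
            refine (norm_sub_le _ _).trans ?_
            rw [norm_mul, norm_mul]
      _ = (‖dt (v j) y - z * dt (v k) (v j)‖ * 2 ^ n) * ‖dt (v k) (v j')‖ +
          (‖dt (v j') y - z * dt (v k) (v j')‖ * 2 ^ n) * ‖dt (v k) (v j)‖ := by ring
      _ ≤ C1 * ‖dt (v k) (v j')‖ + C1 * ‖dt (v k) (v j)‖ := by gcongr
      _ = _ := by ring
  have hR : ‖dt (w j) (w j')‖ ≤ R' := by
    apply hR'
    refine le_of_mul_le_mul_right (a := (2:ℝ) ^ n) ?_ h2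
    refine e2.trans ?_
    have : C1 * (‖dt (v k) (v j')‖ + ‖dt (v k) (v j)‖) ≤ C1 * (C1 * 2 ^ n + C1 * 2 ^ n) := by gcongr
    linarith
  have e3 : 2 ^ n ≤ C1 * (‖dt (v k) (v j')‖ + ‖dt (v k) (v j)‖) :=
    (le_mul_of_one_le_left h2.le hd1).trans e2
  have fin : 1 ≤ C' * θ ^ n * (‖dt (w k) (w j)‖ * ‖dt (w k) (w j')‖) := by
    have hp : 0 < C' * θ ^ n := by positivity
    rcases le_total ‖dt (v k) (v j')‖ ‖dt (v k) (v j)‖ with hab | hab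
    · have := near_aux hC1 hA hθ0 hθ hκ hC' hC'2 (x := ‖dt (w k) (w j)‖) (n := n) (by linarith)
        (hgr k j _ hQ1 le_rfl) (e3.trans (by nlinarith))
      refine this.trans ?_
      gcongr
      exact le_mul_of_one_le_right (norm_nonneg _) hQ1'
    · have := near_aux hC1 hA hθ0 hθ hκ hC' hC'2 (x := ‖dt (w k) (w j')‖) (n := n) (by linarith)
        (hgr k j' _ hQ1' le_rfl) (e3.trans (by nlinarith))
      refine this.trans ?_
      gcongr
      exact le_mul_of_one_le_left (norm_nonneg _) hQ1
  have hpos : 0 < ‖dt (w k) (w j)‖ * ‖dt (w k) (w j')‖ := by positivity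
  rw [div_le_iff₀ hpos]
  calc ‖dt (w j) (w j')‖ ≤ max R' 1 * 1 := by rw [mul_one]; exact hR.trans (le_max_left _ _)
    _ ≤ max R' 1 * (C' * θ ^ n * (‖dt (w k) (w j)‖ * ‖dt (w k) (w j')‖)) := by gcongr
    _ = _ := by ring

theorem half_F {I : Type} {v w : I → ℂ × ℂ} {C : ℝ} (h : FullSys v w C) :
    ∃ F : I → ℂ × ℂ → ℂ × ℂ → ℂ → ℂ,
      (∀ k y y', dt (v k) y = 1 → dt (w k) y' = 1 → ∀ i, dt (v k) (v i) ≠ 0 →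
        F k y y' (zc (v k) y (v i)) = zc (w k) y' (w i)) ∧
      (∀ ε > 0, ∃ δ > 0, ∀ k y y', dt (v k) y = 1 → dt (w k) y' = 1 → ∀ z z', ‖z - z'‖ ≤ δ →
        ‖F k y y' z - F k y y' z'‖ < ε) := by
  obtain ⟨θ, hθ0, hθ1, hh⟩ := near_pair h
  have hC := h.hC
  obtain ⟨C3, n0, hC3, hN⟩ := hh (4 * C) (by linarith)
  have ex : ∀ k y y', ∃ f : ℂ → ℂ, dt (v k) y = 1 → dt (w k) y' = 1 → ∀ n, n0 ≤ n → ∀ z j,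
      Near (v k) y (4 * C) n z (v j) → ‖f z - zc (w k) y' (w j)‖ ≤ (C3 + C3 / (1 - θ)) * θ ^ n := by
    intro k y y'
    by_cases hy : dt (v k) y = 1 ∧ dt (w k) y' = 1
    swap
    · exact ⟨0, fun a b => absurd ⟨a, b⟩ hy⟩
    obtain ⟨hy, hy'⟩ := hy
    choose J hJ using fun (z : ℂ) (n : ℕ) => near_exists h.Sv hy n z
    have mono : ∀ z n x, Near (v k) y C n z x → Near (v k) y (4 * C) n z x := by
      intro z n x ⟨a, b⟩
      refine ⟨a.trans ?_, b.trans (by linarith)⟩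
      gcongr; linarith
    have mono2 : ∀ z n x, Near (v k) y C (n + 1) z x → Near (v k) y (4 * C) n z x := by
      intro z n x ⟨a, b⟩
      have h2 : (0:ℝ) < 2 ^ n := by positivity
      constructor
      · refine a.trans ?_
        rw [pow_succ]; nlinarith
      · rw [pow_succ] at b
        have : 0 ≤ ‖dt x y - z * dt (v k) x‖ * 2 ^ n := by positivity
        linarith
    have step : ∀ z n, dist (zc (w k) y' (w (J z (n + n0)))) (zc (w k) y' (w (J z (n + 1 + n0))))
        ≤ (C3 * θ ^ n0) * θ ^ n := by
      intro z n
      rw [dist_eq_norm]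
      refine (hN k y y' hy hy' (n + n0) (by omega) z _ _ (mono _ _ _ (hJ z _))
        (mono2 z _ _ (by have := hJ z (n + 1 + n0); rwa [show n + 1 + n0 = n + n0 + 1 by ring] at this ⊢))).2.trans ?_
      rw [pow_add]; apply le_of_eq; ring
    choose f hf using fun z => cauchySeq_tendsto_of_complete
      (cauchySeq_of_le_geometric θ (C3 * θ ^ n0) hθ1 (step z))
    refine ⟨f, fun _ _ n hn z j hj => ?_⟩
    obtain ⟨m, rfl⟩ : ∃ m, n = m + n0 := ⟨n - n0, by omega⟩
    have h1 := dist_le_of_le_geometric_of_tendsto θ (C3 * θ ^ n0) hθ1 (step z) (hf z) m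
    have h2 := (hN k y y' hy hy' (m + n0) (by omega) z _ _ (mono _ _ _ (hJ z (m + n0))) hj).2
    rw [dist_eq_norm, norm_sub_rev] at h1
    calc ‖f z - zc (w k) y' (w j)‖ = ‖(f z - zc (w k) y' (w (J z (m + n0)))) +
            (zc (w k) y' (w (J z (m + n0))) - zc (w k) y' (w j))‖ := by congr 1; ring
      _ ≤ _ := norm_add_le _ _
      _ ≤ C3 * θ ^ n0 * θ ^ m / (1 - θ) + C3 * θ ^ (m + n0) := add_le_add h1 h2
      _ = _ := by rw [pow_add]; ring
  choose F hF using ex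
  have hθ' : 0 < 1 - θ := by linarith
  have small : ∀ ε > 0, ∀ c : ℝ, 0 < c → ∃ n, n0 ≤ n ∧ c * θ ^ n < ε := by
    intro ε hε c hc
    obtain ⟨n, hn⟩ := exists_pow_lt_of_lt_one (show 0 < ε / c by positivity) hθ1
    refine ⟨max n n0, le_max_right _ _, ?_⟩
    have : θ ^ (max n n0) ≤ θ ^ n := pow_le_pow_of_le_one hθ0.le hθ1.le (le_max_left _ _)
    rw [lt_div_iff₀ hc] at hn
    nlinarith
  refine ⟨F, ?_, ?_⟩
  · intro k y y' hy hy' i hi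
    obtain ⟨N, hN'⟩ := pow_unbounded_of_one_lt ‖dt (v k) (v i)‖ (by norm_num : (1:ℝ) < 2)
    rw [← sub_eq_zero, ← norm_le_zero_iff]
    refine le_of_forall_pos_le_add fun ε hε => ?_
    obtain ⟨n, hn, hlt⟩ := small ε hε (C3 + C3 / (1 - θ)) (by positivity)
    have h1 := hF k y y' hy hy' (max n N) (hn.trans (le_max_left _ _)) (zc (v k) y (v i)) i (by
      constructor
      · have : (2:ℝ) ^ N ≤ 2 ^ (max n N) := pow_le_pow_right₀ (by norm_num) (le_max_right _ _)
        have h3 : (0:ℝ) < 2 ^ (max n N) := by positivity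
        nlinarith
      · have : dt (v i) y - zc (v k) y (v i) * dt (v k) (v i) = 0 := by rw [zc]; field_simp; ring
        rw [this, norm_zero, zero_mul]; linarith)
    have : θ ^ (max n N) ≤ θ ^ n := pow_le_pow_of_le_one hθ0.le hθ1.le (le_max_left _ _)
    have h4 : 0 < C3 + C3 / (1 - θ) := by positivity
    nlinarith
  · intro ε hε
    obtain ⟨n, hn, hlt⟩ := small ε hε (2 * (C3 + C3 / (1 - θ))) (by positivity)
    refine ⟨(1 / 4) ^ n, by positivity, ?_⟩
    intro k y y' hy hy' z z' hz
    obtain ⟨j, hj1, hj2⟩ := near_exists h.Sv hy n z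
    have h2 : (0:ℝ) < 2 ^ n := by positivity
    have a1 := hF k y y' hy hy' n hn z j ⟨hj1.trans (by gcongr; linarith), hj2.trans (by linarith)⟩
    have a2 := hF k y y' hy hy' n hn z' j ⟨hj1.trans (by gcongr; linarith), by
      have : dt (v j) y - z' * dt (v k) (v j) = (dt (v j) y - z * dt (v k) (v j)) +
        (z - z') * dt (v k) (v j) := by ring
      rw [this]
      have h5 : ‖(z - z') * dt (v k) (v j)‖ ≤ (1 / 4) ^ n * (C * 2 ^ n) := by
        rw [norm_mul]; gcongr
      have h6 : (1 / 4 : ℝ) ^ n * (C * 2 ^ n) * 2 ^ n = C := by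
        have : (1 / 4 : ℝ) ^ n * 2 ^ n * 2 ^ n = 1 := by rw [← mul_pow, ← mul_pow]; norm_num
        linear_combination C * this
      calc _ ≤ (‖dt (v j) y - z * dt (v k) (v j)‖ + (1 / 4) ^ n * (C * 2 ^ n)) * 2 ^ n := by
            gcongr; exact (norm_add_le _ _).trans (by gcongr)
        _ ≤ _ := by rw [add_mul, h6]; linarith⟩
    calc _ = ‖(F k y y' z - zc (w k) y' (w j)) - (F k y y' z' - zc (w k) y' (w j))‖ := by
          congr 1; ring
      _ ≤ _ := norm_sub_le _ _
      _ ≤ 2 * (C3 + C3 / (1 - θ)) * θ ^ n := by linarith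
      _ < ε := hlt

structure HomeoFam {I : Type} (v w : I → ℂ × ℂ) (F G : I → ℂ × ℂ → ℂ × ℂ → ℂ → ℂ) : Prop where
  cusp : ∀ k y y', dt (v k) y = 1 → dt (w k) y' = 1 → ∀ i, dt (v k) (v i) ≠ 0 →
        F k y y' (zc (v k) y (v i)) = zc (w k) y' (w i)
  ucF : ∀ ε > 0, ∃ δ > 0, ∀ k y y', dt (v k) y = 1 → dt (w k) y' = 1 → ∀ z z', ‖z - z'‖ ≤ δ →
        ‖F k y y' z - F k y y' z'‖ < ε
  ucG : ∀ ε > 0, ∃ δ > 0, ∀ k y y', dt (v k) y = 1 → dt (w k) y' = 1 → ∀ z z', ‖z - z'‖ ≤ δ →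
        ‖G k y y' z - G k y y' z'‖ < ε
  GF : ∀ k y y', dt (v k) y = 1 → dt (w k) y' = 1 → ∀ z, G k y y' (F k y y' z) = z
  FG : ∀ k y y', dt (v k) y = 1 → dt (w k) y' = 1 → ∀ z, F k y y' (G k y y' z) = z

lemma HomeoFam.contF {I : Type} {v w : I → ℂ × ℂ} {F G} (h : HomeoFam v w F G) {k y y'}
    (hy : dt (v k) y = 1) (hy' : dt (w k) y' = 1) : Continuous (F k y y') := by
  rw [Metric.continuous_iff]
  intro b ε hε
  obtain ⟨δ, hδ, hh⟩ := h.ucF ε hε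
  exact ⟨δ, hδ, fun a ha => by
    rw [dist_eq_norm] at ha ⊢; exact hh k y y' hy hy' a b ha.le⟩

lemma HomeoFam.contG {I : Type} {v w : I → ℂ × ℂ} {F G} (h : HomeoFam v w F G) {k y y'}
    (hy : dt (v k) y = 1) (hy' : dt (w k) y' = 1) : Continuous (G k y y') := by
  rw [Metric.continuous_iff]
  intro b ε hε
  obtain ⟨δ, hδ, hh⟩ := h.ucG ε hε
  exact ⟨δ, hδ, fun a ha => by
    rw [dist_eq_norm] at ha ⊢; exact hh k y y' hy hy' a b ha.le⟩

lemma cusp_denseSet {I : Type} {v : I → ℂ × ℂ} {C : ℝ} (h : SideSys v C) (hC : 1 ≤ C) {k : I}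
    {y : ℂ × ℂ} (hy : dt (v k) y = 1) :
    Dense {z | ∃ i, dt (v k) (v i) ≠ 0 ∧ z = zc (v k) y (v i)} := by
  intro z
  rw [Metric.mem_closure_iff]
  intro ε hε
  obtain ⟨i, hi, hlt⟩ := zc_dense h hC hy z hε
  exact ⟨_, ⟨i, hi, rfl⟩, by rw [dist_comm, dist_eq_norm]; exact hlt⟩

theorem exists_homeoFam {I : Type} {v w : I → ℂ × ℂ} {C : ℝ} (h : FullSys v w C) :
    ∃ F G, HomeoFam v w F G := by
  obtain ⟨F, hF1, hF2⟩ := half_F h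
  obtain ⟨G, hG1, hG2⟩ := half_F h.symm
  have cF : ∀ k y y', dt (v k) y = 1 → dt (w k) y' = 1 → Continuous (F k y y') := by
    intro k y y' hy hy'
    rw [Metric.continuous_iff]
    intro b ε hε
    obtain ⟨δ, hδ, hh⟩ := hF2 ε hε
    exact ⟨δ, hδ, fun a ha => by
      rw [dist_eq_norm] at ha ⊢; exact hh k y y' hy hy' a b ha.le⟩
  have cG : ∀ k y y', dt (w k) y = 1 → dt (v k) y' = 1 → Continuous (G k y y') := by
    intro k y y' hy hy'
    rw [Metric.continuous_iff]
    intro b ε hε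
    obtain ⟨δ, hδ, hh⟩ := hG2 ε hε
    exact ⟨δ, hδ, fun a ha => by
      rw [dist_eq_norm] at ha ⊢; exact hh k y y' hy hy' a b ha.le⟩
  refine ⟨F, fun k y y' => G k y' y, ⟨hF1, hF2, ?_, ?_, ?_⟩⟩
  · intro ε hε
    obtain ⟨δ, hδ, hh⟩ := hG2 ε hε
    exact ⟨δ, hδ, fun k y y' hy hy' => hh k y' y hy' hy⟩
  · intro k y y' hy hy'
    refine congrFun (Continuous.ext_on (cusp_denseSet h.Sv h.hC hy)
      ((cG _ _ _ hy' hy).comp (cF _ _ _ hy hy')) continuous_id ?_)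
    rintro z ⟨i, hi, rfl⟩
    simp only [Function.comp, id]
    rw [hF1 k y y' hy hy' i hi, hG1 k y' y hy' hy i (fun hh => hi (h.Jwv.J0 _ _ hh))]
  · intro k y y' hy hy'
    refine congrFun (Continuous.ext_on (cusp_denseSet h.Sw h.hC hy')
      ((cF _ _ _ hy hy').comp (cG _ _ _ hy' hy)) continuous_id ?_)
    rintro z ⟨i, hi, rfl⟩
    simp only [Function.comp, id]
    rw [hG1 k y' y hy' hy i hi, hF1 k y y' hy hy' i (fun hh => hi (h.Jvw.J0 _ _ hh))]

open Filter Topology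

theorem base_change {I : Type} {v w : I → ℂ × ℂ} {C : ℝ} (h : FullSys v w C) {F G}
    (H : HomeoFam v w F G) {o k : I} {y y' u u' : ℂ × ℂ} (hy : dt (v o) y = 1)
    (hy' : dt (w o) y' = 1) (hu : dt (v k) u = 1) (hu' : dt (w k) u' = 1)
    (hq : dt (v o) (v k) ≠ 0) (z : ℂ) :
    F o y y' z = zc (w o) y' (w k) - 1 / (dt (w o) (w k) ^ 2 *
      (F k u u' (zc (v k) u (v o) - 1 / (dt (v o) (v k) ^ 2 * (z - zc (v o) y (v k)))) -
        F k u u' (zc (v k) u (v o)))) := by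
  have hq' : dt (w o) (w k) ≠ 0 := fun hh => hq (h.Jwv.J0 _ _ hh)
  by_cases hz : z = zc (v o) y (v k)
  · rw [hz, H.cusp o y y' hy hy' k hq]; simp
  have hz' : z - zc (v o) y (v k) ≠ 0 := sub_ne_zero.mpr hz
  set D := {z | ∃ i, dt (v o) (v i) ≠ 0 ∧ z = zc (v o) y (v i)}
  have hD : z ∈ closure D := cusp_denseSet h.Sv h.hC hy z
  have hne : (𝓝[D] z).NeBot := mem_closure_iff_nhdsWithin_neBot.mp hD
  have cF := H.contF hu hu'
  have hinj : ∀ a b, F k u u' a = F k u u' b → a = b := fun a b hab => by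
    rw [← H.GF k u u' hu hu' a, ← H.GF k u u' hu hu' b, hab]
  have hcont : ContinuousAt (fun z => zc (w o) y' (w k) - 1 / (dt (w o) (w k) ^ 2 *
      (F k u u' (zc (v k) u (v o) - 1 / (dt (v o) (v k) ^ 2 * (z - zc (v o) y (v k)))) -
        F k u u' (zc (v k) u (v o))))) z := by
    refine ContinuousAt.sub continuousAt_const (ContinuousAt.div continuousAt_const ?_ ?_)
    · refine ContinuousAt.mul continuousAt_const (ContinuousAt.sub ?_ continuousAt_const)
      refine cF.continuousAt.comp ?_
      refine ContinuousAt.sub continuousAt_const (ContinuousAt.div continuousAt_const ?_ ?_)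
      · fun_prop
      · exact mul_ne_zero (pow_ne_zero _ hq) hz'
    · refine mul_ne_zero (pow_ne_zero _ hq') (sub_ne_zero.mpr fun hh => ?_)
      have h1 := hinj _ _ hh
      have h2 : 1 / (dt (v o) (v k) ^ 2 * (z - zc (v o) y (v k))) ≠ 0 :=
        one_div_ne_zero (mul_ne_zero (pow_ne_zero _ hq) hz')
      exact h2 (by linear_combination -h1)
  have hF : ContinuousAt (F o y y') z := (H.contF hy hy').continuousAt
  refine tendsto_nhds_unique_of_eventuallyEq (l := 𝓝[D] z) (hF.tendsto.mono_left nhdsWithin_le_nhds)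
    (hcont.tendsto.mono_left nhdsWithin_le_nhds) ?_
  have hopen : ∀ᶠ z1 in 𝓝[D] z, z1 ≠ zc (v o) y (v k) :=
    nhdsWithin_le_nhds (isOpen_ne.mem_nhds hz)
  filter_upwards [hopen, self_mem_nhdsWithin] with z1 hz1 hz1D
  obtain ⟨i, hi, rfl⟩ := hz1D
  have e1 := zc_sub hy hi hq
  have hik : dt (v k) (v i) ≠ 0 := by
    intro h0
    apply hz1
    rw [← sub_eq_zero, e1, dt_swap, h0]; simp
  have hi' : dt (w o) (w i) ≠ 0 := fun hh => hi (h.Jwv.J0 _ _ hh)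
  have hik' : dt (w k) (w i) ≠ 0 := fun hh => hik (h.Jwv.J0 _ _ hh)
  have e2 := zc_sub hu hik (dt_ne_swap hq)
  have e1' := zc_sub hy' hi' hq'
  have e2' := zc_sub hu' hik' (dt_ne_swap hq')
  rw [e1, H.cusp o y y' hy hy' i hi, H.cusp k u u' hu hu' o (dt_ne_swap hq)]
  have e3 : zc (v k) u (v o) - 1 / (dt (v o) (v k) ^ 2 * (dt (v i) (v k) / (dt (v o) (v i) * dt (v o) (v k))))
      = zc (v k) u (v i) := by
    rw [← sub_eq_zero, sub_right_comm, sub_eq_zero, ← neg_sub, e2, dt_swap (v i) (v k),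
      dt_swap (v i) (v o), dt_swap (v k) (v o)]
    field_simp
  rw [e3, H.cusp k u u' hu hu' i hik, e2']
  rw [← sub_eq_zero, sub_sub_eq_add_sub, add_sub_right_comm, e1', dt_swap (w i) (w k),
      dt_swap (w i) (w o), dt_swap (w k) (w o)]
  field_simp
  ring

lemma chain_bound {f : ℂ → ℂ} {δ : ℝ} (hδ : 0 < δ)
    (hf : ∀ z z', ‖z - z'‖ ≤ δ → ‖f z - f z'‖ < 1) (z z' : ℂ) :
    ‖f z - f z'‖ ≤ ‖z - z'‖ / δ + 1 := by
  have key : ∀ n : ℕ, ∀ z z', ‖z - z'‖ ≤ n * δ → ‖f z - f z'‖ ≤ n := by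
    intro n
    induction n with
    | zero =>
      intro z z' hz
      simp only [Nat.cast_zero, zero_mul, norm_le_zero_iff, sub_eq_zero] at hz
      simp [hz]
    | succ n ih =>
      intro z z' hz
      push_cast at hz ⊢
      set t : ℂ := z' + ((n / (n + 1) : ℝ) : ℂ) * (z - z')
      have hn : (0:ℝ) < n + 1 := by positivity
      have h1 : ‖t - z'‖ ≤ n * δ := by
        rw [show t - z' = ((n / (n + 1) : ℝ) : ℂ) * (z - z') by simp [t], norm_mul,
          Complex.norm_real, Real.norm_of_nonneg (by positivity), div_mul_eq_mul_div,
          div_le_iff₀ hn]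
        have : (n:ℝ) * ‖z - z'‖ ≤ n * ((n + 1) * δ) := by gcongr
        linarith
      have h2 : ‖z - t‖ ≤ δ := by
        have : z - t = ((1 / (n + 1) : ℝ) : ℂ) * (z - z') := by
          have hn' : ((n:ℂ) + 1) ≠ 0 := by exact_mod_cast hn.ne'
          simp only [t]; push_cast; field_simp; ring
        rw [this, norm_mul, Complex.norm_real, Real.norm_of_nonneg (by positivity), div_mul_eq_mul_div,
          div_le_iff₀ hn]
        linarith
      have h3 := ih t z' h1
      have h4 := hf z t h2
      have := norm_sub_le_norm_sub_add_norm_sub (f z) (f t) (f z')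
      linarith
  refine (key ⌈‖z - z'‖ / δ⌉₊ z z' ?_).trans (Nat.ceil_lt_add_one (by positivity)).le
  rw [← div_le_iff₀ hδ]
  exact Nat.le_ceil _

theorem LL {I : Type} {v w : I → ℂ × ℂ} {F G} (H : HomeoFam v w F G) {ε : ℝ} (hε : 0 < ε) :
    ∃ c Cc : ℝ, 0 < c ∧ 0 < Cc ∧ ∀ k y y', dt (v k) y = 1 → dt (w k) y' = 1 → ∀ Y Y',
      ε ≤ ‖Y - Y'‖ → c * ‖Y - Y'‖ ≤ ‖F k y y' Y - F k y y' Y'‖ ∧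
        ‖F k y y' Y - F k y y' Y'‖ ≤ Cc * ‖Y - Y'‖ := by
  obtain ⟨δ, hδ, h1⟩ := H.ucF 1 one_pos
  obtain ⟨δ', hδ', h2⟩ := H.ucG 1 one_pos
  obtain ⟨η, hη, h3⟩ := H.ucG ε hε
  refine ⟨(1 / δ' + 1 / η)⁻¹, 1 / δ + 1 / ε, by positivity, by positivity, ?_⟩
  intro k y y' hy hy' Y Y' hYY
  constructor
  · rw [inv_mul_le_iff₀ (by positivity)]
    have a := chain_bound hδ' (h2 k y y' hy hy') (F k y y' Y) (F k y y' Y')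
    rw [H.GF k y y' hy hy', H.GF k y y' hy hy'] at a
    have b : η ≤ ‖F k y y' Y - F k y y' Y'‖ := by
      by_contra hc
      push Not at hc
      have := h3 k y y' hy hy' _ _ hc.le
      rw [H.GF k y y' hy hy', H.GF k y y' hy hy'] at this
      linarith
    have : 1 ≤ ‖F k y y' Y - F k y y' Y'‖ / η := by rwa [one_le_div hη]
    rw [add_mul, one_div_mul_eq_div, one_div_mul_eq_div]; linarith
  · have a := chain_bound hδ (h1 k y y' hy hy') Y Y'
    have : 1 ≤ ‖Y - Y'‖ / ε := by rwa [one_le_div hε]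
    rw [add_mul, one_div_mul_eq_div, one_div_mul_eq_div]; linarith

lemma inversion_ball {Z0 T : ℂ} {ρ : ℝ} (hρ : 0 < ρ) (hZ : 4 * ρ ≤ ‖Z0‖)
    (hT : ‖T - 1 / Z0‖ < ρ / (2 * ‖Z0‖ ^ 2)) : T ≠ 0 ∧ ‖1 / T - Z0‖ < ρ := by
  have hZpos : 0 < ‖Z0‖ := by linarith
  have hZ0 : Z0 ≠ 0 := norm_pos_iff.mp hZpos
  rw [lt_div_iff₀ (by positivity)] at hT
  have e : T * Z0 - 1 = (T - 1 / Z0) * Z0 := by field_simp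
  have h1 : ‖T * Z0 - 1‖ * (2 * ‖Z0‖) < ρ := by
    rw [e, norm_mul]; nlinarith
  have h2 : ‖T * Z0 - 1‖ ≤ 1 / 8 := by
    by_contra hc
    push Not at hc
    nlinarith [norm_nonneg (T * Z0 - 1)]
  have h3 : 7 / 8 ≤ ‖T * Z0‖ := by
    have := norm_sub_norm_le (1:ℂ) (1 - T * Z0)
    rw [norm_one, norm_sub_rev, sub_sub_cancel] at this
    linarith
  have hT0 : T ≠ 0 := by
    rintro rfl; simp at h3; linarith
  refine ⟨hT0, ?_⟩
  have e2 : 1 / T - Z0 = (1 - T * Z0) * Z0 / (T * Z0) := by field_simp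
  rw [e2, norm_div, norm_mul, norm_sub_rev, div_lt_iff₀ (by linarith)]
  nlinarith [norm_nonneg (T * Z0 - 1)]

lemma qs_core {f fk : ℂ → ℂ} {s x x' K Q z h : ℂ} {c Cc ε C : ℝ} (hc : 0 < c) (hCc : 0 < Cc)
    (hC : 1 ≤ C) (hε : ε = 1 / (100 * C ^ 2))
    (hLL : ∀ Y Y', ε ≤ ‖Y - Y'‖ → c * ‖Y - Y'‖ ≤ ‖fk Y - fk Y'‖ ∧ ‖fk Y - fk Y'‖ ≤ Cc * ‖Y - Y'‖)
    (hsurj : ∀ W, ∃ Y, fk Y = W) (hK : K ≠ 0) (hQ : Q ≠ 0)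
    (hf : ∀ z, f z = x' - 1 / (K * (fk (s - 1 / (Q * (z - x))) - fk s)))
    (hh : 0 < ‖h‖) (hxz : ‖Q‖ * ‖z - x‖ ^ 2 ≤ C ^ 2 * ‖h‖) (hQh : ‖Q‖ * ‖h‖ ≤ C ^ 2) :
    (∃ ξ, Metric.ball ξ (c / (8 * Cc ^ 2) * (‖h‖ * ‖Q‖ / ‖K‖)) ⊆ f '' Metric.ball z (5 * ‖h‖)) ∧
    ‖f (z + h) - f z‖ ≤ (3 * Cc / c ^ 2 + 6 / c) * (‖h‖ * ‖Q‖ / ‖K‖) := by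
  have hN : 0 < ‖Q‖ := norm_pos_iff.mpr hQ
  have hKp : 0 < ‖K‖ := norm_pos_iff.mpr hK
  have hC2 : 0 < C ^ 2 := by positivity
  have hεpos : 0 < ε := by rw [hε]; positivity
  constructor
  · obtain ⟨z1, hz1, hD1, hD2⟩ : ∃ z1, ‖z1 - z‖ ≤ 3 * ‖h‖ ∧ ‖h‖ ≤ ‖z1 - x‖ ∧
        ‖Q‖ * ‖z1 - x‖ ^ 2 ≤ 25 * C ^ 2 * ‖h‖ := by
      by_cases hcase : 2 * ‖h‖ ≤ ‖z - x‖
      · exact ⟨z, by simp, by linarith, hxz.trans (by gcongr; linarith)⟩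
      · push Not at hcase
        refine ⟨z + 3 * h, by simp, ?_, ?_⟩
        · have := norm_sub_norm_le (3 * h) (x - z)
          rw [norm_mul, norm_sub_rev x z, show 3 * h - (x - z) = z + 3 * h - x by ring] at this
          norm_num at this
          linarith
        · have : ‖z + 3 * h - x‖ ≤ 5 * ‖h‖ := by
            rw [show z + 3 * h - x = (z - x) + 3 * h by ring]
            refine (norm_add_le _ _).trans ?_
            rw [norm_mul]; norm_num; linarith
          calc ‖Q‖ * ‖z + 3 * h - x‖ ^ 2 ≤ ‖Q‖ * (5 * ‖h‖) ^ 2 := by gcongr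
            _ = 25 * (‖Q‖ * ‖h‖) * ‖h‖ := by ring
            _ ≤ _ := by gcongr
    set D := ‖z1 - x‖
    have hDpos : 0 < D := by linarith
    have hz1x : z1 - x ≠ 0 := norm_pos_iff.mp hDpos
    set τ := ‖h‖ / (‖Q‖ * D ^ 2) with hτ
    have hτpos : 0 < τ := by positivity
    have hτε : ε ≤ τ / 4 := by
      rw [hε, hτ, div_div, div_le_div_iff₀ (by positivity) (by positivity)]
      nlinarith
    set Y1 := s - 1 / (Q * (z1 - x)) with hY1
    have hY1s : ‖Y1 - s‖ = 1 / (‖Q‖ * D) := by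
      rw [hY1, sub_sub_cancel_left, norm_neg, norm_div, norm_one, norm_mul]
    have hτY : τ ≤ ‖Y1 - s‖ := by
      rw [hY1s, hτ, div_le_div_iff₀ (by positivity) (by positivity)]
      have : ‖h‖ * (‖Q‖ * D) ≤ D * (‖Q‖ * D) := by gcongr
      nlinarith
    set Z0 := fk Y1 - fk s with hZ0
    obtain ⟨hl, hu⟩ := hLL Y1 s (by linarith)
    rw [← hZ0] at hl hu
    have hZpos : 0 < ‖Z0‖ := by
      have : 0 < c * ‖Y1 - s‖ := mul_pos hc (by linarith)
      linarith
    have hrad : c / (8 * Cc ^ 2) * (‖h‖ * ‖Q‖ / ‖K‖) ≤ (c * τ / 4) / (2 * ‖Z0‖ ^ 2) / ‖K‖ := by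
      have h1 : ‖Z0‖ ^ 2 ≤ Cc ^ 2 * (1 / (‖Q‖ * D)) ^ 2 := by
        rw [← hY1s, ← mul_pow]; gcongr
      calc c / (8 * Cc ^ 2) * (‖h‖ * ‖Q‖ / ‖K‖)
          = (c * τ / 4) / (2 * (Cc ^ 2 * (1 / (‖Q‖ * D)) ^ 2)) / ‖K‖ := by
            rw [hτ]; field_simp; ring
        _ ≤ _ := by gcongr
    refine ⟨x' - 1 / (K * Z0), ?_⟩
    intro ζ hζ
    rw [Metric.mem_ball, dist_eq_norm] at hζ
    have hζ2 := hζ.trans_le hrad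
    have hZne : Z0 ≠ 0 := norm_pos_iff.mp hZpos
    have hT : ‖K * (x' - ζ) - 1 / Z0‖ < (c * τ / 4) / (2 * ‖Z0‖ ^ 2) := by
      have : K * (x' - ζ) - 1 / Z0 = - (K * (ζ - (x' - 1 / (K * Z0)))) := by field_simp; ring
      rw [this, norm_neg, norm_mul, mul_comm, ← lt_div_iff₀ hKp]; exact hζ2
    obtain ⟨hT0, hT1⟩ := inversion_ball (by positivity)
      (by have : c * τ ≤ c * ‖Y1 - s‖ := by gcongr
          linarith) hT
    obtain ⟨Y, hY⟩ := hsurj (1 / (K * (x' - ζ)) + fk s)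
    have hYY1 : ‖Y - Y1‖ < τ / 4 := by
      by_contra hcon
      push Not at hcon
      have := (hLL Y Y1 (hτε.trans hcon)).1
      rw [hY, show 1 / (K * (x' - ζ)) + fk s - fk Y1 = 1 / (K * (x' - ζ)) - Z0 by rw [hZ0]; ring] at this
      nlinarith
    have hYs : 3 / 4 * ‖Y1 - s‖ ≤ ‖Y - s‖ := by
      have := norm_sub_norm_le (Y1 - s) (Y1 - Y)
      rw [norm_sub_rev Y1 Y, show Y1 - s - (Y1 - Y) = Y - s by ring] at this
      linarith
    have hYspos : 0 < ‖Y - s‖ := by linarith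
    have hYs0 : Y - s ≠ 0 := norm_pos_iff.mp hYspos
    have hY1s0 : Y1 - s ≠ 0 := by
      rw [hY1, sub_sub_cancel_left]; exact neg_ne_zero.mpr (one_div_ne_zero (mul_ne_zero hQ hz1x))
    refine ⟨x - 1 / (Q * (Y - s)), ?_, ?_⟩
    · rw [Metric.mem_ball, dist_eq_norm]
      have e1 : z1 = x - 1 / (Q * (Y1 - s)) := by
        rw [hY1, sub_sub_cancel_left]; field_simp; ring
      have e2 : x - 1 / (Q * (Y - s)) - z1 = (Y - Y1) / (Q * (Y - s) * (Y1 - s)) := by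
        rw [e1]
        field_simp; ring
      have e3 : ‖x - 1 / (Q * (Y - s)) - z1‖ ≤ ‖h‖ / 3 := by
        rw [e2, norm_div, norm_mul, norm_mul]
        have hp : 0 < ‖Y1 - s‖ := by linarith
        have : ‖Q‖ * (3 / 4 * ‖Y1 - s‖) * ‖Y1 - s‖ ≤ ‖Q‖ * ‖Y - s‖ * ‖Y1 - s‖ := by gcongr
        calc _ ≤ (τ / 4) / (‖Q‖ * (3 / 4 * ‖Y1 - s‖) * ‖Y1 - s‖) := by gcongr
          _ = ‖h‖ / 3 := by rw [hY1s, hτ]; field_simp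
      calc ‖x - 1 / (Q * (Y - s)) - z‖ = ‖(x - 1 / (Q * (Y - s)) - z1) + (z1 - z)‖ := by
            congr 1; ring
        _ ≤ _ := norm_add_le _ _
        _ < 5 * ‖h‖ := by linarith
    · rw [hf]
      have : s - 1 / (Q * (x - 1 / (Q * (Y - s)) - x)) = Y := by
        rw [sub_sub_cancel_left]; field_simp; ring
      rw [this, hY, add_sub_cancel_right]
      have hxζ : x' - ζ ≠ 0 := right_ne_zero_of_mul hT0
      field_simp; ring
  · have hyp : ∀ ζ, ζ ≠ x → ‖s - 1 / (Q * (ζ - x)) - s‖ = 1 / (‖Q‖ * ‖ζ - x‖) := by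
      intro ζ _
      rw [sub_sub_cancel_left, norm_neg, norm_div, norm_one, norm_mul]
    by_cases hcase : 2 * ‖h‖ ≤ ‖z - x‖
    · set D := ‖z - x‖
      have hDpos : 0 < D := by linarith
      have hzx : z - x ≠ 0 := norm_pos_iff.mp hDpos
      set D2 := ‖z + h - x‖ with hD2
      have hD2a : D2 ≤ 3 / 2 * D := by
        rw [hD2, show z + h - x = (z - x) + h by ring]
        exact (norm_add_le _ _).trans (by linarith)
      have hD2b : 1 / 2 * D ≤ D2 := by
        have := norm_sub_norm_le (z - x) (-h)
        rw [norm_neg, show z - x - -h = z + h - x by ring] at this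
        linarith
      have hD2pos : 0 < D2 := by linarith
      have hzhx : z + h - x ≠ 0 := norm_pos_iff.mp hD2pos
      set Ya := s - 1 / (Q * (z - x)) with hYa
      set Yb := s - 1 / (Q * (z + h - x)) with hYb
      have hNC : ‖Q‖ * ‖h‖ ≤ C ^ 2 := hQh
      have ea : ‖Ya - s‖ = 1 / (‖Q‖ * D) := hyp z (sub_ne_zero.mp hzx)
      have eb : ‖Yb - s‖ = 1 / (‖Q‖ * D2) := hyp (z + h) (sub_ne_zero.mp hzhx)
      have eab : ‖Ya - Yb‖ = ‖h‖ / (‖Q‖ * D * D2) := by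
        have : Ya - Yb = - (h / (Q * (z - x) * (z + h - x))) := by
          rw [hYa, hYb]; field_simp; ring
        rw [this, norm_neg, norm_div, norm_mul, norm_mul]
      have hDD : D * D2 ≤ 3 / 2 * D ^ 2 := by nlinarith
      have lab : ε ≤ ‖Ya - Yb‖ := by
        rw [eab, hε, div_le_div_iff₀ (by positivity) (by positivity)]
        have : ‖Q‖ * (D * D2) ≤ ‖Q‖ * (3 / 2 * D ^ 2) := by gcongr
        nlinarith
      have la : ε ≤ ‖Ya - s‖ := by
        refine lab.trans ?_
        rw [ea, eab, div_le_div_iff₀ (by positivity) (by positivity)]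
        have : ‖h‖ ≤ D2 := by linarith
        have h5 : ‖h‖ * (‖Q‖ * D) ≤ D2 * (‖Q‖ * D) := by gcongr
        linarith
      have lb : ε ≤ ‖Yb - s‖ := by
        refine lab.trans ?_
        rw [eb, eab, div_le_div_iff₀ (by positivity) (by positivity)]
        have h5 : ‖h‖ * (‖Q‖ * D2) ≤ D * (‖Q‖ * D2) := by gcongr; linarith
        linarith
      have ga := (hLL Ya s la).1
      have gb := (hLL Yb s lb).1
      have gab := (hLL Ya Yb lab).2
      rw [ea] at ga
      rw [eb] at gb
      rw [eab] at gab
      have pa : 0 < ‖fk Ya - fk s‖ := lt_of_lt_of_le (by positivity) ga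
      have pb : 0 < ‖fk Yb - fk s‖ := lt_of_lt_of_le (by positivity) gb
      have na := norm_pos_iff.mp pa
      have nb := norm_pos_iff.mp pb
      have e : f (z + h) - f z = - ((fk Ya - fk Yb) / (K * ((fk Ya - fk s) * (fk Yb - fk s)))) := by
        rw [hf, hf]
        rw [← hYa, ← hYb]
        field_simp; ring
      rw [e, norm_neg, norm_div, norm_mul, norm_mul]
      calc _ ≤ (Cc * (‖h‖ / (‖Q‖ * D * D2))) / (‖K‖ * ((c * (1 / (‖Q‖ * D))) * (c * (1 / (‖Q‖ * D2))))) := by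
            gcongr
        _ = Cc / c ^ 2 * (‖h‖ * ‖Q‖ / ‖K‖) := by field_simp
        _ ≤ _ := by
            gcongr
            have : 0 < 6 / c := by positivity
            have h2 : 0 < Cc / c ^ 2 := by positivity
            rw [mul_div_assoc]; linarith
    · push Not at hcase
      have key : ∀ ζ, ‖ζ - x‖ ≤ 3 * ‖h‖ → ‖f ζ - x'‖ ≤ 3 / c * (‖h‖ * ‖Q‖ / ‖K‖) := by
        intro ζ hζ
        by_cases hζx : ζ = x
        · rw [hζx, hf]; simp; positivity
        have hζ0 : ζ - x ≠ 0 := sub_ne_zero.mpr hζx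
        have hζp : 0 < ‖ζ - x‖ := norm_pos_iff.mpr hζ0
        have e := hyp ζ hζx
        have g := (hLL (s - 1 / (Q * (ζ - x))) s (by
          rw [e, hε, div_le_div_iff₀ (by positivity) (by positivity)]
          have : ‖Q‖ * ‖ζ - x‖ ≤ ‖Q‖ * (3 * ‖h‖) := by gcongr
          linarith)).1
        rw [e] at g
        rw [hf, sub_sub_cancel_left, norm_neg, norm_div, norm_one, norm_mul]
        calc _ ≤ 1 / (‖K‖ * (c * (1 / (‖Q‖ * (3 * ‖h‖))))) := by
              gcongr
              refine le_trans ?_ g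
              gcongr
          _ = _ := by field_simp
      have k1 := key z (by linarith)
      have k2 := key (z + h) (by
        rw [show z + h - x = (z - x) + h by ring]
        exact (norm_add_le _ _).trans (by linarith))
      calc _ = ‖(f (z + h) - x') - (f z - x')‖ := by congr 1; ring
        _ ≤ _ := norm_sub_le _ _
        _ ≤ 6 / c * (‖h‖ * ‖Q‖ / ‖K‖) := by
          have : 6 / c = 3 / c + 3 / c := by ring
          rw [this, add_mul]; linarith
        _ ≤ _ := by
          gcongr
          have : 0 < 3 * Cc / c ^ 2 := by positivity
          linarith

lemma exists_dual {p : ℂ × ℂ} (hp : p ≠ 0) : ∃ y, dt p y = 1 := by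
  by_cases h1 : p.1 = 0
  · have h2 : p.2 ≠ 0 := fun h2 => hp (Prod.ext h1 h2)
    exact ⟨(-1 / p.2, 0), by simp [dt]; field_simp⟩
  · exact ⟨(0, 1 / p.1), by simp [dt]; field_simp⟩

theorem QS {I : Type} {v w : I → ℂ × ℂ} {C : ℝ} (hS : FullSys v w C) {F G}
    (H : HomeoFam v w F G) : ∃ c : ℝ, 0 < c ∧ ∀ o y y', dt (v o) y = 1 → dt (w o) y' = 1 →
      ∀ z h : ℂ, 0 < ‖h‖ → ∃ ξ, Metric.ball ξ (c * ‖F o y y' (z + h) - F o y y' z‖) ⊆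
        F o y y' '' Metric.ball z (5 * ‖h‖) := by
  have hC := hS.hC
  have hCp : 0 < C := by linarith
  obtain ⟨c, Cc, hc, hCc, h1⟩ := LL H (ε := 1 / (100 * C ^ 2)) (by positivity)
  obtain ⟨d, Dd, hd, hDd, h2⟩ := LL H (ε := 1 / C ^ 4) (by positivity)
  set c1 := c / (8 * Cc ^ 2) / (3 * Cc / c ^ 2 + 6 / c) with hc1
  refine ⟨min c1 (d / Dd), by positivity, ?_⟩
  intro o y y' hy hy' z h hh
  obtain ⟨r, hr⟩ : ∃ r, r = √‖h‖ := ⟨_, rfl⟩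
  have hrpos : 0 < r := by rw [hr]; positivity
  have hr2 : r ^ 2 = ‖h‖ := by rw [hr]; exact Real.sq_sqrt hh.le
  have hrc : (r:ℂ) ≠ 0 := by exact_mod_cast hrpos.ne'
  have hrn : ‖(r:ℂ)‖ = r := by rw [Complex.norm_real, Real.norm_of_nonneg hrpos.le]
  obtain ⟨k, hk1, hk2⟩ := hS.Sv.V3 ((r:ℂ) • v o) ((r:ℂ)⁻¹ • (y + z • v o)) (by
    rw [dt_smul_left, dt_smul_right, dt_add_right, dt_smul_right, dt_self, hy]
    field_simp; simp)
  rw [dt_smul_left, norm_mul, hrn] at hk1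
  rw [dt_smul_left, norm_mul, norm_inv, hrn, dt_add_left, dt_smul_left, dt_swap y,
    inv_mul_le_iff₀ hrpos, show -dt (v k) y + z * dt (v o) (v k) =
      -(dt (v k) y - z * dt (v o) (v k)) by ring, norm_neg] at hk2
  by_cases hq : dt (v o) (v k) = 0
  · have hv := hS.Sv.V2 o k hq y
    rw [hy, norm_one] at hv
    rw [hq, mul_zero, sub_zero] at hk2
    have hrC : 1 ≤ r * C ^ 2 := by nlinarith
    have hhC : 1 / C ^ 4 ≤ ‖h‖ := by
      rw [div_le_iff₀ (by positivity), ← hr2]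
      nlinarith
    refine ⟨F o y y' z, ?_⟩
    have u := (h2 o y y' hy hy' (z + h) z (by simpa using hhC)).2
    rw [add_sub_cancel_left] at u
    intro ζ hζ
    rw [Metric.mem_ball, dist_eq_norm] at hζ
    refine ⟨G o y y' ζ, ?_, H.FG o y y' hy hy' ζ⟩
    rw [Metric.mem_ball, dist_eq_norm]
    by_contra hcon
    push Not at hcon
    have l := (h2 o y y' hy hy' (G o y y' ζ) z (by linarith)).1
    rw [H.FG o y y' hy hy'] at l
    have e1 : min c1 (d / Dd) * ‖F o y y' (z + h) - F o y y' z‖ ≤ d / Dd * (Dd * ‖h‖) := by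
      gcongr; exact min_le_right _ _
    have e2 : d / Dd * (Dd * ‖h‖) = d * ‖h‖ := by field_simp
    have e3 : d * (5 * ‖h‖) ≤ d * ‖G o y y' ζ - z‖ := by gcongr
    nlinarith
  · have hq' : dt (w o) (w k) ≠ 0 := fun hh => hq (hS.Jwv.J0 _ _ hh)
    obtain ⟨u, hu⟩ := exists_dual (hS.Sv.V0 k)
    obtain ⟨u', hu'⟩ := exists_dual (hS.Sw.V0 k)
    have bc := base_change hS H hy hy' hu hu' hq
    have hzx : ‖dt (v o) (v k) ^ 2‖ * ‖z - zc (v o) y (v k)‖ ^ 2 ≤ C ^ 2 * ‖h‖ := by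
      rw [← norm_pow, ← norm_mul, ← mul_pow, norm_pow, ← hr2, ← mul_pow]
      gcongr
      rw [show dt (v o) (v k) * (z - zc (v o) y (v k)) = -(dt (v k) y - z * dt (v o) (v k)) by
        rw [zc]; field_simp; ring, norm_neg]
      linarith
    have hQh : ‖dt (v o) (v k) ^ 2‖ * ‖h‖ ≤ C ^ 2 := by
      rw [norm_pow, ← hr2, ← mul_pow]
      gcongr; linarith
    obtain ⟨⟨ξ, hξ⟩, hub⟩ := qs_core hc hCc hC rfl (h1 k u u' hu hu')
      (fun W => ⟨_, H.FG k u u' hu hu' W⟩) (pow_ne_zero 2 hq') (pow_ne_zero 2 hq) bc hh hzx hQh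
    refine ⟨ξ, (Metric.ball_subset_ball ?_).trans hξ⟩
    set X := ‖h‖ * ‖dt (v o) (v k) ^ 2‖ / ‖dt (w o) (w k) ^ 2‖
    calc _ ≤ c1 * ((3 * Cc / c ^ 2 + 6 / c) * X) := by gcongr; exact min_le_left _ _
      _ = c / (8 * Cc ^ 2) * X := by rw [hc1]; field_simp

open Filter Topology MeasureTheory

lemma l2_bound {f : ℝ × ℝ → ℂ} {g : ℂ → ℝ × ℝ} (hf : Continuous f) (hg : Continuous g)
    (hgf : ∀ p, g (f p) = p) (hfg : ∀ ζ, f (g ζ) = ζ) {c : ℝ} (hc : 0 < c)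
    (hqs : ∀ p : ℝ × ℝ, ∀ h : ℝ, 0 < h → ∃ ξ, Metric.ball ξ (c * ‖f (p.1 + h, p.2) - f p‖) ⊆
      f '' Metric.ball p (5 * h)) :
    ∃ K : ENNReal, K ≠ ⊤ ∧ ∀ h : ℝ, 0 < h → h ≤ 1 →
      ∫⁻ p in Metric.closedBall (0 : ℝ × ℝ) 2, ‖f (p.1 + h, p.2) - f p‖ₑ ^ 2 ≤
        K * ENNReal.ofReal h ^ 2 := by
  set B := Metric.closedBall (0 : ℝ × ℝ) 2 with hB
  set T := f '' Metric.closedBall (0 : ℝ × ℝ) 7 with hT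
  have hTc : IsCompact T := (isCompact_closedBall _ _).image hf
  have hTfin : volume T ≠ ⊤ := hTc.measure_ne_top
  set a : ENNReal := ENNReal.ofReal c ^ 2 * NNReal.pi with ha
  have ha0 : a ≠ 0 := by
    rw [ha]; refine mul_ne_zero (pow_ne_zero _ ?_) ?_
    · simpa using hc
    · simpa using NNReal.pi_pos.ne'
  have hatop : a ≠ ⊤ := by rw [ha]; finiteness
  refine ⟨a⁻¹ * (100 * volume T), by finiteness, ?_⟩
  intro h hh hh1
  have key : ∀ p, a * ‖f (p.1 + h, p.2) - f p‖ₑ ^ 2 ≤ volume {ζ | dist (g ζ) p < 5 * h} := by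
    intro p
    obtain ⟨ξ, hξ⟩ := hqs p h hh
    have h1 : volume (Metric.ball ξ (c * ‖f (p.1 + h, p.2) - f p‖)) ≤ volume {ζ | dist (g ζ) p < 5 * h} := by
      apply measure_mono
      refine hξ.trans ?_
      rintro _ ⟨q, hq, rfl⟩
      simpa [hgf] using hq
    rw [Complex.volume_ball, ENNReal.ofReal_mul hc.le, ofReal_norm] at h1
    refine le_trans (le_of_eq ?_) h1
    rw [ha]; ring
  have hopen : IsOpen {q : (ℝ × ℝ) × ℂ | dist (g q.2) q.1 < 5 * h} :=
    isOpen_lt (by fun_prop) continuous_const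
  have h2 : ∫⁻ p in B, volume {ζ | dist (g ζ) p < 5 * h} =
      ∫⁻ ζ, (volume.restrict B) {p | dist (g ζ) p < 5 * h} := by
    have e1 := Measure.prod_apply (μ := volume.restrict B) (ν := (volume : Measure ℂ)) hopen.measurableSet
    have e2 := Measure.prod_apply_symm (μ := volume.restrict B) (ν := (volume : Measure ℂ)) hopen.measurableSet
    exact e1.symm.trans e2
  have hdouble : ∀ ζ, (volume.restrict B) {p | dist (g ζ) p < 5 * h} ≤
      T.indicator (fun _ => 100 * ENNReal.ofReal h ^ 2) ζ := by
    intro ζ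
    by_cases hζ : ζ ∈ T
    · rw [Set.indicator_of_mem hζ]
      refine (Measure.restrict_apply_le _ _).trans ?_
      have : {p | dist (g ζ) p < 5 * h} = Metric.ball (g ζ).1 (5 * h) ×ˢ Metric.ball (g ζ).2 (5 * h) := by
        rw [ball_prod_same]; ext p; simp [dist_comm]
      rw [this, Measure.volume_eq_prod, Measure.prod_prod, Real.volume_ball, Real.volume_ball,
        show 2 * (5 * h) = 10 * h by ring, ENNReal.ofReal_mul (by norm_num)]
      apply le_of_eq
      rw [show ENNReal.ofReal 10 = 10 by simp]
      ring
    · rw [Set.indicator_of_notMem hζ]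
      rw [Measure.restrict_apply (isOpen_lt (by fun_prop) continuous_const).measurableSet]
      have : {p | dist (g ζ) p < 5 * h} ∩ B = ∅ := by
        ext p
        simp only [Set.mem_inter_iff, Set.mem_setOf_eq, Set.mem_empty_iff_false, iff_false]
        rintro ⟨h3, h4⟩
        apply hζ
        refine ⟨g ζ, ?_, hfg ζ⟩
        rw [Metric.mem_closedBall]
        rw [hB, Metric.mem_closedBall] at h4
        have := dist_triangle (g ζ) p 0
        linarith
      rw [this, measure_empty]
  have h4 : a * ∫⁻ p in B, ‖f (p.1 + h, p.2) - f p‖ₑ ^ 2 ≤ 100 * ENNReal.ofReal h ^ 2 * volume T := by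
    rw [← lintegral_const_mul' _ _ hatop]
    calc _ ≤ ∫⁻ p in B, volume {ζ | dist (g ζ) p < 5 * h} := lintegral_mono key
      _ = _ := h2
      _ ≤ ∫⁻ ζ, T.indicator (fun _ => 100 * ENNReal.ofReal h ^ 2) ζ := lintegral_mono hdouble
      _ = _ := by rw [lintegral_indicator_const hTc.measurableSet]
  calc _ = a⁻¹ * (a * ∫⁻ p in B, ‖f (p.1 + h, p.2) - f p‖ₑ ^ 2) := by
        rw [← mul_assoc, ENNReal.inv_mul_cancel ha0 hatop, one_mul]
    _ ≤ a⁻¹ * (100 * ENNReal.ofReal h ^ 2 * volume T) := by gcongr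
    _ = _ := by ring

lemma hilbert_weak_limit {E : Type*} [NormedAddCommGroup E] [InnerProductSpace ℂ E] [CompleteSpace E]
    (u : ℕ → E) (M : ℝ) (hu : ∀ n, ‖u n‖ ≤ M) :
    ∃ g : E, ∀ x : E, Tendsto (fun n => inner ℂ x (u n)) (hyperfilter ℕ) (𝓝 (inner ℂ x g)) := by
  have hc := WeakDual.isCompact_closedBall (𝕜 := ℂ) (E := E) 0 M
  set U : Ultrafilter (WeakDual ℂ E) := (hyperfilter ℕ).map
    (fun n => StrongDual.toWeakDual (InnerProductSpace.toDual ℂ E (u n))) with hU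
  obtain ⟨φ, -, hφ⟩ := hc.ultrafilter_le_nhds U (by
    rw [le_principal_iff, hU, Ultrafilter.coe_map, mem_map]
    refine univ_mem' (fun n : ℕ => ?_)
    simp only [Set.mem_preimage, Metric.mem_closedBall, dist_zero_right]
    refine le_trans (le_of_eq ?_) (hu n)
    exact (InnerProductSpace.toDual ℂ E).norm_map (u n))
  refine ⟨(InnerProductSpace.toDual ℂ E).symm (WeakDual.toStrongDual φ), fun x => ?_⟩
  have h1 : Tendsto (fun n => StrongDual.toWeakDual (InnerProductSpace.toDual ℂ E (u n)))
      (hyperfilter ℕ) (𝓝 φ) := hφ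
  have h2 := ((WeakDual.eval_continuous (𝕜 := ℂ) x).tendsto φ).comp h1
  have h3 := (Complex.continuous_conj.tendsto _).comp h2
  have e1 : (inner ℂ x ((InnerProductSpace.toDual ℂ E).symm (WeakDual.toStrongDual φ)) : ℂ)
      = (starRingEnd ℂ) (φ x) := by
    rw [← inner_conj_symm, InnerProductSpace.toDual_symm_apply]; rfl
  rw [e1]
  refine h3.congr (fun n => ?_)
  simp only [Function.comp]
  rw [← inner_conj_symm x (u n)]
  rfl

open Filter Topology MeasureTheory

lemma weak_grad {f : ℝ × ℝ → ℂ} (hf : Continuous f) {K : ENNReal} (hK : K ≠ ⊤)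
    (hb : ∀ h : ℝ, 0 < h → h ≤ 1 →
      ∫⁻ p in Metric.closedBall (0 : ℝ × ℝ) 2, ‖f (p.1 + h, p.2) - f p‖ₑ ^ 2 ≤
        K * ENNReal.ofReal h ^ 2) :
    ∃ g : ℝ × ℝ → ℂ, Integrable g volume ∧ ∀ a b c d : ℝ, -1 ≤ a → a ≤ b → b ≤ 1 → -1 ≤ c → c ≤ d →
      d ≤ 1 → ∫ p in Set.Icc a b ×ˢ Set.Icc c d, g p = ∫ y in c..d, (f (b, y) - f (a, y)) := by
  set B := Metric.closedBall (0 : ℝ × ℝ) 2 with hB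
  have hBc : IsCompact B := isCompact_closedBall _ _
  have hBm : MeasurableSet B := hBc.measurableSet
  set μ := (volume : Measure (ℝ × ℝ)).restrict B with hμ
  have : IsFiniteMeasure μ := ⟨by rw [hμ, Measure.restrict_apply_univ]; exact hBc.measure_lt_top⟩
  set t : ℕ → ℝ := fun n => 1 / ((n : ℝ) + 1) with ht
  have ht0 : ∀ n, 0 < t n := fun n => Nat.one_div_pos_of_nat
  have ht1 : ∀ n, t n ≤ 1 := fun n => by
    rw [ht]; simp only; rw [div_le_one (by positivity)]; linarith [(Nat.cast_nonneg n : (0:ℝ) ≤ n)]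
  set D : ℕ → ℝ × ℝ → ℂ := fun n p => (t n)⁻¹ • (f (p.1 + t n, p.2) - f p) with hD
  have hDc : ∀ n, Continuous (D n) := fun n => by rw [hD]; fun_prop
  have hE : ∀ n, eLpNorm (D n) 2 μ ≤ 1 + K := by
    intro n
    have h1 : eLpNorm (D n) 2 μ ^ 2 ≤ K := by
      have h2 := eLpNorm_nnreal_pow_eq_lintegral (f := D n) (p := 2) (μ := μ) (by norm_num)
      have h2' : eLpNorm (D n) 2 μ ^ 2 = ∫⁻ p, ‖D n p‖ₑ ^ 2 ∂μ := by
        have e : ((2 : NNReal) : ℝ) = ((2 : ℕ) : ℝ) := by norm_num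
        rw [e] at h2
        simp only [ENNReal.rpow_natCast] at h2
        exact_mod_cast h2
      rw [h2']
      have h3 : ∀ p, ‖D n p‖ₑ ^ 2 = ENNReal.ofReal (t n)⁻¹ ^ 2 * ‖f (p.1 + t n, p.2) - f p‖ₑ ^ 2 := by
        intro p
        rw [hD]; simp only
        rw [enorm_smul, mul_pow, Real.enorm_eq_ofReal (inv_nonneg.2 (ht0 n).le)]
      simp_rw [h3]
      rw [lintegral_const_mul' _ _ (by finiteness)]
      calc _ ≤ ENNReal.ofReal (t n)⁻¹ ^ 2 * (K * ENNReal.ofReal (t n) ^ 2) := by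
            gcongr; exact hb _ (ht0 n) (ht1 n)
        _ = K * (ENNReal.ofReal (t n)⁻¹ * ENNReal.ofReal (t n)) ^ 2 := by ring
        _ = K := by
          rw [← ENNReal.ofReal_mul (inv_nonneg.2 (ht0 n).le), inv_mul_cancel₀ (ht0 n).ne']; simp
    by_cases h : eLpNorm (D n) 2 μ ≤ 1
    · exact h.trans le_self_add
    · refine le_trans ?_ (h1.trans le_add_self)
      push Not at h
      rw [pow_two]
      exact le_mul_of_one_le_left' h.le
  have hmem : ∀ n, MemLp (D n) 2 μ := fun n =>
    ⟨(hDc n).aestronglyMeasurable, (hE n).trans_lt (by finiteness)⟩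
  obtain ⟨G, hG⟩ := hilbert_weak_limit (fun n => (hmem n).toLp (D n)) (1 + K).toReal (fun n => by
    rw [Lp.norm_toLp]; exact ENNReal.toReal_mono (by finiteness) (hE n))
  have hGi : Integrable G μ := (Lp.memLp G).integrable (by norm_num)
  refine ⟨B.indicator G, (integrable_indicator_iff hBm).2 hGi, ?_⟩
  intro a b c d ha hab hb1 hc hcd hd
  set Q := Set.Icc a b ×ˢ Set.Icc c d with hQ
  have hQm : MeasurableSet Q := measurableSet_Icc.prod measurableSet_Icc
  have hQB : Q ⊆ B := by
    rintro ⟨x, y⟩ ⟨⟨h1, h2⟩, h3, h4⟩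
    simp only at h1 h2 h3 h4
    rw [hB, Metric.mem_closedBall, dist_zero_right, Prod.norm_def]
    simp only [Real.norm_eq_abs]
    refine max_le (abs_le.2 ⟨by linarith, by linarith⟩) (abs_le.2 ⟨by linarith, by linarith⟩)
  have hμQ : μ.restrict Q = volume.restrict Q := by
    rw [hμ, Measure.restrict_restrict hQm, Set.inter_eq_left.2 hQB]
  have e1 : ∫ p in Q, B.indicator G p = ∫ p in Q, G p ∂μ := by
    rw [hμQ]
    refine setIntegral_congr_fun hQm (fun p hp => ?_)
    exact Set.indicator_of_mem (hQB hp) _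
  have hlim := hG (indicatorConstLp 2 hQm (measure_ne_top μ Q) 1)
  simp only [L2.inner_indicatorConstLp_one] at hlim
  set φ : ℝ → ℂ := fun x => ∫ y in c..d, f (x, y) with hφ
  have hφc : Continuous φ :=
    intervalIntegral.continuous_parametric_intervalIntegral_of_continuous' (show Continuous (Function.uncurry fun x y => f (x, y)) from hf) c d
  set P : ℝ → ℂ := fun s => ∫ x in (0:ℝ)..s, φ x with hP
  have hPd : ∀ s, HasDerivAt P (φ s) s := fun s =>
    intervalIntegral.integral_hasDerivAt_right (hφc.intervalIntegrable _ _)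
      (hφc.stronglyMeasurableAtFilter _ _) hφc.continuousAt
  have hint : ∀ h : ℝ, ∫ p in Q, f (p.1 + h, p.2) = P (b + h) - P (a + h) := by
    intro h
    rw [hQ, Measure.volume_eq_prod, setIntegral_prod]
    · rw [integral_Icc_eq_integral_Ioc, ← intervalIntegral.integral_of_le hab]
      have : ∀ x, ∫ y in Set.Icc c d, f (x + h, y) = φ (x + h) := by
        intro x
        rw [integral_Icc_eq_integral_Ioc, ← intervalIntegral.integral_of_le hcd]
      simp only [this]
      rw [intervalIntegral.integral_comp_add_right φ h, hP]
      simp only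
      rw [intervalIntegral.integral_interval_sub_left] <;> exact hφc.intervalIntegrable _ _
    · rw [← Measure.volume_eq_prod]
      exact ContinuousOn.integrableOn_compact (isCompact_Icc.prod isCompact_Icc) (by fun_prop)
  have hDint : ∀ n, ∫ p in Q, (hmem n).toLp (D n) p ∂μ =
      (t n)⁻¹ • (P (b + t n) - P b) - (t n)⁻¹ • (P (a + t n) - P a) := by
    intro n
    have h1 : ∫ p in Q, (hmem n).toLp (D n) p ∂μ = ∫ p in Q, D n p ∂μ :=
      integral_congr_ae (ae_restrict_of_ae (MemLp.coeFn_toLp (hmem n)))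
    rw [h1, hμQ, hD]
    simp only
    have hic : ∀ h : ℝ, Integrable (fun p : ℝ × ℝ => f (p.1 + h, p.2)) (volume.restrict Q) := fun h =>
      ContinuousOn.integrableOn_compact (isCompact_Icc.prod isCompact_Icc) (by fun_prop)
    rw [integral_smul, integral_sub (hic _) (by simpa using hic 0), hint]
    have := hint 0
    simp only [add_zero, Prod.mk.eta] at this
    rw [this, ← smul_sub]
    congr 1; ring
  simp only [hDint] at hlim
  have ht2 : Tendsto t atTop (𝓝[≠] 0) := by
    rw [tendsto_nhdsWithin_iff]
    exact ⟨tendsto_one_div_add_atTop_nhds_zero_nat, Eventually.of_forall (fun n => (ht0 n).ne')⟩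
  have hlim2 : Tendsto (fun n => (t n)⁻¹ • (P (b + t n) - P b) - (t n)⁻¹ • (P (a + t n) - P a)) atTop
      (𝓝 (φ b - φ a)) :=
    ((hPd b).tendsto_slope_zero.comp ht2).sub ((hPd a).tendsto_slope_zero.comp ht2)
  have h3 := tendsto_nhds_unique hlim (hlim2.mono_left Nat.hyperfilter_le_atTop)
  rw [e1, h3, hφ]
  simp only
  rw [intervalIntegral.integral_sub] <;> exact Continuous.intervalIntegrable (by fun_prop) _ _

lemma leb_point {f g : ℝ × ℝ → ℂ} (hg : Integrable g volume)
    (hfg : ∀ a b c d : ℝ, -1 ≤ a → a ≤ b → b ≤ 1 → -1 ≤ c → c ≤ d →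
      d ≤ 1 → ∫ p in Set.Icc a b ×ˢ Set.Icc c d, g p = ∫ y in c..d, (f (b, y) - f (a, y))) :
    ∀ᵐ p : ℝ × ℝ, ‖p‖ < 1 → ∀ a b c d : ℝ, a ≤ b → c ≤ d →
      Tendsto (fun r : ℝ => r⁻¹ • ∫ y in c..d, (f (p.1 + r * b, p.2 + r * y) - f (p.1 + r * a, p.2 + r * y)))
        (𝓝[>] 0) (𝓝 (((b - a) * (d - c)) • g p)) := by
  filter_upwards [IsUnifLocDoublingMeasure.ae_tendsto_average_norm_sub volume hg.locallyIntegrable 1] with p hp hp1 a b c d hab hcd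
  obtain ⟨R, hR⟩ : ∃ R : ℝ, 0 < R ∧ |a| ≤ R ∧ |b| ≤ R ∧ |c| ≤ R ∧ |d| ≤ R :=
    ⟨|a| + |b| + |c| + |d| + 1, by positivity, by linarith [abs_nonneg b, abs_nonneg c, abs_nonneg d],
      by linarith [abs_nonneg a, abs_nonneg c, abs_nonneg d],
      by linarith [abs_nonneg b, abs_nonneg a, abs_nonneg d],
      by linarith [abs_nonneg b, abs_nonneg c, abs_nonneg a]⟩
  obtain ⟨hR0, hRa, hRb, hRc, hRd⟩ := hR
  rw [abs_le] at hRa hRb hRc hRd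
  have hδ : Tendsto (fun r : ℝ => R * r) (𝓝[>] 0) (𝓝[>] 0) := by
    rw [tendsto_nhdsWithin_iff]
    constructor
    · have : Tendsto (fun r : ℝ => R * r) (𝓝 0) (𝓝 (R * 0)) := (continuous_const.mul continuous_id).tendsto 0
      rw [mul_zero] at this
      exact this.mono_left nhdsWithin_le_nhds
    · filter_upwards [self_mem_nhdsWithin] with r hr
      exact mul_pos hR0 hr
  have hav := hp (fun _ : ℝ => p) (fun r => R * r) hδ (by
    filter_upwards [self_mem_nhdsWithin] with r hr
    have : 0 < r := hr
    simp only [Metric.mem_closedBall, dist_self]; positivity)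
  rw [tendsto_iff_norm_sub_tendsto_zero]
  have hav2 := hav.const_mul (4 * R ^ 2)
  rw [mul_zero] at hav2
  rw [Prod.norm_def, max_lt_iff, Real.norm_eq_abs, Real.norm_eq_abs, abs_lt, abs_lt] at hp1
  have hsmall : ∀ᶠ r : ℝ in 𝓝[>] 0, R * r < 1 - |p.1| ∧ R * r < 1 - |p.2| := by
    have h1 : Tendsto (fun r : ℝ => R * r) (𝓝[>] 0) (𝓝 0) := hδ.mono_right nhdsWithin_le_nhds
    have h2 : |p.1| < 1 := abs_lt.2 hp1.1
    have h3 : |p.2| < 1 := abs_lt.2 hp1.2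
    exact (h1.eventually_lt_const (by linarith)).and (h1.eventually_lt_const (by linarith))
  refine squeeze_zero' (Eventually.of_forall fun r => norm_nonneg _) ?_ hav2
  filter_upwards [hsmall, self_mem_nhdsWithin] with r hr hr0
  replace hr0 : 0 < r := hr0
  obtain ⟨hr1, hr2⟩ := hr
  have habs1 := abs_le.1 (le_refl |p.1|)
  have habs2 := abs_le.1 (le_refl |p.2|)
  have ha' : r * a ≤ R * r ∧ -(R * r) ≤ r * a := ⟨by nlinarith, by nlinarith⟩
  have hb' : r * b ≤ R * r ∧ -(R * r) ≤ r * b := ⟨by nlinarith, by nlinarith⟩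
  have hc' : r * c ≤ R * r ∧ -(R * r) ≤ r * c := ⟨by nlinarith, by nlinarith⟩
  have hd' : r * d ≤ R * r ∧ -(R * r) ≤ r * d := ⟨by nlinarith, by nlinarith⟩
  have hab' : r * a ≤ r * b := by gcongr
  have hcd' : r * c ≤ r * d := by gcongr
  set Q := Set.Icc (p.1 + r * a) (p.1 + r * b) ×ˢ Set.Icc (p.2 + r * c) (p.2 + r * d) with hQ
  have hQm : MeasurableSet Q := measurableSet_Icc.prod measurableSet_Icc
  have e0 := hfg (p.1 + r * a) (p.1 + r * b) (p.2 + r * c) (p.2 + r * d) (by linarith) (by linarith)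
    (by linarith) (by linarith) (by linarith) (by linarith)
  have e1 : ∫ y in c..d, (f (p.1 + r * b, p.2 + r * y) - f (p.1 + r * a, p.2 + r * y)) =
      r⁻¹ • ∫ q in Q, g q := by
    rw [e0, ← intervalIntegral.integral_comp_add_mul (fun y => f (p.1 + r * b, y) - f (p.1 + r * a, y)) hr0.ne']
  have hQfin : volume Q ≠ ⊤ := (isCompact_Icc.prod isCompact_Icc).measure_ne_top
  have hQv : volume.real Q = r ^ 2 * ((b - a) * (d - c)) := by
    rw [measureReal_def, hQ, Measure.volume_eq_prod, Measure.prod_prod, Real.volume_Icc, Real.volume_Icc,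
      ENNReal.toReal_mul, ENNReal.toReal_ofReal (by linarith), ENNReal.toReal_ofReal (by linarith)]
    ring
  have e2 : r⁻¹ • (r⁻¹ • ∫ q in Q, g q) - ((b - a) * (d - c)) • g p = (r⁻¹ * r⁻¹) • ∫ q in Q, (g q - g p) := by
    rw [integral_sub hg.integrableOn (integrableOn_const hQfin), setIntegral_const, hQv, smul_sub,
      smul_smul, smul_smul]
    congr 2
    field_simp
  have hBv : volume.real (Metric.closedBall p (R * r)) = 4 * R ^ 2 * r ^ 2 := by
    rw [show p = (p.1, p.2) from rfl, ← closedBall_prod_same, measureReal_def, Measure.volume_eq_prod, Measure.prod_prod,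
      Real.volume_closedBall, Real.volume_closedBall, ENNReal.toReal_mul, ENNReal.toReal_ofReal (by positivity)]
    ring
  have hQB : Q ⊆ Metric.closedBall p (R * r) := by
    rintro ⟨x, y⟩ ⟨⟨h1, h2⟩, h3, h4⟩
    simp only at h1 h2 h3 h4
    rw [Metric.mem_closedBall, Prod.dist_eq, Real.dist_eq, Real.dist_eq]
    exact max_le (abs_le.2 ⟨by linarith, by linarith⟩) (abs_le.2 ⟨by linarith, by linarith⟩)
  have hBi : IntegrableOn (fun q => ‖g q - g p‖) (Metric.closedBall p (R * r)) volume := by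
    have := (hg.integrableOn (s := Metric.closedBall p (R * r))).sub
      (integrableOn_const (C := g p) ((isCompact_closedBall p (R * r)).measure_ne_top (μ := volume)))
    exact this.norm
  rw [e1, e2, norm_smul, setAverage_eq, hBv, Real.norm_of_nonneg (by positivity), smul_eq_mul]
  calc r⁻¹ * r⁻¹ * ‖∫ q in Q, (g q - g p)‖ ≤ r⁻¹ * r⁻¹ * ∫ q in Metric.closedBall p (R * r), ‖g q - g p‖ := by
        gcongr
        refine (norm_integral_le_integral_norm _).trans ?_
        exact setIntegral_mono_set hBi (Eventually.of_forall fun _ => norm_nonneg _) hQB.eventuallyLE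
    _ = _ := by field_simp

open Filter Topology MeasureTheory

lemma grad_of {F G : ℂ → ℂ} (hF : Continuous F) (hG : Continuous G) (hGF : ∀ z, G (F z) = z)
    (hFG : ∀ z, F (G z) = z) {c : ℝ} (hc : 0 < c)
    (hqs : ∀ z h : ℂ, 0 < ‖h‖ → ∃ ξ, Metric.ball ξ (c * ‖F (z + h) - F z‖) ⊆ F '' Metric.ball z (5 * ‖h‖))
    {e : ℝ × ℝ → ℂ} {e' : ℂ → ℝ × ℝ} (he : Continuous e) (he' : Continuous e') (hee' : ∀ z, e (e' z) = z)
    (he'e : ∀ p, e' (e p) = p) {u : ℂ} (hu : ‖u‖ = 1) (heh : ∀ (p : ℝ × ℝ) (h : ℝ), e (p.1 + h, p.2) = e p + h * u)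
    (hd : ∀ p q, dist p q ≤ dist (e p) (e q)) :
    ∃ g : ℝ × ℝ → ℂ, Integrable g volume ∧ ∀ a b c d : ℝ, -1 ≤ a → a ≤ b → b ≤ 1 → -1 ≤ c → c ≤ d →
      d ≤ 1 → ∫ p in Set.Icc a b ×ˢ Set.Icc c d, g p = ∫ y in c..d, (F (e (b, y)) - F (e (a, y))) := by
  obtain ⟨K, hK, hb⟩ := l2_bound (f := F ∘ e) (g := e' ∘ G) (hF.comp he) (he'.comp hG)
    (fun p => by simp [hGF, he'e]) (fun z => by simp [hee', hFG]) hc (by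
      intro p h hh
      have hn : ‖(h : ℂ) * u‖ = h := by simp [hu, abs_of_pos hh]
      obtain ⟨ξ, hξ⟩ := hqs (e p) (h * u) (by rw [hn]; exact hh)
      refine ⟨ξ, ?_⟩
      simp only [Function.comp, heh]
      refine hξ.trans ?_
      rintro _ ⟨z, hz, rfl⟩
      refine ⟨e' z, ?_, by simp [hee']⟩
      rw [Metric.mem_ball] at hz ⊢
      refine (hd _ _).trans_lt ?_
      rw [hee']; rwa [hn] at hz)
  exact weak_grad (hF.comp he) hK hb

lemma good_point {F G : ℂ → ℂ} (hF : Continuous F) (hG : Continuous G) (hGF : ∀ z, G (F z) = z)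
    (hFG : ∀ z, F (G z) = z) {c : ℝ} (hc : 0 < c)
    (hqs : ∀ z h : ℂ, 0 < ‖h‖ → ∃ ξ, Metric.ball ξ (c * ‖F (z + h) - F z‖) ⊆ F '' Metric.ball z (5 * ‖h‖))
    {S : Set ℂ} (hS : S.Countable) :
    ∃ z0 ∉ S, ∃ lam mu : ℂ, lam ≠ 0 ∧ ∀ a b c d : ℝ, a ≤ b → c ≤ d →
      Tendsto (fun r : ℝ => r⁻¹ • ∫ y in c..d, (F (z0 + r * (b + y * Complex.I)) - F (z0 + r * (a + y * Complex.I))))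
        (𝓝[>] 0) (𝓝 (((b - a) * (d - c)) • lam)) ∧
      Tendsto (fun r : ℝ => r⁻¹ • ∫ x in a..b, (F (z0 + r * (x + d * Complex.I)) - F (z0 + r * (x + c * Complex.I))))
        (𝓝[>] 0) (𝓝 (((b - a) * (d - c)) • mu)) := by
  obtain ⟨g1, hg1, hr1⟩ := grad_of hF hG hGF hFG hc hqs (e := fun p => p.1 + p.2 * Complex.I)
    (e' := fun z => (z.re, z.im)) (by fun_prop) (by fun_prop) (fun z => by simp [Complex.re_add_im])
    (fun p => by simp) (u := 1) (by simp) (fun p h => by push_cast; ring) (fun p q => by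
      rw [Prod.dist_eq, Real.dist_eq, Real.dist_eq, Complex.dist_eq]
      refine max_le ?_ ?_
      · refine le_trans (le_of_eq ?_) (Complex.abs_re_le_norm _); simp
      · refine le_trans (le_of_eq ?_) (Complex.abs_im_le_norm _); simp)
  obtain ⟨g2, hg2, hr2⟩ := grad_of hF hG hGF hFG hc hqs (e := fun p => p.2 + p.1 * Complex.I)
    (e' := fun z => (z.im, z.re)) (by fun_prop) (by fun_prop) (fun z => by simp [Complex.re_add_im])
    (fun p => by simp) (u := Complex.I) (by simp) (fun p h => by push_cast; ring) (fun p q => by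
      rw [Prod.dist_eq, Real.dist_eq, Real.dist_eq, Complex.dist_eq]
      refine max_le ?_ ?_
      · refine le_trans (le_of_eq ?_) (Complex.abs_im_le_norm _); simp
      · refine le_trans (le_of_eq ?_) (Complex.abs_re_le_norm _); simp)
  have l1 := leb_point (f := fun p => F (p.1 + p.2 * Complex.I)) hg1 hr1
  have l2 := leb_point (f := fun p => F (p.2 + p.1 * Complex.I)) hg2 hr2
  have l3 := (Measure.measurePreserving_swap (μ := (volume : Measure ℝ)) (ν := (volume : Measure ℝ))).quasiMeasurePreserving.ae l2
  have hS' : ∀ᵐ p : ℝ × ℝ, ((p.1 : ℂ) + p.2 * Complex.I) ∉ S := by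
    have : ((fun p : ℝ × ℝ => ((p.1 : ℂ) + p.2 * Complex.I)) ⁻¹' S).Countable := by
      refine hS.preimage (fun p q hpq => ?_)
      have h1 := congrArg Complex.re hpq
      have h2 := congrArg Complex.im hpq
      simp at h1 h2
      exact Prod.ext h1 h2
    exact this.ae_notMem _
  have hne : ¬ ∀ᵐ p : ℝ × ℝ, ‖p‖ < 1 → g1 p = 0 := by
    intro hz
    set k : ℝ → ℂ := fun y => F ((1/2 : ℝ) + y * Complex.I) - F ((0 : ℝ) + y * Complex.I) with hk
    have hkc : Continuous k := by rw [hk]; fun_prop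
    have hk0 : ∀ᶠ s in 𝓝 (1/4 : ℝ), ∫ y in (0:ℝ)..s, k y = 0 := by
      filter_upwards [Ioo_mem_nhds (show (0:ℝ) < 1/4 by norm_num) (show (1/4:ℝ) < 1/2 by norm_num)] with s hs
      rw [← hr1 0 (1/2) 0 s (by norm_num) (by norm_num) (by norm_num) (by norm_num) hs.1.le (by linarith [hs.2])]
      rw [setIntegral_congr_ae (g := fun _ => (0:ℂ)) (measurableSet_Icc.prod measurableSet_Icc)]
      · simp
      · filter_upwards [hz] with p hp hpQ
        apply hp
        obtain ⟨⟨h1, h2⟩, h3, h4⟩ := hpQ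
        rw [Prod.norm_def, max_lt_iff, Real.norm_eq_abs, Real.norm_eq_abs, abs_lt, abs_lt]
        exact ⟨⟨by linarith, by linarith⟩, by linarith, by linarith [hs.2]⟩
    have hd : HasDerivAt (fun s => ∫ y in (0:ℝ)..s, k y) (k (1/4)) (1/4) :=
      intervalIntegral.integral_hasDerivAt_right (hkc.intervalIntegrable _ _)
        (hkc.stronglyMeasurableAtFilter _ _) hkc.continuousAt
    have hd0 : HasDerivAt (fun s => ∫ y in (0:ℝ)..s, k y) 0 (1/4) :=
      (hasDerivAt_const (1/4 : ℝ) (0:ℂ)).congr_of_eventuallyEq hk0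
    have h4 := hd.unique hd0
    rw [hk] at h4
    simp only [sub_eq_zero] at h4
    have h5 := congrArg G h4
    rw [hGF, hGF] at h5
    have h6 := congrArg Complex.re h5
    norm_num at h6
  have hfr := (Filter.not_eventually.1 hne).and_eventually (l1.and (l3.and hS'))
  obtain ⟨p, hp, q1, q3, qS⟩ := hfr.exists
  push Not at hp
  refine ⟨_, qS, g1 p, g2 p.swap, hp.2, fun a b c d hab hcd => ⟨?_, ?_⟩⟩
  · refine (q1 hp.1 a b c d hab hcd).congr (fun r => ?_)
    congr 2; funext y
    congr 2 <;> (push_cast; ring)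
  · have := q3 (by
      have h := hp.1
      rw [Prod.norm_def] at h ⊢
      rwa [Prod.fst_swap, Prod.snd_swap, max_comm]) c d a b hcd hab
    rw [mul_comm (d - c)] at this
    refine this.congr (fun r => ?_)
    congr 2; funext y
    simp only [Prod.fst_swap, Prod.snd_swap]
    congr 2 <;> (push_cast; ring)

open Filter Topology MeasureTheory

lemma zoom_dct {F : ℂ → ℂ} (hF : Continuous F) {z0 : ℂ} {r : ℕ → ℝ} (hr : ∀ n, 0 < r n)
    {m k : ℕ → ℂ} {p : ℂ} {H : ℂ → ℂ}
    (hlim : ∀ z, z ≠ p → Tendsto (fun n => m n * (F (z0 + r n * z) - k n)) atTop (𝓝 (H z)))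
    (hbd : ∀ R : ℝ, ∃ M : ℝ, ∀ᶠ n in atTop, ∀ z, ‖z‖ ≤ R → ‖m n * (F (z0 + r n * z) - k n)‖ ≤ M)
    (u : ℂ) {u' : ℂ} (hu' : u' ≠ 0) (a b c d : ℝ) :
    Tendsto (fun n => (m n * r n) * ((r n)⁻¹ • ∫ y in c..d, (F (z0 + r n * (b * u + y * u')) -
      F (z0 + r n * (a * u + y * u'))))) atTop (𝓝 (∫ y in c..d, (H (b * u + y * u') - H (a * u + y * u')))) := by
  have e1 : ∀ n, (m n * r n) * ((r n)⁻¹ • ∫ y in c..d, (F (z0 + r n * (b * u + y * u')) -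
      F (z0 + r n * (a * u + y * u')))) = ∫ y in c..d, (m n * (F (z0 + r n * (b * u + y * u')) - k n) -
      m n * (F (z0 + r n * (a * u + y * u')) - k n)) := by
    intro n
    have hrn : (r n : ℂ) ≠ 0 := by exact_mod_cast (hr n).ne'
    rw [Complex.real_smul, Complex.ofReal_inv, mul_assoc, mul_inv_cancel_left₀ hrn,
      ← intervalIntegral.integral_const_mul]
    congr 1; funext y; ring
  simp only [e1]
  set R : ℝ := ‖(a : ℂ) * u‖ + ‖(b : ℂ) * u‖ + (|c| + |d|) * ‖u'‖ with hR
  obtain ⟨M, hM⟩ := hbd R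
  have hcR : ∀ y ∈ Set.uIoc c d, ‖(y : ℂ) * u'‖ ≤ (|c| + |d|) * ‖u'‖ := by
    intro y hy
    rw [norm_mul, Complex.norm_real, Real.norm_eq_abs]
    gcongr
    rw [Set.uIoc, Set.mem_Ioc] at hy
    obtain ⟨h1, h2⟩ := hy
    rw [abs_le]
    rcases le_total c d with h | h
    · rw [min_eq_left h] at h1; rw [max_eq_right h] at h2
      exact ⟨by linarith [neg_abs_le c, abs_nonneg d], by linarith [le_abs_self d, abs_nonneg c]⟩
    · rw [min_eq_right h] at h1; rw [max_eq_left h] at h2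
      exact ⟨by linarith [neg_abs_le d, abs_nonneg c], by linarith [le_abs_self c, abs_nonneg d]⟩
  refine intervalIntegral.tendsto_integral_filter_of_dominated_convergence (fun _ => M + M) ?_ ?_ ?_ ?_
  · refine Eventually.of_forall (fun n => ?_)
    apply Continuous.aestronglyMeasurable
    fun_prop
  · filter_upwards [hM] with n hn
    refine Eventually.of_forall (fun y hy => ?_)
    have := hcR y hy
    refine (norm_sub_le _ _).trans (add_le_add (hn _ ?_) (hn _ ?_))
    · refine (norm_add_le _ _).trans ?_
      linarith [norm_nonneg ((a : ℂ) * u)]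
    · refine (norm_add_le _ _).trans ?_
      linarith [norm_nonneg ((b : ℂ) * u)]
  · exact intervalIntegrable_const
  · have hcount : ∀ q : ℂ, ∀ᵐ y : ℝ, q + y * u' ≠ p := by
      intro q
      have : (({(p - q) / u'} : Set ℂ).preimage (fun y : ℝ => (y : ℂ))).Countable :=
        (Set.countable_singleton _).preimage Complex.ofReal_injective
      filter_upwards [this.ae_notMem volume] with y hy h
      apply hy
      simp only [Set.mem_preimage, Set.mem_singleton_iff]
      field_simp
      rw [← h]; ring
    filter_upwards [hcount (a * u), hcount (b * u)] with y h1 h2 _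
    exact (hlim _ h2).sub (hlim _ h1)

lemma zoom_half {F : ℂ → ℂ} (hF : Continuous F) {z0 : ℂ} {r : ℕ → ℝ} (hr : ∀ n, 0 < r n)
    (hr0 : Tendsto r atTop (𝓝 0))
    {m k : ℕ → ℂ} {p : ℂ} {H : ℂ → ℂ} (hH : Continuous H)
    (hlim : ∀ z, z ≠ p → Tendsto (fun n => m n * (F (z0 + r n * z) - k n)) atTop (𝓝 (H z)))
    (hbd : ∀ R : ℝ, ∃ M : ℝ, ∀ᶠ n in atTop, ∀ z, ‖z‖ ≤ R → ‖m n * (F (z0 + r n * z) - k n)‖ ≤ M)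
    (u : ℂ) {u' : ℂ} (hu' : u' ≠ 0) {lam L : ℂ} (hL : Tendsto (fun n => m n * r n) atTop (𝓝 L))
    (hd : ∀ a b c d : ℝ, a ≤ b → c ≤ d →
      Tendsto (fun r : ℝ => r⁻¹ • ∫ y in c..d, (F (z0 + r * (b * u + y * u')) - F (z0 + r * (a * u + y * u'))))
        (𝓝[>] 0) (𝓝 (((b - a) * (d - c)) • lam)))
    (a b d : ℝ) : H (b * u + d * u') - H (a * u + d * u') = L * lam * (b - a) := by
  wlog hab : a ≤ b generalizing a b
  · have := this b a (by linarith)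
    linear_combination -this
  have hrr : Tendsto r atTop (𝓝[>] 0) := tendsto_nhdsWithin_iff.2 ⟨hr0, Eventually.of_forall hr⟩
  have h1 : ∀ s, d - 1 ≤ s → ∫ y in (d-1)..s, (H (b * u + y * u') - H (a * u + y * u')) =
      (L * lam * (b - a)) * ((s - (d - 1) : ℝ) : ℂ) := by
    intro s hs
    have t1 := zoom_dct hF hr hlim hbd u hu' a b (d-1) s
    have t2 := hL.mul ((hd a b (d-1) s hab hs).comp hrr)
    rw [tendsto_nhds_unique t1 t2, Complex.real_smul]
    push_cast; ring
  have hc : Continuous (fun y : ℝ => H (b * u + y * u') - H (a * u + y * u')) := by fun_prop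
  have d1 : HasDerivAt (fun s => ∫ y in (d-1)..s, (H (b * u + y * u') - H (a * u + y * u')))
      (H (b * u + d * u') - H (a * u + d * u')) d :=
    intervalIntegral.integral_hasDerivAt_right (hc.intervalIntegrable _ _)
        (hc.stronglyMeasurableAtFilter _ _) hc.continuousAt
  have d2 : HasDerivAt (fun s : ℝ => (L * lam * (b - a)) * ((s - (d - 1) : ℝ) : ℂ)) ((L * lam * (b - a)) * ((1 : ℝ) : ℂ)) d :=
    (((hasDerivAt_id d).sub_const (d-1)).ofReal_comp).const_mul _
  have d3 := d2.congr_of_eventuallyEq (f₁ := fun s => ∫ y in (d-1)..s, (H (b * u + y * u') - H (a * u + y * u'))) (by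
    filter_upwards [Ioi_mem_nhds (show d - 1 < d by linarith)] with s hs
    exact h1 s (le_of_lt hs))
  have := d1.unique d3
  simpa using this

lemma zoom {F : ℂ → ℂ} (hF : Continuous F) {z0 : ℂ} {r : ℕ → ℝ} (hr : ∀ n, 0 < r n)
    (hr0 : Tendsto r atTop (𝓝 0))
    {m k : ℕ → ℂ} {p : ℂ} {H : ℂ → ℂ} (hH : Continuous H)
    (hlim : ∀ z, z ≠ p → Tendsto (fun n => m n * (F (z0 + r n * z) - k n)) atTop (𝓝 (H z)))
    (hbd : ∀ R : ℝ, ∃ M : ℝ, ∀ᶠ n in atTop, ∀ z, ‖z‖ ≤ R → ‖m n * (F (z0 + r n * z) - k n)‖ ≤ M)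
    {lam mu : ℂ} (hlam : lam ≠ 0) (hd : ∀ a b c d : ℝ, a ≤ b → c ≤ d →
      Tendsto (fun r : ℝ => r⁻¹ • ∫ y in c..d, (F (z0 + r * (b + y * Complex.I)) - F (z0 + r * (a + y * Complex.I))))
        (𝓝[>] 0) (𝓝 (((b - a) * (d - c)) • lam)) ∧
      Tendsto (fun r : ℝ => r⁻¹ • ∫ x in a..b, (F (z0 + r * (x + d * Complex.I)) - F (z0 + r * (x + c * Complex.I))))
        (𝓝[>] 0) (𝓝 (((b - a) * (d - c)) • mu))) :
    ∃ A B : ℂ, ∀ z, H z = H 0 + A * z + B * (starRingEnd ℂ) z := by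
  have hrr : Tendsto r atTop (𝓝[>] 0) := tendsto_nhdsWithin_iff.2 ⟨hr0, Eventually.of_forall hr⟩
  have hd1 : ∀ a b c d : ℝ, a ≤ b → c ≤ d →
      Tendsto (fun r : ℝ => r⁻¹ • ∫ y in c..d, (F (z0 + r * (b * 1 + y * Complex.I)) - F (z0 + r * (a * 1 + y * Complex.I))))
        (𝓝[>] 0) (𝓝 (((b - a) * (d - c)) • lam)) := by
    intro a b c d hab hcd
    simpa only [mul_one] using (hd a b c d hab hcd).1
  have hd2 : ∀ a b c d : ℝ, a ≤ b → c ≤ d →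
      Tendsto (fun r : ℝ => r⁻¹ • ∫ y in c..d, (F (z0 + r * (b * Complex.I + y * 1)) - F (z0 + r * (a * Complex.I + y * 1))))
        (𝓝[>] 0) (𝓝 (((b - a) * (d - c)) • mu)) := by
    intro a b c d hab hcd
    have := (hd c d a b hcd hab).2
    rw [mul_comm (d - c)] at this
    refine this.congr (fun r => ?_)
    congr 2; funext y
    congr 2 <;> ring_nf
  obtain ⟨L, hL⟩ : ∃ L, Tendsto (fun n => m n * r n) atTop (𝓝 L) := by
    have t1 := zoom_dct hF hr hlim hbd 1 Complex.I_ne_zero 0 1 0 1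
    have t2 := (hd1 0 1 0 1 (by norm_num) (by norm_num)).comp hrr
    have e : ((1 - 0 : ℝ) * (1 - 0)) • lam = lam := by simp
    rw [e] at t2
    refine ⟨_, (t1.div t2 hlam).congr' ?_⟩
    filter_upwards [t2.eventually_ne hlam] with n hn
    simp only [Function.comp] at hn
    simp only [Function.comp, Pi.div_apply]
    exact mul_div_cancel_right₀ _ hn
  have k1 := zoom_half hF hr hr0 hH hlim hbd 1 Complex.I_ne_zero hL hd1
  have k2 := zoom_half hF hr hr0 hH hlim hbd Complex.I one_ne_zero hL hd2
  refine ⟨(L * lam - Complex.I * (L * mu)) / 2, (L * lam + Complex.I * (L * mu)) / 2, fun z => ?_⟩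
  have e1 := k1 0 z.re z.im
  have e2 := k2 0 z.im 0
  simp only [Complex.ofReal_zero, zero_mul, mul_one, zero_add, add_zero, sub_zero, Complex.re_add_im] at e1 e2
  have hz := Complex.re_add_im z
  have hz' : (starRingEnd ℂ) z = z.re - z.im * Complex.I := by
    apply Complex.ext <;> simp
  rw [hz']
  have hz2 : (L * lam - Complex.I * (L * mu)) / 2 * z = (L * lam - Complex.I * (L * mu)) / 2 * (z.re + z.im * Complex.I) := by
    rw [hz]
  rw [hz2]
  have hI := Complex.I_mul_I
  linear_combination e1 + e2 + (L * mu * z.im) * hI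

open Filter Topology MeasureTheory

lemma affine_of_period {f : ℂ → ℂ} (hinj : Function.Injective f) {s A B τ : ℂ}
    (hper : ∀ Y, f (Y + 1) = f Y + τ)
    (hf : ∀ X, X ≠ 0 → f (s + X) - f s = 1 / (A / X + B / (starRingEnd ℂ) X)) :
    ∃ a b : ℂ, a ≠ 0 ∧ ((∀ Y, f Y = a * Y + b) ∨ (∀ Y, f Y = a * (starRingEnd ℂ) Y + b)) := by
  have hI2 : Complex.I ^ 2 = -1 := Complex.I_sq
  have hne : ∀ X, X ≠ 0 → A / X + B / (starRingEnd ℂ) X ≠ 0 := by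
    intro X hX h0
    have h1 := hf X hX
    rw [h0, div_zero, sub_eq_zero] at h1
    have := hinj h1
    simp [hX] at this
  have hI1 : (1 : ℂ) + Complex.I ≠ 0 := by
    intro h; have := congrArg Complex.re h; simp at this
  have hI1' : (1 : ℂ) - Complex.I ≠ 0 := by
    intro h; have := congrArg Complex.re h; simp at this
  have n1 := hne 1 one_ne_zero
  have n2 := hne Complex.I Complex.I_ne_zero
  have n3 := hne (1 + Complex.I) hI1
  have e1 := hf 1 one_ne_zero
  have e2 := hf Complex.I Complex.I_ne_zero
  have e3 := hf (1 + Complex.I) hI1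
  have p1 := hper s
  have p2 := hper (s + Complex.I)
  have c3 : (starRingEnd ℂ) (1 + Complex.I) = 1 - Complex.I := by simp [sub_eq_add_neg]
  have r1 : A / 1 + B / (starRingEnd ℂ) 1 = A + B := by simp
  have r2 : A / Complex.I + B / (starRingEnd ℂ) Complex.I = Complex.I * (B - A) := by
    rw [Complex.conj_I]
    field_simp
    linear_combination (A - B) * hI2
  have r3 : A / (1 + Complex.I) + B / (starRingEnd ℂ) (1 + Complex.I) = ((A + B) + Complex.I * (B - A)) / 2 := by
    rw [c3]
    field_simp
    linear_combination (-A * Complex.I + B * Complex.I + A + B) * hI2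
  rw [r1] at n1 e1
  rw [r2] at n2 e2
  rw [r3] at n3 e3
  have key : 1 / (((A + B) + Complex.I * (B - A)) / 2) = 1 / (A + B) + 1 / (Complex.I * (B - A)) := by
    rw [← e1, ← e2, ← e3, p1]
    rw [show s + (1 + Complex.I) = s + Complex.I + 1 by ring, p2]; ring
  have hAB : A * B = 0 := by
    have n3' : (A + B) + Complex.I * (B - A) ≠ 0 := fun h => n3 (by rw [h]; simp)
    set S := A + B with hS
    set T := Complex.I * (B - A) with hT
    have : 1 / ((S + T) / 2) * ((S + T) * S * T) = (1 / S + 1 / T) * ((S + T) * S * T) := by rw [key]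
    have e : S ^ 2 + T ^ 2 = 0 := by
      field_simp at this
      linear_combination -this
    rw [hS, hT] at e
    linear_combination e / 4 - (B - A) ^ 2 / 4 * hI2
  rcases mul_eq_zero.1 hAB with h | h
  · have hB : B ≠ 0 := by intro hB; apply n1; rw [h, hB]; simp
    refine ⟨1 / B, f s - 1 / B * (starRingEnd ℂ) s, by simpa using hB, Or.inr fun Y => ?_⟩
    by_cases hY : Y = s
    · rw [hY]; ring
    · have hYs : Y - s ≠ 0 := sub_ne_zero.2 hY
      have hYs' : (starRingEnd ℂ) (Y - s) ≠ 0 := (map_ne_zero _).2 hYs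
      have := hf (Y - s) hYs
      rw [h, zero_div, zero_add, one_div_div, add_sub_cancel, map_sub] at this
      linear_combination this
  · have hA : A ≠ 0 := by intro hA; apply n1; rw [h, hA]; simp
    refine ⟨1 / A, f s - 1 / A * s, by simpa using hA, Or.inl fun Y => ?_⟩
    by_cases hY : Y = s
    · rw [hY]; ring
    · have hYs : Y - s ≠ 0 := sub_ne_zero.2 hY
      have := hf (Y - s) hYs
      rw [h, zero_div, add_zero, one_div_div, add_sub_cancel] at this
      linear_combination this

lemma blowup {F : ℂ → ℂ} (hF : Continuous F) {m : ℕ} {fk : Fin m → ℂ → ℂ} (hfk : ∀ ρ, Continuous (fk ρ))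
    (hinj : ∀ ρ, Function.Injective (fk ρ))
    (hLL : ∀ ε : ℝ, 0 < ε → ∃ c : ℝ, 0 < c ∧ ∀ ρ Y Y', ε ≤ ‖Y - Y'‖ → c * ‖Y - Y'‖ ≤ ‖fk ρ Y - fk ρ Y'‖)
    {z0 lam mu : ℂ} (hlam : lam ≠ 0) (hd : ∀ a b c d : ℝ, a ≤ b → c ≤ d →
      Tendsto (fun r : ℝ => r⁻¹ • ∫ y in c..d, (F (z0 + r * (b + y * Complex.I)) - F (z0 + r * (a + y * Complex.I))))
        (𝓝[>] 0) (𝓝 (((b - a) * (d - c)) • lam)) ∧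
      Tendsto (fun r : ℝ => r⁻¹ • ∫ x in a..b, (F (z0 + r * (x + d * Complex.I)) - F (z0 + r * (x + c * Complex.I))))
        (𝓝[>] 0) (𝓝 (((b - a) * (d - c)) • mu)))
    {M : ℝ} (hseq : ∀ N : ℝ, ∃ (ρ : Fin m) (s x x' Q K : ℂ), K ≠ 0 ∧ N < ‖Q‖ ∧ ‖s‖ ≤ M ∧ ‖z0 - x‖ * ‖Q‖ ≤ M ∧
      ∀ z, F z = x' - 1 / (K * (fk ρ (s - 1 / (Q * (z - x))) - fk ρ s))) :
    ∃ ρ s A B, ∀ X, X ≠ 0 → fk ρ (s + X) - fk ρ s = 1 / (A / X + B / (starRingEnd ℂ) X) := by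
  choose ρ s x x' Q K hK hQ hs hx hFe using fun n : ℕ => hseq n
  have hQ0 : ∀ n, 0 < ‖Q n‖ := fun n => (Nat.cast_nonneg n).trans_lt (hQ n)
  have hQ0' : ∀ n, (‖Q n‖ : ℂ) ≠ 0 := fun n => by exact_mod_cast (hQ0 n).ne'
  set ζ : ℕ → ℂ := fun n => Q n / ‖Q n‖ with hζ
  set θ : ℕ → ℂ := fun n => ‖Q n‖ * (z0 - x n) with hθ
  have hζ1 : ∀ n, ‖ζ n‖ = 1 := fun n => by simp [hζ, (hQ0 n).ne']
  have hθ1 : ∀ n, ‖θ n‖ ≤ M := fun n => by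
    simp only [hθ, norm_mul, Complex.norm_real, norm_norm]; rw [mul_comm]; exact hx n
  have hM0 : 0 ≤ M := (norm_nonneg _).trans (hs 0)
  have hcomp : IsCompact ((Set.univ : Set (Fin m)) ×ˢ (Metric.closedBall (0:ℂ) M ×ˢ (Metric.closedBall (0:ℂ) 1 ×ˢ Metric.closedBall (0:ℂ) M))) :=
    isCompact_univ.prod ((isCompact_closedBall _ _).prod ((isCompact_closedBall _ _).prod (isCompact_closedBall _ _)))
  obtain ⟨⟨ρ0, s0, ζ0, θ0⟩, -, φ, hφ, hlim⟩ := hcomp.tendsto_subseq (x := fun n => (ρ n, s n, ζ n, θ n)) (fun n => by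
    simp only [Set.mem_prod, Set.mem_univ, Metric.mem_closedBall, dist_zero_right, true_and]
    exact ⟨hs n, (hζ1 n).le, hθ1 n⟩)
  rw [Prod.tendsto_iff, Prod.tendsto_iff, Prod.tendsto_iff] at hlim
  obtain ⟨l1, l2, l3, l4⟩ := hlim
  simp only [Function.comp] at l1 l2 l3 l4
  have hρ : ∀ᶠ n in atTop, ρ (φ n) = ρ0 := by
    rw [nhds_discrete] at l1
    exact l1 (by simp : ({ρ0} : Set (Fin m)) ∈ pure ρ0)
  have hζ0 : ‖ζ0‖ = 1 := tendsto_nhds_unique l3.norm (by simp [hζ1])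
  have hζ0' : ζ0 ≠ 0 := by rw [← norm_ne_zero_iff, hζ0]; exact one_ne_zero
  set f := fk ρ0 with hf
  set H : ℂ → ℂ := fun z => 1 / (f (s0 - 1 / (ζ0 * (θ0 + z))) - f s0) with hH
  have hHeq : ∀ n z, -K n * (F (z0 + ((1 / ‖Q n‖ : ℝ) : ℂ) * z) - x' n) =
      1 / (fk (ρ n) (s n - 1 / (ζ n * (θ n + z))) - fk (ρ n) (s n)) := by
    intro n z
    rw [hFe n]
    have e : Q n * (z0 + ((1 / ‖Q n‖ : ℝ) : ℂ) * z - x n) = ζ n * (θ n + z) := by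
      simp only [hζ, hθ]; have := hQ0' n; push_cast; field_simp; ring
    rw [e]
    have hKn := hK n
    rw [one_div, mul_inv, one_div]
    field_simp
    ring
  have hfY : ∀ z, z ≠ -θ0 → f (s0 - 1 / (ζ0 * (θ0 + z))) - f s0 ≠ 0 := by
    intro z hz h0
    have := hinj ρ0 (sub_eq_zero.1 h0)
    have hz' : θ0 + z ≠ 0 := fun h => hz (by linear_combination h)
    have h2 : 1 / (ζ0 * (θ0 + z)) = 0 := by linear_combination -this
    simp [hζ0', hz'] at h2
  have hHθ : H (-θ0) = 0 := by simp [hH]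
  have hHc : Continuous H := by
    rw [continuous_iff_continuousAt]
    intro z
    by_cases hz : z = -θ0
    · rw [hz, ContinuousAt, hHθ]
      obtain ⟨c, hc, hcc⟩ := hLL 1 one_pos
      have hb : Tendsto (fun z => ‖θ0 + z‖ / c) (𝓝 (-θ0)) (𝓝 0) := by
        have : Continuous (fun z => ‖θ0 + z‖ / c) := by fun_prop
        simpa using this.tendsto (-θ0)
      have hb2 : Tendsto (fun z => ‖θ0 + z‖) (𝓝 (-θ0)) (𝓝 0) := by
        have : Continuous (fun z => ‖θ0 + z‖) := by fun_prop
        simpa using this.tendsto (-θ0)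
      refine squeeze_zero_norm' ?_ hb
      filter_upwards [hb2.eventually_lt_const one_pos] with w hw
      by_cases hw0 : w = -θ0
      · rw [hw0, hHθ]; simp
      have hw1 : 0 < ‖θ0 + w‖ := by
        rw [norm_pos_iff]; intro h; exact hw0 (by linear_combination h)
      have hdist : ‖s0 - 1 / (ζ0 * (θ0 + w)) - s0‖ = 1 / ‖θ0 + w‖ := by
        rw [show s0 - 1 / (ζ0 * (θ0 + w)) - s0 = -(1 / (ζ0 * (θ0 + w))) by ring, norm_neg, norm_div,
          norm_mul, hζ0, one_mul, norm_one]
      have h3 := hcc ρ0 (s0 - 1 / (ζ0 * (θ0 + w))) s0 (by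
        rw [hdist, le_div_iff₀ hw1]; linarith)
      rw [hdist] at h3
      rw [hH]; simp only
      rw [norm_div, norm_one]
      refine (one_div_le_one_div_of_le (by positivity) h3).trans (le_of_eq ?_)
      field_simp
    · have hz' : θ0 + z ≠ 0 := fun h => hz (by linear_combination h)
      refine ContinuousAt.div continuousAt_const ?_ (hfY z hz)
      refine ContinuousAt.sub ?_ continuousAt_const
      refine (hfk ρ0).continuousAt.comp ?_
      refine ContinuousAt.sub continuousAt_const (ContinuousAt.div continuousAt_const (by fun_prop) ?_)
      exact mul_ne_zero hζ0' hz'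
  have hr0 : Tendsto (fun n => 1 / ‖Q (φ n)‖) atTop (𝓝 0) := by
    have : Tendsto (fun n => ‖Q (φ n)‖) atTop atTop := by
      refine tendsto_atTop_mono (fun n => ?_) tendsto_natCast_atTop_atTop
      exact (Nat.cast_le.2 (hφ.id_le n)).trans (hQ (φ n)).le
    simp only [one_div]; exact this.inv_tendsto_atTop
  obtain ⟨A, B, hAB⟩ := zoom hF (z0 := z0) (r := fun n => 1 / ‖Q (φ n)‖) (fun n => by have := hQ0 (φ n); positivity) hr0
    (m := fun n => -K (φ n)) (k := fun n => x' (φ n)) (p := -θ0) hHc (by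
      intro z hz
      simp only [hHeq]
      have hz' : θ0 + z ≠ 0 := fun h => hz (by linear_combination h)
      have t1 : Tendsto (fun n => s (φ n) - 1 / (ζ (φ n) * (θ (φ n) + z))) atTop (𝓝 (s0 - 1 / (ζ0 * (θ0 + z)))) :=
        l2.sub (tendsto_const_nhds.div (l3.mul (l4.add_const z)) (mul_ne_zero hζ0' hz'))
      have t2 := tendsto_const_nhds (x := (1:ℂ)).div ((((hfk ρ0).tendsto _).comp t1).sub (((hfk ρ0).tendsto _).comp l2)) (hfY z hz)
      refine t2.congr' ?_
      filter_upwards [hρ] with n hn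
      simp [hn]) (by
      intro R
      obtain ⟨c, hc, hcc⟩ := hLL (1 / (M + |R| + 1)) (by positivity)
      refine ⟨1 / (c * (1 / (M + |R| + 1))), Eventually.of_forall fun n z hz => ?_⟩
      rw [hHeq]
      by_cases h0 : θ (φ n) + z = 0
      · rw [h0]; simp; positivity
      have hw1 : 0 < ‖θ (φ n) + z‖ := norm_pos_iff.2 h0
      have hw2 : ‖θ (φ n) + z‖ ≤ M + |R| + 1 := by
        refine (norm_add_le _ _).trans ?_
        linarith [hθ1 (φ n), le_abs_self R]
      have hdist : ‖s (φ n) - 1 / (ζ (φ n) * (θ (φ n) + z)) - s (φ n)‖ = 1 / ‖θ (φ n) + z‖ := by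
        rw [show s (φ n) - 1 / (ζ (φ n) * (θ (φ n) + z)) - s (φ n) = -(1 / (ζ (φ n) * (θ (φ n) + z))) by ring, norm_neg, norm_div,
          norm_mul, hζ1, one_mul, norm_one]
      have hle := one_div_le_one_div_of_le hw1 hw2
      have h3 := hcc (ρ (φ n)) (s (φ n) - 1 / (ζ (φ n) * (θ (φ n) + z))) (s (φ n)) (by
        rw [hdist]; exact hle)
      rw [hdist] at h3
      rw [norm_div, norm_one]
      refine one_div_le_one_div_of_le (by positivity) (le_trans ?_ h3)
      gcongr) hlam hd
  refine ⟨ρ0, s0, -A / ζ0, -B / (starRingEnd ℂ) ζ0, fun X hX => ?_⟩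
  have hcζ : (starRingEnd ℂ) ζ0 ≠ 0 := (map_ne_zero _).2 hζ0'
  have hcX : (starRingEnd ℂ) X ≠ 0 := (map_ne_zero _).2 hX
  have h1 := hAB (-θ0 - 1 / (ζ0 * X))
  have h2 := hAB (-θ0)
  rw [hHθ] at h2
  have h3 : H (-θ0 - 1 / (ζ0 * X)) = 1 / (f (s0 + X) - f s0) := by
    rw [hH]; simp only
    congr 4
    field_simp
    ring
  rw [h3] at h1
  simp only [map_sub, map_neg, map_div₀, map_one, map_mul] at h1 h2
  rw [← one_div_one_div (f (s0 + X) - f s0), h1]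
  congr 1
  have : H 0 = A * θ0 + B * (starRingEnd ℂ) θ0 := by linear_combination -h2
  rw [this]
  field_simp
  ring

open Filter Topology MeasureTheory

lemma near_quad {I : Type} {v : I → ℂ × ℂ} {C : ℝ} (h : SideSys v C) (hC : 1 ≤ C) {k : I}
    {y : ℂ × ℂ} (hy : dt (v k) y = 1) (z : ℂ) {ε : ℝ} (hε : 0 < ε) :
    ∃ i, dt (v k) (v i) ≠ 0 ∧ ‖zc (v k) y (v i) - z‖ < ε ∧
      ‖z - zc (v k) y (v i)‖ * ‖dt (v k) (v i) ^ 2‖ ≤ C ^ 2 := by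
  obtain ⟨n, hn⟩ := pow_unbounded_of_one_lt (max (C * C) (C / ε)) (by norm_num : (1:ℝ) < 2)
  have hn1 := (le_max_left _ _).trans_lt hn
  have hn2 := (le_max_right _ _).trans_lt hn
  have h2 : (0:ℝ) < 2 ^ n := by positivity
  obtain ⟨j, h1, h3⟩ := near_exists h hy n z
  have hq : dt (v k) (v j) ≠ 0 := by
    intro h0
    have := h.V2 k j h0 y
    rw [hy, norm_one] at this
    rw [h0, mul_zero, sub_zero] at h3
    have h5 : ‖dt (v j) y‖ * 2 ^ n * C ≤ C * C := by gcongr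
    nlinarith
  refine ⟨j, hq, ?_⟩
  have hq1 := h.V1 _ _ hq
  have e : zc (v k) y (v j) - z = (dt (v j) y - z * dt (v k) (v j)) / dt (v k) (v j) := by
    rw [zc]; field_simp
  have hqp : 0 < ‖dt (v k) (v j)‖ := norm_pos_iff.2 hq
  constructor
  · rw [e, norm_div]
    refine (div_le_self (norm_nonneg _) hq1).trans_lt ?_
    rw [div_lt_iff₀ hε] at hn2
    by_contra hc
    push Not at hc
    have : ε * 2 ^ n ≤ C := (by gcongr : ε * 2 ^ n ≤ _ * 2 ^ n).trans h3
    linarith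
  · rw [norm_sub_rev, e, norm_div, norm_pow]
    set D := ‖dt (v j) y - z * dt (v k) (v j)‖
    have e2 : D / ‖dt (v k) (v j)‖ * ‖dt (v k) (v j)‖ ^ 2 = D * ‖dt (v k) (v j)‖ := by
      field_simp
    rw [e2]
    calc D * ‖dt (v k) (v j)‖ ≤ D * (C * 2 ^ n) := by gcongr
      _ = (D * 2 ^ n) * C := by ring
      _ ≤ C * C := by gcongr
      _ = C ^ 2 := by ring

lemma approx_large {I : Type} {v : I → ℂ × ℂ} {C : ℝ} (h : SideSys v C) (hC : 1 ≤ C) {k : I}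
    {y : ℂ × ℂ} (hy : dt (v k) y = 1) (z : ℂ) (hz : ∀ i, z ≠ zc (v k) y (v i)) (N : ℝ) :
    ∃ i, dt (v k) (v i) ≠ 0 ∧ N < ‖dt (v k) (v i) ^ 2‖ ∧
      ‖z - zc (v k) y (v i)‖ * ‖dt (v k) (v i) ^ 2‖ ≤ C ^ 2 := by
  by_contra hcon
  push Not at hcon
  obtain ⟨a, ha0, ha1, ha2⟩ := near_quad h hC hy z (ε := 1 / (2 * (|N| + 1))) (by positivity)
  have ha3 : 0 < ‖zc (v k) y (v a) - z‖ := norm_pos_iff.2 (sub_ne_zero.2 (hz a).symm)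
  obtain ⟨b, hb0, hb1, hb2⟩ := near_quad h hC hy z (ε := min (1 / (2 * (|N| + 1))) ‖zc (v k) y (v a) - z‖)
    (lt_min (by positivity) ha3)
  have hNa : ‖dt (v k) (v a) ^ 2‖ ≤ N := by
    by_contra h'; exact absurd ha2 (not_le.2 (hcon a ha0 (not_le.1 h')))
  have hNb : ‖dt (v k) (v b) ^ 2‖ ≤ N := by
    by_contra h'; exact absurd hb2 (not_le.2 (hcon b hb0 (not_le.1 h')))
  have hne : zc (v k) y (v a) ≠ zc (v k) y (v b) := by
    intro h'
    rw [← h'] at hb1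
    exact absurd (hb1.trans_le (min_le_right _ _)) (lt_irrefl _)
  have hs := zc_sub hy ha0 hb0
  have hdne : dt (v a) (v b) ≠ 0 := by
    intro h'; rw [h', zero_div, sub_eq_zero] at hs; exact hne hs
  have h1 := h.V1 _ _ hdne
  have hlt : ‖zc (v k) y (v a) - zc (v k) y (v b)‖ < 1 / (|N| + 1) := by
    have : ‖zc (v k) y (v a) - zc (v k) y (v b)‖ ≤ ‖zc (v k) y (v a) - z‖ + ‖zc (v k) y (v b) - z‖ := by
      rw [norm_sub_rev (zc (v k) y (v b)) z]
      calc _ = ‖(zc (v k) y (v a) - z) + (z - zc (v k) y (v b))‖ := by congr 1; ring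
        _ ≤ _ := norm_add_le _ _
    have e : 1 / (2 * (|N| + 1)) + 1 / (2 * (|N| + 1)) = 1 / (|N| + 1) := by field_simp; norm_num
    linarith [hb1.trans_le (min_le_left _ _)]
  rw [hs, norm_div, norm_mul] at hlt
  rw [norm_pow] at hNa hNb
  have hpa : 0 < ‖dt (v k) (v a)‖ := norm_pos_iff.2 ha0
  have hpb : 0 < ‖dt (v k) (v b)‖ := norm_pos_iff.2 hb0
  rw [div_lt_div_iff₀ (by positivity) (by positivity)] at hlt
  have : ‖dt (v k) (v a)‖ * ‖dt (v k) (v b)‖ ≤ |N| := by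
    have := le_abs_self N
    nlinarith [sq_nonneg (‖dt (v k) (v a)‖ - ‖dt (v k) (v b)‖)]
  nlinarith [abs_nonneg N]

theorem rigidity {I : Type} [Countable I] {v w : I → ℂ × ℂ} {C : ℝ} (h : FullSys v w C)
    (o : I) {m : ℕ} (R : Fin m → I) (ur ur' : Fin m → ℂ × ℂ)
    (hur : ∀ ρ, dt (v (R ρ)) (ur ρ) = 1) (hur' : ∀ ρ, dt (w (R ρ)) (ur' ρ) = 1) (M : ℝ)
    (hE : ∀ k, ∃ ρ u u', dt (v k) u = 1 ∧ dt (w k) u' = 1 ∧ ‖zc (v k) u (v o)‖ ≤ M ∧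
      ∀ i, dt (v k) (v i) ≠ 0 → ∃ j, dt (v (R ρ)) (v j) ≠ 0 ∧
        zc (v k) u (v i) = zc (v (R ρ)) (ur ρ) (v j) ∧ zc (w k) u' (w i) = zc (w (R ρ)) (ur' ρ) (w j))
    (hT : ∀ ρ, ∃ τ, ∀ i, dt (v (R ρ)) (v i) ≠ 0 → ∃ j, dt (v (R ρ)) (v j) ≠ 0 ∧
      zc (v (R ρ)) (ur ρ) (v j) = zc (v (R ρ)) (ur ρ) (v i) + 1 ∧
      zc (w (R ρ)) (ur' ρ) (w j) = zc (w (R ρ)) (ur' ρ) (w i) + τ) :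
    ∃ k y y', dt (v k) y = 1 ∧ dt (w k) y' = 1 ∧ ∃ a b : ℂ, a ≠ 0 ∧
      ((∀ i, dt (v k) (v i) ≠ 0 → zc (w k) y' (w i) = a * zc (v k) y (v i) + b) ∨
       (∀ i, dt (v k) (v i) ≠ 0 → zc (w k) y' (w i) = a * (starRingEnd ℂ) (zc (v k) y (v i)) + b)) := by
  obtain ⟨F, G, H⟩ := exists_homeoFam h
  obtain ⟨y, hy⟩ := exists_dual (h.Sv.V0 o)
  obtain ⟨y', hy'⟩ := exists_dual (h.Sw.V0 o)
  obtain ⟨c, hc, hqs⟩ := QS h H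
  obtain ⟨z0, hz0, lam, mu, hlam, hd⟩ := good_point (H.contF hy hy') (H.contG hy hy') (H.GF o y y' hy hy')
    (H.FG o y y' hy hy') hc (hqs o y y' hy hy') (Set.countable_range (fun i => zc (v o) y (v i)))
  set fk : Fin m → ℂ → ℂ := fun ρ => F (R ρ) (ur ρ) (ur' ρ) with hfk
  have hcont : ∀ ρ, Continuous (fk ρ) := fun ρ => H.contF (hur ρ) (hur' ρ)
  have hinj : ∀ ρ, Function.Injective (fk ρ) := fun ρ =>
    Function.LeftInverse.injective (H.GF (R ρ) (ur ρ) (ur' ρ) (hur ρ) (hur' ρ))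
  obtain ⟨ρ, s, A, B, hAB⟩ := blowup (H.contF hy hy') hcont hinj (by
      intro ε hε
      obtain ⟨c, _, hc, -, hh⟩ := LL H hε
      exact ⟨c, hc, fun ρ Y Y' hY => (hh _ _ _ (hur ρ) (hur' ρ) Y Y' hY).1⟩) hlam hd (M := max M (C ^ 2)) (by
      intro N
      obtain ⟨k, hk0, hkN, hkC⟩ := approx_large h.Sv h.hC hy z0 (fun i hi => hz0 ⟨i, hi.symm⟩) N
      obtain ⟨ρ, u, u', hu, hu', hM, hi⟩ := hE k
      refine ⟨ρ, zc (v k) u (v o), zc (v o) y (v k), zc (w o) y' (w k), dt (v o) (v k) ^ 2, dt (w o) (w k) ^ 2,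
        pow_ne_zero _ (fun hh => hk0 (h.Jwv.J0 _ _ hh)), hkN, hM.trans (le_max_left _ _), hkC.trans (le_max_right _ _), ?_⟩
      intro z
      have heq : F k u u' = fk ρ := by
        refine Continuous.ext_on (cusp_denseSet h.Sv h.hC hu) (H.contF hu hu') (hcont ρ) ?_
        rintro _ ⟨i, hi0, rfl⟩
        obtain ⟨j, hj0, e1, e2⟩ := hi i hi0
        rw [H.cusp k u u' hu hu' i hi0, e2, e1, hfk]
        exact (H.cusp _ _ _ (hur ρ) (hur' ρ) j hj0).symm
      rw [base_change h H hy hy' hu hu' hk0 z, heq])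
  obtain ⟨τ, hτ⟩ := hT ρ
  have hper : ∀ Y, fk ρ (Y + 1) = fk ρ Y + τ := by
    have : (fun Y => fk ρ (Y + 1)) = fun Y => fk ρ Y + τ := by
      refine Continuous.ext_on (cusp_denseSet h.Sv h.hC (hur ρ)) ((hcont ρ).comp (by fun_prop))
        ((hcont ρ).add continuous_const) ?_
      rintro _ ⟨i, hi0, rfl⟩
      obtain ⟨j, hj0, e1, e2⟩ := hτ i hi0
      simp only [hfk]
      rw [← e1, H.cusp _ _ _ (hur ρ) (hur' ρ) j hj0, H.cusp _ _ _ (hur ρ) (hur' ρ) i hi0, e2]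
    exact fun Y => congrFun this Y
  obtain ⟨a, b, ha, hab⟩ := affine_of_period (hinj ρ) hper hAB
  refine ⟨R ρ, ur ρ, ur' ρ, hur ρ, hur' ρ, a, b, ha, ?_⟩
  rcases hab with hab | hab
  · left; intro i hi; rw [← H.cusp _ _ _ (hur ρ) (hur' ρ) i hi]; exact hab _
  · right; intro i hi; rw [← H.cusp _ _ _ (hur ρ) (hur' ρ) i hi]; exact hab _

section SM5a
open Matrix

section sl
variable {R : Type*} [CommRing R]

def ac (A : SL2 R) (x : R × R) : R × R :=
  (A 0 0 * x.1 + A 0 1 * x.2, A 1 0 * x.1 + A 1 1 * x.2)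

lemma sl_ext {A B : SL2 R} (h00 : A 0 0 = B 0 0) (h01 : A 0 1 = B 0 1)
    (h10 : A 1 0 = B 1 0) (h11 : A 1 1 = B 1 1) : A = B := by
  ext i j; fin_cases i <;> fin_cases j <;> assumption

lemma sl_det (A : SL2 R) : A 0 0 * A 1 1 - A 0 1 * A 1 0 = 1 := by
  have := A.det_coe; rwa [det_fin_two] at this

lemma sl_mul (A B : SL2 R) (i j : Fin 2) :
    (A * B) i j = A i 0 * B 0 j + A i 1 * B 1 j := by
  have := congrFun (congrFun (Matrix.SpecialLinearGroup.coe_mul A B) i) j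
  rw [Matrix.mul_apply, Fin.sum_univ_two] at this; exact this

lemma sl_inv00 (A : SL2 R) : A⁻¹ 0 0 = A 1 1 := by
  have := congrFun (congrFun (Matrix.SpecialLinearGroup.coe_inv A) 0) 0
  rw [adjugate_fin_two] at this; exact this
lemma sl_inv01 (A : SL2 R) : A⁻¹ 0 1 = - A 0 1 := by
  have := congrFun (congrFun (Matrix.SpecialLinearGroup.coe_inv A) 0) 1
  rw [adjugate_fin_two] at this; exact this
lemma sl_inv10 (A : SL2 R) : A⁻¹ 1 0 = - A 1 0 := by
  have := congrFun (congrFun (Matrix.SpecialLinearGroup.coe_inv A) 1) 0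
  rw [adjugate_fin_two] at this; exact this
lemma sl_inv11 (A : SL2 R) : A⁻¹ 1 1 = A 0 0 := by
  have := congrFun (congrFun (Matrix.SpecialLinearGroup.coe_inv A) 1) 1
  rw [adjugate_fin_two] at this; exact this

lemma sl_neg (A : SL2 R) (i j : Fin 2) : (-A) i j = - A i j := by
  rw [SpecialLinearGroup.coe_neg]; rfl

lemma sl_one00 : (1 : SL2 R) 0 0 = 1 := by simp
lemma sl_one01 : (1 : SL2 R) 0 1 = 0 := by simp
lemma sl_one10 : (1 : SL2 R) 1 0 = 0 := by simp
lemma sl_one11 : (1 : SL2 R) 1 1 = 1 := by simp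

lemma ac_mul (A B : SL2 R) (x : R × R) : ac (A * B) x = ac A (ac B x) := by
  simp only [ac, sl_mul]; ext <;> simp only <;> ring
lemma ac_one (x : R × R) : ac 1 x = x := by
  simp only [ac, sl_one00, sl_one01, sl_one10, sl_one11]; ext <;> simp
lemma ac_neg (A : SL2 R) (x : R × R) : ac (-A) x = - ac A x := by
  simp only [ac, sl_neg]; ext <;> simp only [Prod.fst_neg, Prod.snd_neg] <;> ring
lemma ac_vneg (A : SL2 R) (x : R × R) : ac A (-x) = - ac A x := by
  simp only [ac]; ext <;> simp only [Prod.fst_neg, Prod.snd_neg] <;> ring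
lemma ac_smul (A : SL2 R) (c : R) (x : R × R) : ac A (c • x) = c • ac A x := by
  simp only [ac]; ext <;> simp only [Prod.smul_fst, Prod.smul_snd, smul_eq_mul] <;> ring
lemma ac_add (A : SL2 R) (x y : R × R) : ac A (x + y) = ac A x + ac A y := by
  simp only [ac]; ext <;> simp only [Prod.fst_add, Prod.snd_add] <;> ring
lemma ac_inv_ac (A : SL2 R) (x : R × R) : ac A⁻¹ (ac A x) = x := by
  rw [← ac_mul, inv_mul_cancel, ac_one]
lemma ac_ac_inv (A : SL2 R) (x : R × R) : ac A (ac A⁻¹ x) = x := by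
  rw [← ac_mul, mul_inv_cancel, ac_one]
lemma ac_zero (A : SL2 R) : ac A 0 = 0 := by
  simp only [ac]; ext <;> simp
lemma ac_ne_zero {A : SL2 R} {x : R × R} (hx : x ≠ 0) : ac A x ≠ 0 := by
  intro h; apply hx; rw [← ac_inv_ac A x, h, ac_zero]

def Pg (v : R × R) (t : R) : SL2 R :=
  ⟨!![1 - t * v.1 * v.2, t * v.1 ^ 2; - t * v.2 ^ 2, 1 + t * v.1 * v.2], by
    rw [det_fin_two_of]; ring⟩

lemma Pg00 (v : R × R) (t : R) : Pg v t 0 0 = 1 - t * v.1 * v.2 := rfl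
lemma Pg01 (v : R × R) (t : R) : Pg v t 0 1 = t * v.1 ^ 2 := rfl
lemma Pg10 (v : R × R) (t : R) : Pg v t 1 0 = - t * v.2 ^ 2 := rfl
lemma Pg11 (v : R × R) (t : R) : Pg v t 1 1 = 1 + t * v.1 * v.2 := rfl

lemma ac_Pg (v y : R × R) (t : R) : ac (Pg v t) y = y + (t * (v.1 * y.2 - v.2 * y.1)) • v := by
  simp only [ac, Pg00, Pg01, Pg10, Pg11]
  ext <;> simp only [Prod.fst_add, Prod.snd_add, Prod.smul_fst, Prod.smul_snd, smul_eq_mul] <;> ring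

lemma Pg_add (v : R × R) (s t : R) : Pg v (s + t) = Pg v s * Pg v t := by
  apply sl_ext <;> simp only [sl_mul, Pg00, Pg01, Pg10, Pg11] <;> ring

lemma Pg_zero (v : R × R) : Pg v 0 = 1 := by
  apply sl_ext <;> simp [Pg00, Pg01, Pg10, Pg11]

lemma Pg_zpow (v : R × R) (t : R) (n : ℤ) : Pg v t ^ n = Pg v (n * t) := by
  let f : Multiplicative R →* SL2 R :=
    { toFun := fun t => Pg v t.toAdd, map_one' := Pg_zero v, map_mul' := fun s t => Pg_add v _ _ }
  have : f (Multiplicative.ofAdd t ^ n) = f (Multiplicative.ofAdd t) ^ n := map_zpow f _ _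
  rw [← ofAdd_zsmul, zsmul_eq_mul] at this
  exact this.symm

lemma Pg_conj (A : SL2 R) (v : R × R) (t : R) :
    A * Pg v t * A⁻¹ = Pg (ac A v) t := by
  rw [mul_inv_eq_iff_eq_mul]
  have hd := sl_det A
  apply sl_ext <;> simp only [sl_mul, Pg00, Pg01, Pg10, Pg11, ac]
  · linear_combination (t * v.1 * v.2 * A 0 0 + t * v.2^2 * A 0 1) * hd
  · linear_combination (t * v.1 ^ 2 * A 0 0 + t * v.1 * v.2 * A 0 1) * hd * (-1)
  · linear_combination (t * v.1 * v.2 * A 1 0 + t * v.2^2 * A 1 1) * hd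
  · linear_combination (t * v.1 ^ 2 * A 1 0 + t * v.1 * v.2 * A 1 1) * hd * (-1)

end sl

lemma dt_ac (A : SL2 ℂ) (x y : ℂ × ℂ) : dt (ac A x) (ac A y) = dt x y := by
  simp only [dt, ac]; linear_combination (x.1 * y.2 - x.2 * y.1) * sl_det A

lemma ac_Pg' (v y : ℂ × ℂ) (t : ℂ) : ac (Pg v t) y = y + (t * dt v y) • v := ac_Pg v y t

lemma dt_neg_left (x y : ℂ × ℂ) : dt (-x) y = - dt x y := by simp only [dt, Prod.fst_neg, Prod.snd_neg]; ring
lemma dt_neg_right (x y : ℂ × ℂ) : dt x (-y) = - dt x y := by simp only [dt, Prod.fst_neg, Prod.snd_neg]; ring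

lemma Pg_eq {x y : ℂ × ℂ} (h : Pg x 1 = Pg y 1) : x = y ∨ x = -y := by
  have h00 : Pg x 1 0 0 = Pg y 1 0 0 := by rw [h]
  have h01 : Pg x 1 0 1 = Pg y 1 0 1 := by rw [h]
  have h10 : Pg x 1 1 0 = Pg y 1 1 0 := by rw [h]
  simp only [Pg00, Pg01, Pg10] at h00 h01 h10
  have a1 : x.1 * x.2 = y.1 * y.2 := by linear_combination -h00
  have a2 : x.1 ^ 2 = y.1 ^ 2 := by linear_combination h01
  have a3 : x.2 ^ 2 = y.2 ^ 2 := by linear_combination -h10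
  rcases sq_eq_sq_iff_eq_or_eq_neg.1 a2 with b | b <;> rcases sq_eq_sq_iff_eq_or_eq_neg.1 a3 with c | c
  · left; exact Prod.ext b c
  · by_cases h : y.1 = 0
    · right; exact Prod.ext (by simp [b, h]) c
    · left; refine Prod.ext b ?_
      rw [b] at a1; exact mul_left_cancel₀ h a1
  · by_cases h : y.1 = 0
    · left; exact Prod.ext (by simp [b, h]) c
    · right; refine Prod.ext b ?_
      rw [b] at a1; 
      have : y.1 * (x.2 + y.2) = 0 := by linear_combination -a1
      rcases mul_eq_zero.1 this with h' | h'
      · exact absurd h' h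
      · simp only [Prod.snd_neg]; linear_combination h'
  · right; exact Prod.ext b c

lemma Pg_ne_neg (x y : ℂ × ℂ) : Pg x 1 ≠ - Pg y 1 := by
  intro h
  have h00 : Pg x 1 0 0 = (-Pg y 1) 0 0 := by rw [h]
  have h11 : Pg x 1 1 1 = (-Pg y 1) 1 1 := by rw [h]
  rw [sl_neg] at h00 h11
  simp only [Pg00, Pg11] at h00 h11
  have : (4 : ℂ) = 0 := by linear_combination h00 + h11
  norm_num at this

lemma dt_eq_zero_smul {x y : ℂ × ℂ} (hx : x ≠ 0) (h : dt x y = 0) : ∃ c : ℂ, y = c • x := by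
  simp only [dt] at h
  by_cases h1 : x.1 = 0
  · have h2 : x.2 ≠ 0 := fun h2 => hx (Prod.ext h1 h2)
    refine ⟨y.2 / x.2, Prod.ext ?_ ?_⟩
    · rw [h1] at h; simp only [Prod.smul_fst, smul_eq_mul, h1]
      have : x.2 * y.1 = 0 := by linear_combination -h
      rcases mul_eq_zero.1 this with h' | h'
      · exact absurd h' h2
      · simp [h']
    · simp only [Prod.smul_snd, smul_eq_mul]; field_simp
  · refine ⟨y.1 / x.1, Prod.ext ?_ ?_⟩
    · simp only [Prod.smul_fst, smul_eq_mul]; field_simp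
    · simp only [Prod.smul_snd, smul_eq_mul]; field_simp; linear_combination h

/-- an element fixing a nonzero vector is a transvection -/
lemma fix_Pg {A : SL2 ℂ} {x y : ℂ × ℂ} (hxy : dt x y = 1) (h : ac A x = x) :
    ∃ β, A = Pg x β := by
  have hy : dt x (ac A y - y) = 0 := by
    have := dt_ac A x y
    rw [h] at this
    rw [sub_eq_add_neg, dt_add_right, dt_neg_right, this]; ring
  have hx : x ≠ 0 := by rintro rfl; simp [dt] at hxy
  obtain ⟨β, hβ⟩ := dt_eq_zero_smul hx hy
  have hy2 : ac A y = ac (Pg x β) y := by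
    rw [ac_Pg', hxy, mul_one, ← hβ]; abel
  have hx2 : ac A x = ac (Pg x β) x := by
    rw [h, ac_Pg', dt_self, mul_zero, zero_smul, add_zero]
  refine ⟨β, ?_⟩
  have key : ∀ z, ac A z = ac (Pg x β) z := by
    intro z
    have hz : z = (dt z y) • x + (dt x z) • y := by
      simp only [dt] at hxy ⊢
      ext
      · simp only [Prod.fst_add, Prod.smul_fst, smul_eq_mul]; linear_combination (-z.1) * hxy
      · simp only [Prod.snd_add, Prod.smul_snd, smul_eq_mul]; linear_combination (-z.2) * hxy
    rw [hz, ac_add, ac_smul, ac_smul, ac_add, ac_smul, ac_smul, hx2, hy2]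
  have k1 := key (1, 0)
  have k2 := key (0, 1)
  simp only [ac, mul_one, mul_zero, add_zero, zero_add, Prod.mk.injEq] at k1 k2
  exact sl_ext k1.1 k2.1 k1.2 k2.2
end SM5a

section SM5b
open Matrix

structure QRing (O : Type) [CommRing O] (ι : O →+* ℂ) : Prop where
  inj : Function.Injective ι
  disc : ∀ x, x ≠ 0 → 1 ≤ ‖ι x‖
  fin : ∀ R : ℝ, {x | ‖ι x‖ ≤ R}.Finite
  conj : ∃ c : O →+* O, ∀ x, ι (c x) = starRingEnd ℂ (ι x)
  del : ∃ δ : O, ∃ D : ℝ, 1 ≤ D ∧ ι δ = D * Complex.I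
  quot : ∀ Δ : O, Δ ≠ 0 → Finite (O ⧸ Ideal.span {Δ})
  closed : ∀ z : ℂ, ∀ n : O, n ≠ 0 → (∃ a, ι a = z ^ 2) → (∃ b, ι b = ι n * z) → ∃ c, ι c = z
  sqn : ∀ (a : Ideal O) (s : O), a * a = Ideal.span {s} → ∃ n : ℕ, ‖ι s‖ = n

def dO {O : Type} [CommRing O] (p q : O × O) : O := p.1 * q.2 - p.2 * q.1

def ve {O : Type} [CommRing O] (ι : O →+* ℂ) (p : O × O) : ℂ × ℂ := (ι p.1, ι p.2)

def Mn {O : Type} [CommRing O] (ι : O →+* ℂ) (C : ℝ) (y : O × O) : Prop :=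
  ∃ u, dO y u ≠ 0 ∧ ‖ι (dO y u)‖ ≤ C

lemma exists_min_of_fin {α : Type*} (f : α → ℝ) (hf : ∀ R, {a | f a ≤ R}.Finite) (P : α → Prop)
    (h : ∃ a, P a) : ∃ a, P a ∧ ∀ b, P b → f a ≤ f b := by
  obtain ⟨a, ha⟩ := h
  have hfin : {b | f b ≤ f a ∧ P b}.Finite := (hf (f a)).subset fun b hb => hb.1
  obtain ⟨c, hc, hm⟩ := Set.exists_min_image _ f hfin ⟨a, le_rfl, ha⟩
  refine ⟨c, hc.2, fun b hb => ?_⟩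
  by_cases hba : f b ≤ f a
  · exact hm b ⟨hba, hb⟩
  · exact hc.1.trans (not_le.1 hba).le

section ring
variable {O : Type} [CommRing O] {ι : O →+* ℂ}

lemma dt_ve (p q : O × O) : dt (ve ι p) (ve ι q) = ι (dO p q) := by
  simp only [dt, ve, dO, map_sub, map_mul]

lemma dO_ac (A : SL2 O) (x y : O × O) : dO (ac A x) (ac A y) = dO x y := by
  simp only [dO, ac]; linear_combination (x.1 * y.2 - x.2 * y.1) * sl_det A

lemma Mn_ac {C : ℝ} {y : O × O} (A : SL2 O) (h : Mn ι C y) : Mn ι C (ac A y) := by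
  obtain ⟨u, h1, h2⟩ := h
  exact ⟨ac A u, by rwa [dO_ac], by rwa [dO_ac]⟩

lemma Mn_mono {C C' : ℝ} {y : O × O} (h : Mn ι C y) (hC : C ≤ C') : Mn ι C' y := by
  obtain ⟨u, h1, h2⟩ := h
  exact ⟨u, h1, h2.trans hC⟩

lemma Mn_ne {C : ℝ} {y : O × O} (h : Mn ι C y) : y ≠ 0 := by
  rintro rfl; obtain ⟨u, h1, h2⟩ := h; simp [dO] at h1

variable (H : QRing O ι)
include H

lemma QRing.ne {x : O} : ι x ≠ 0 ↔ x ≠ 0 := by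
  rw [not_iff_not]; exact map_eq_zero_iff ι H.inj

lemma QRing.dom : IsDomain O := H.inj.isDomain ι

lemma QRing.vec_inj : Function.Injective (ve ι) := by
  intro a b h
  simp only [ve, Prod.mk.injEq] at h
  exact Prod.ext (H.inj h.1) (H.inj h.2)

lemma QRing.vec_ne {p : O × O} (h : p ≠ 0) : ve ι p ≠ 0 := by
  intro h'; apply h; apply H.vec_inj; rw [h']; simp [ve]; rfl

lemma QRing.ctbl : Countable O := by
  have : (Set.univ : Set O) = ⋃ n : ℕ, {x | ‖ι x‖ ≤ n} := by
    ext x; simp only [Set.mem_univ, Set.mem_iUnion, Set.mem_setOf_eq, true_iff]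
    exact exists_nat_ge _
  rw [← Set.countable_univ_iff, this]
  exact Set.countable_iUnion fun n => (H.fin n).countable

lemma QRing.vfin (R : ℝ) : {p : O × O | ‖ve ι p‖ ≤ R}.Finite := by
  refine ((H.fin R).prod (H.fin R)).subset ?_
  intro p hp
  simp only [Set.mem_setOf_eq, ve, Prod.norm_def, max_le_iff] at hp
  exact hp

lemma QRing.cover : ∃ δ : O, ∃ ρ : ℝ, 1 ≤ ρ ∧ (∀ z : ℂ, ∃ m n : ℤ, ‖z - ι (m + n * δ)‖ ≤ ρ) ∧
    (∀ m n : ℤ, ι (m + n * δ) = 0 → m = 0 ∧ n = 0) ∧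
    (∀ m n : ℤ, |(m:ℝ)| ≤ ‖ι (m + n * δ)‖ ∧ |(n:ℝ)| ≤ ‖ι (m + n * δ)‖) := by
  obtain ⟨δ, D, hD, hδ⟩ := H.del
  have hre : ∀ m n : ℤ, (ι (m + n * δ)).re = m := by intro m n; simp [hδ]
  have him : ∀ m n : ℤ, (ι (m + n * δ)).im = n * D := by intro m n; simp [hδ]
  have hab : ∀ m n : ℤ, |(m:ℝ)| ≤ ‖ι (m + n * δ)‖ ∧ |(n:ℝ)| ≤ ‖ι (m + n * δ)‖ := by
    intro m n
    constructor
    · have := Complex.abs_re_le_norm (ι (m + n * δ)); rwa [hre] at this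
    · have := Complex.abs_im_le_norm (ι (m + n * δ)); rw [him, abs_mul] at this
      refine le_trans ?_ this
      rw [abs_of_pos (by linarith : 0 < D)]
      nlinarith [abs_nonneg (n:ℝ)]
  refine ⟨δ, 1 + D, by linarith, fun z => ?_, fun m n h => ?_, hab⟩
  · refine ⟨round z.re, round (z.im / D), ?_⟩
    refine (Complex.norm_le_abs_re_add_abs_im _).trans ?_
    rw [Complex.sub_re, Complex.sub_im, hre, him]
    have h1 := abs_sub_round z.re
    have h2 := abs_sub_round (z.im / D)
    have h3 : z.im - round (z.im / D) * D = D * (z.im / D - round (z.im / D)) := by field_simp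
    rw [h3, abs_mul, abs_of_pos (by linarith : 0 < D)]
    nlinarith
  · have := hab m n
    rw [h, norm_zero] at this
    exact ⟨by exact_mod_cast abs_nonpos_iff.1 this.1, by exact_mod_cast abs_nonpos_iff.1 this.2⟩

lemma QRing.dirichlet (ε : ℝ) (hε : 0 < ε) : ∃ M : ℕ, 1 ≤ M ∧ ∀ z : ℂ, ∃ k : ℕ, 1 ≤ k ∧ k ≤ M ∧
    ∃ t : O, ‖k * z - ι t‖ ≤ ε := by
  obtain ⟨δ, D, hD, hδ⟩ := H.del
  obtain ⟨N, hN⟩ := exists_nat_gt (2 / ε)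
  have hN0 : 0 < N := by
    have : (0:ℝ) < N := lt_trans (by positivity) hN
    exact_mod_cast this
  obtain ⟨N', hN'⟩ := exists_nat_gt (2 * D * N / ε)
  have hN0' : 0 < N' := by
    have : (0:ℝ) < N' := lt_of_le_of_lt (by positivity) hN'
    exact_mod_cast this
  refine ⟨N * N', Nat.mul_pos hN0 hN0', fun z => ?_⟩
  obtain ⟨k, hk0, hk, hk'⟩ := Real.exists_nat_abs_mul_sub_round_le (z.im / D) hN0'
  obtain ⟨l, hl0, hl, hl'⟩ := Real.exists_nat_abs_mul_sub_round_le (k * z.re) hN0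
  refine ⟨l * k, Nat.mul_pos hl0 hk0, Nat.mul_le_mul hl hk,
    ((round (l * (k * z.re)) : ℤ) : O) + ((l * round (k * (z.im / D)) : ℤ) : O) * δ, ?_⟩
  refine (Complex.norm_le_abs_re_add_abs_im _).trans ?_
  have e1 : ((l * k : ℕ) * z - ι (((round (l * (k * z.re)) : ℤ) : O) +
      ((l * round (k * (z.im / D)) : ℤ) : O) * δ)).re = l * (k * z.re) - round (l * (k * z.re)) := by
    simp [hδ]; ring
  have e2 : ((l * k : ℕ) * z - ι (((round (l * (k * z.re)) : ℤ) : O) +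
      ((l * round (k * (z.im / D)) : ℤ) : O) * δ)).im =
      l * D * (k * (z.im / D) - round (k * (z.im / D))) := by
    simp [hδ]; field_simp
  rw [e1, e2, abs_mul]
  have hD0 : 0 < D := by linarith
  have hl0' : (0:ℝ) < l := by exact_mod_cast hl0
  have hlN : (l:ℝ) ≤ N := by exact_mod_cast hl
  have f1 : (1:ℝ) / (N + 1) ≤ ε / 2 := by
    rw [div_le_div_iff₀ (by positivity) (by positivity)]
    rw [div_lt_iff₀ hε] at hN; linarith
  have f2 : (N * D) * (1 / ((N':ℝ) + 1)) ≤ ε / 2 := by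
    rw [mul_one_div, div_le_div_iff₀ (by positivity) (by positivity)]
    rw [div_lt_iff₀ hε] at hN'; linarith
  have f3 : |(l:ℝ) * D| * |k * (z.im / D) - round (k * (z.im / D))| ≤ (N * D) * (1 / ((N':ℝ) + 1)) := by
    rw [abs_of_pos (by positivity)]
    gcongr
  linarith

lemma QRing.exists_min : ∃ C : ℝ, 1 ≤ C ∧ ∀ y : O × O, y ≠ 0 → ∃ v, ∃ μ : ℂ, ve ι v = μ • ve ι y ∧
    μ ≠ 0 ∧ ‖μ‖ ≤ 1 ∧ Mn ι C v := by
  have := H.dom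
  obtain ⟨M, hM1, hM⟩ := H.dirichlet (1/2) (by norm_num)
  refine ⟨(M.factorial : ℕ), by exact_mod_cast M.factorial_pos, fun y hy => ?_⟩
  obtain ⟨v, ⟨hv0, hvy⟩, hvm⟩ := exists_min_of_fin (fun p : O × O => ‖ve ι p‖) H.vfin
    (fun p => p ≠ 0 ∧ dO y p = 0) ⟨y, hy, by simp [dO, mul_comm]⟩
  obtain ⟨μ, hμ⟩ := dt_eq_zero_smul (H.vec_ne hy) (y := ve ι v) (by rw [dt_ve, hvy, map_zero])
  have hμ0 : μ ≠ 0 := by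
    rintro rfl; rw [zero_smul] at hμ; exact H.vec_ne hv0 hμ
  have hvy' := hvm y ⟨hy, by simp [dO, mul_comm]⟩
  have hy0 : 0 < ‖ve ι y‖ := norm_pos_iff.2 (H.vec_ne hy)
  have hv0' : 0 < ‖ve ι v‖ := norm_pos_iff.2 (H.vec_ne hv0)
  refine ⟨v, μ, hμ, hμ0, ?_, ?_⟩
  · rw [hμ, norm_smul] at hvy'
    exact (mul_le_iff_le_one_left hy0).1 hvy'
  · have hex : ∃ u, dO v u ≠ 0 := by
      by_contra hcon
      push Not at hcon
      have h1 := hcon (0, 1); have h2 := hcon (1, 0)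
      simp [dO] at h1 h2
      exact hv0 (Prod.ext h1 h2)
    have hex' : ∃ α : O, α ≠ 0 ∧ ∃ u, dO v u = α := by
      obtain ⟨u, hu⟩ := hex; exact ⟨_, hu, u, rfl⟩
    obtain ⟨α, ⟨hα0, u, hu⟩, hαm⟩ := exists_min_of_fin (fun x : O => ‖ι x‖) H.fin _ hex'
    refine ⟨u, by rwa [hu], ?_⟩
    rw [hu]
    have hαι : ι α ≠ 0 := H.ne.2 hα0
    have hα1 : 0 < ‖ι α‖ := norm_pos_iff.2 hαι
    have hdiv : ∀ u', α ∣ (M.factorial : O) * dO v u' := by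
      intro u'
      obtain ⟨k, hk1, hk2, t, ht⟩ := hM (ι (dO v u') / ι α)
      have hz : (k : O) * dO v u' - t * α = 0 := by
        by_contra hne
        have h1 := hαm _ ⟨hne, (k * u'.1 - t * u.1, k * u'.2 - t * u.2), by
          rw [← hu]; simp only [dO]; ring⟩
        have h2 : ι ((k : O) * dO v u' - t * α) = ι α * (k * (ι (dO v u') / ι α) - ι t) := by
          simp only [map_sub, map_mul, map_natCast]; field_simp
        rw [h2, norm_mul] at h1
        nlinarith
      have h3 : α ∣ (k : O) * dO v u' := ⟨t, by linear_combination hz⟩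
      obtain ⟨c, hc⟩ := Nat.dvd_factorial hk1 hk2
      rw [hc]; push_cast
      rw [mul_right_comm]
      exact Dvd.dvd.mul_right h3 _
    obtain ⟨c1, hc1⟩ := hdiv (0, 1)
    obtain ⟨c2, hc2⟩ := hdiv (-1, 0)
    simp only [dO, mul_one, mul_zero, sub_zero, mul_neg, zero_sub, neg_neg] at hc1 hc2
    have hL0 : (M.factorial : ℂ) ≠ 0 := by exact_mod_cast M.factorial_ne_zero
    have hvv : ve ι (c1, c2) = ((M.factorial : ℂ) / ι α) • ve ι v := by
      have e1 := congrArg ι hc1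
      have e2 := congrArg ι hc2
      simp only [map_mul, map_natCast] at e1 e2
      simp only [ve]
      refine Prod.ext ?_ ?_
      · simp only [Prod.smul_mk, smul_eq_mul]; field_simp; linear_combination -e1
      · simp only [Prod.smul_mk, smul_eq_mul]; field_simp; linear_combination -e2
    have hc0 : (c1, c2) ≠ (0 : O × O) := by
      intro h0
      have : ve ι (c1, c2) = 0 := by rw [h0]; simp [ve]
      rw [this] at hvv
      have := smul_eq_zero.1 hvv.symm
      rcases this with h | h
      · exact (div_ne_zero hL0 hαι) h
      · exact H.vec_ne hv0 h
    have hpar : dO y (c1, c2) = 0 := by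
      apply H.inj
      rw [← dt_ve, hvv, dt_smul_right, dt_ve, hvy]; simp
    have := hvm _ ⟨hc0, hpar⟩
    rw [hvv, norm_smul, norm_div] at this
    have h5 := (le_mul_iff_one_le_left hv0').1 this
    rw [le_div_iff₀ hα1, one_mul] at h5
    simpa using h5

lemma QRing.fin_orb (R : ℝ) : ∃ T : Set ((O × O) × (O × O)), T.Finite ∧
    (∀ t ∈ T, dO t.1 t.2 ≠ 0 ∧ ‖ι (dO t.1 t.2)‖ ≤ R) ∧
    ∀ a b : O × O, dO a b ≠ 0 → ‖ι (dO a b)‖ ≤ R → ∃ t ∈ T, ∃ γ : SL2 O, ac γ t.1 = a ∧ ac γ t.2 = b := by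
  have := H.dom
  have hΔ : ∀ Δ : O, Δ ≠ 0 → ∃ T : Set ((O × O) × (O × O)), T.Finite ∧ (∀ t ∈ T, dO t.1 t.2 = Δ) ∧
      ∀ a b : O × O, dO a b = Δ → ∃ t ∈ T, ∃ γ : SL2 O, ac γ t.1 = a ∧ ac γ t.2 = b := by
    intro Δ hΔ
    have := H.quot Δ hΔ
    let q := Ideal.Quotient.mk (Ideal.span {Δ})
    let S := {t : (O × O) × (O × O) // dO t.1 t.2 = Δ}
    let F : S → ((O ⧸ Ideal.span {Δ}) × (O ⧸ Ideal.span {Δ})) × ((O ⧸ Ideal.span {Δ}) × (O ⧸ Ideal.span {Δ})) :=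
      fun t => ((q t.1.1.1, q t.1.1.2), (q t.1.2.1, q t.1.2.2))
    let G : Set.range F → S := fun x => x.2.choose
    have hG : ∀ x, F (G x) = x.1 := fun x => x.2.choose_spec
    refine ⟨Set.range fun x => (G x).1, Set.finite_range _, ?_, ?_⟩
    · rintro t ⟨x, rfl⟩; exact (G x).2
    · intro a b hab
      let s : S := ⟨(a, b), hab⟩
      let r := G ⟨F s, s, rfl⟩
      have hr : F r = F s := hG _
      refine ⟨r.1, ⟨_, rfl⟩, ?_⟩
      simp only [F, s, Prod.mk.injEq] at hr
      obtain ⟨⟨h1, h2⟩, h3, h4⟩ := hr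
      have hq : ∀ x y : O, q x = q y → ∃ e, y = x + Δ * e := by
        intro x y h
        have := (Ideal.Quotient.eq.1 h.symm)
        rw [Ideal.mem_span_singleton] at this
        obtain ⟨e, he⟩ := this
        exact ⟨e, by linear_combination he⟩
      obtain ⟨e1, g1⟩ := hq _ _ h1
      obtain ⟨e2, g2⟩ := hq _ _ h2
      obtain ⟨f1, g3⟩ := hq _ _ h3
      obtain ⟨f2, g4⟩ := hq _ _ h4
      clear h1 h2 h3 h4
      have hrd := r.2
      obtain ⟨⟨⟨x1, x2⟩, ⟨y1, y2⟩⟩, hxy⟩ := r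
      obtain ⟨a1, a2⟩ := a
      obtain ⟨b1, b2⟩ := b
      simp only [dO] at hrd hab ⊢
      change a1 = x1 + _ at g1; change a2 = x2 + _ at g2; change b1 = y1 + _ at g3; change b2 = y2 + _ at g4
      have hdet : (1 + e1 * y2 - f1 * x2) * (1 - e2 * y1 + f2 * x1) -
          (- e1 * y1 + f1 * x1) * (e2 * y2 - f2 * x2) = 1 := by
        apply mul_left_cancel₀ hΔ
        rw [g1, g2, g3, g4] at hab
        linear_combination hab + (e1 * f2 - e2 * f1) * Δ * hrd - hrd
      refine ⟨⟨!![1 + e1 * y2 - f1 * x2, - e1 * y1 + f1 * x1; e2 * y2 - f2 * x2, 1 - e2 * y1 + f2 * x1], by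
        rw [det_fin_two_of]; exact hdet⟩, ?_, ?_⟩
      · refine Prod.ext ?_ ?_
        · change (1 + e1 * y2 - f1 * x2) * x1 + (- e1 * y1 + f1 * x1) * x2 = a1
          rw [g1]; linear_combination e1 * hrd
        · change (e2 * y2 - f2 * x2) * x1 + (1 - e2 * y1 + f2 * x1) * x2 = a2
          rw [g2]; linear_combination e2 * hrd
      · refine Prod.ext ?_ ?_
        · change (1 + e1 * y2 - f1 * x2) * y1 + (- e1 * y1 + f1 * x1) * y2 = b1
          rw [g3]; linear_combination f1 * hrd
        · change (e2 * y2 - f2 * x2) * y1 + (1 - e2 * y1 + f2 * x1) * y2 = b2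
          rw [g4]; linear_combination f2 * hrd
  choose! T hT1 hT2 hT3 using hΔ
  have hfin : {x : O | x ≠ 0 ∧ ‖ι x‖ ≤ R}.Finite := (H.fin R).subset fun x hx => hx.2
  refine ⟨⋃ Δ ∈ {x : O | x ≠ 0 ∧ ‖ι x‖ ≤ R}, T Δ, hfin.biUnion fun Δ hΔ => hT1 Δ hΔ.1, ?_, ?_⟩
  · intro t ht
    simp only [Set.mem_iUnion] at ht
    obtain ⟨Δ, hΔ, ht⟩ := ht
    rw [hT2 Δ hΔ.1 t ht]; exact hΔ
  · intro a b h0 hR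
    obtain ⟨t, ht, γ, hγ⟩ := hT3 _ h0 a b rfl
    refine ⟨t, ?_, γ, hγ⟩
    simp only [Set.mem_iUnion]
    exact ⟨_, ⟨h0, hR⟩, ht⟩

/-- uniform bounds from finiteness of orbits -/
lemma QRing.unif (Q : O × O → O × O → ℝ → Prop) (hm : ∀ a b K K', K ≤ K' → Q a b K → Q a b K')
    (hi : ∀ (γ : SL2 O) a b K, Q a b K → Q (ac γ a) (ac γ b) K)
    (hp : ∀ a b, dO a b ≠ 0 → ∃ K, Q a b K) (R : ℝ) :
    ∃ K : ℝ, 1 ≤ K ∧ ∀ a b, dO a b ≠ 0 → ‖ι (dO a b)‖ ≤ R → Q a b K := by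
  obtain ⟨T, hT, hT1, hT2⟩ := H.fin_orb R
  choose! K hK using hp
  obtain ⟨B, hB⟩ := (hT.image fun t => K t.1 t.2).bddAbove
  refine ⟨max 1 B, le_max_left _ _, fun a b h0 hR => ?_⟩
  obtain ⟨t, ht, γ, rfl, rfl⟩ := hT2 a b h0 hR
  apply hi
  exact hm _ _ _ _ ((hB ⟨t, ht, rfl⟩).trans (le_max_right _ _)) (hK _ _ (hT1 t ht).1)

end ring
end SM5b

def good {O : Type} [CommRing O] (ι : O →+* ℂ) (C : ℝ) (x : ℂ × ℂ) : Prop :=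
  ∃ s : ℂ, ∃ p u : O × O, ‖s‖ ≤ C ∧ 1 ≤ C * ‖s‖ ∧ s • x = ve ι p ∧ dO p u ≠ 0 ∧ ‖ι (dO p u)‖ ≤ C

section ring
variable {O : Type} [CommRing O] {ι : O →+* ℂ}

lemma good_mono {C C' : ℝ} {x : ℂ × ℂ} (hC : C ≤ C') (h : good ι C x) : good ι C' x := by
  obtain ⟨s, p, u, h1, h2, h3, h4, h5⟩ := h
  exact ⟨s, p, u, h1.trans hC, h2.trans (by gcongr), h3, h4, h5.trans hC⟩

lemma good_ve {C : ℝ} (hC : 1 ≤ C) {p : O × O} (h : Mn ι C p) : good ι C (ve ι p) := by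
  obtain ⟨u, h1, h2⟩ := h
  exact ⟨1, p, u, by simpa using hC, by simpa using hC, one_smul _ _, h1, h2⟩

lemma good_sne {C : ℝ} {s : ℂ} (h : 1 ≤ C * ‖s‖) : s ≠ 0 := by
  rintro rfl; simp at h; linarith

end ring

section ring2
variable {O : Type} [CommRing O] {ι : O →+* ℂ} (H : QRing O ι)
include H

lemma QRing.good_ne {C : ℝ} {x : ℂ × ℂ} (h : good ι C x) : x ≠ 0 := by
  rintro rfl
  obtain ⟨s, p, u, h1, h2, h3, h4, h5⟩ := h
  apply h4
  rw [smul_zero] at h3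
  apply H.inj; rw [← dt_ve, ← h3]; simp [dt]

lemma QRing.good_par {C : ℝ} (hC : 1 ≤ C) {x x' : ℂ × ℂ} (h : good ι C x) (h' : good ι C x')
    (hd : dt x x' = 0) : ∃ c : ℂ, x' = c • x ∧ c ≠ 0 ∧ ‖c‖ ≤ C ^ 3 := by
  obtain ⟨c, hc⟩ := dt_eq_zero_smul (H.good_ne h) hd
  have hc0 : c ≠ 0 := by rintro rfl; exact H.good_ne h' (by rw [hc, zero_smul])
  refine ⟨c, hc, hc0, ?_⟩
  obtain ⟨s, p, u, h1, h2, h3, h4, h5⟩ := h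
  obtain ⟨s', p', u', h1', h2', h3', h4', h5'⟩ := h'
  have hs := good_sne h2
  have hs' := good_sne h2'
  have e : s * ι (dO p' u') = s' * c * ι (dO p u') := by
    rw [← dt_ve, ← dt_ve, ← h3', ← h3, hc]; simp only [dt_smul_left]; ring
  have hne : dO p u' ≠ 0 := by
    intro h0; rw [h0, map_zero, mul_zero] at e
    exact (mul_ne_zero hs (H.ne.2 h4')) e
  have h6 := H.disc _ hne
  have e2 := congrArg norm e
  simp only [norm_mul] at e2
  have e3 : ‖s'‖ * ‖c‖ ≤ C * C := by
    calc ‖s'‖ * ‖c‖ ≤ ‖s'‖ * ‖c‖ * ‖ι (dO p u')‖ := le_mul_of_one_le_right (by positivity) h6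
      _ = ‖s‖ * ‖ι (dO p' u')‖ := e2.symm
      _ ≤ C * C := by gcongr
  calc ‖c‖ ≤ (C * ‖s'‖) * ‖c‖ := le_mul_of_one_le_left (norm_nonneg _) h2'
    _ = C * (‖s'‖ * ‖c‖) := by ring
    _ ≤ C * (C * C) := by gcongr
    _ = C ^ 3 := by ring

lemma QRing.side (C : ℝ) (hC : 1 ≤ C) : ∃ C' : ℝ, C ≤ C' ∧ ∀ (I : Type) (x : I → ℂ × ℂ),
    (∀ i j, dt (x i) (x j) ≠ 0 → 1 ≤ ‖dt (x i) (x j)‖) →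
    (∀ y : O × O, y ≠ 0 → ∃ i, ∃ μ : ℂ, x i = μ • ve ι y ∧ μ ≠ 0 ∧ ‖μ‖ ≤ C) →
    (∀ i, good ι C (x i)) → SideSys x C' := by
  obtain ⟨δ, ρ, hρ, hcov, -, -⟩ := H.cover
  obtain ⟨M, hM1, hM⟩ := H.dirichlet (1 / (2 * C ^ 2)) (by positivity)
  have hM1' : (1:ℝ) ≤ M := by exact_mod_cast hM1
  have hC0 : 0 ≤ C := by linarith
  have c1 : 1 ≤ C ^ 2 := one_le_pow₀ hC
  have c2 : C ^ 2 ≤ C ^ 3 := pow_le_pow_right₀ hC (by norm_num)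
  have c3 : C ≤ C ^ 3 := le_self_pow₀ hC (by norm_num)
  have k1 : C ^ 3 ≤ C ^ 3 * (1 + ρ + 2 * M) := le_mul_of_one_le_right (by positivity) (by linarith)
  have k2 : C ^ 2 * (2 * M) ≤ C ^ 3 * (1 + ρ + 2 * M) := by gcongr; linarith
  have k3 : C ^ 2 * ρ ≤ C ^ 3 * (1 + ρ + 2 * M) := by gcongr; linarith
  refine ⟨C ^ 3 * (1 + ρ + 2 * M), c3.trans k1, fun I x V1 hb hg => ?_⟩
  refine ⟨V1, ?_, ?_, ?_, fun i => H.good_ne (hg i)⟩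
  · intro i k hd y
    obtain ⟨c, hc, -, hc'⟩ := H.good_par hC (hg k) (hg i) (by rw [dt_swap, hd, neg_zero])
    rw [hc, dt_smul_left, norm_mul]
    exact mul_le_mul_of_nonneg_right (hc'.trans k1) (norm_nonneg _)
  · intro X Y hXY
    have hfin : ∀ R, {v : O × O | max ‖dt X (ve ι v)‖ ‖dt Y (ve ι v)‖ ≤ R}.Finite := by
      intro R
      refine (H.vfin (R * ‖X‖ + R * ‖Y‖)).subset ?_
      intro v hv
      rw [Set.mem_ofPred_eq, max_le_iff] at hv
      obtain ⟨h1, h2⟩ := hv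
      have hz : ve ι v = (- dt Y (ve ι v)) • X + (dt X (ve ι v)) • Y := by
        simp only [dt] at hXY ⊢
        ext
        · simp only [Prod.fst_add, Prod.smul_fst, smul_eq_mul]; linear_combination (-(ve ι v).1) * hXY
        · simp only [Prod.snd_add, Prod.smul_snd, smul_eq_mul]; linear_combination (-(ve ι v).2) * hXY
      change ‖ve ι v‖ ≤ _
      rw [hz]
      refine (norm_add_le _ _).trans ?_
      rw [norm_smul, norm_smul, norm_neg]
      gcongr
    obtain ⟨v, hv0, hvm⟩ := exists_min_of_fin _ hfin (fun v => v ≠ 0)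
      ⟨(1, 0), by
        intro h; have := congrArg Prod.fst h
        have := congrArg ι this; simp at this⟩
    set m := max ‖dt X (ve ι v)‖ ‖dt Y (ve ι v)‖ with hm
    have hm0 : 0 ≤ m := (norm_nonneg _).trans (le_max_left _ _)
    obtain ⟨i, μ, hμ, hμ0, hμC⟩ := hb v hv0
    have key : m ^ 2 ≤ 2 * M * C := by
      obtain ⟨s, p, u, h1, h2, h3, h4, h5⟩ := hg i
      have hpv : ve ι p = (s * μ) • ve ι v := by rw [← h3, hμ, smul_smul]
      have hsμ : ‖s * μ‖ ≤ C ^ 2 := by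
        rw [norm_mul, pow_two]; gcongr
      have hp0 : p ≠ 0 := by rintro rfl; simp [dO] at h4
      have hfp := hvm p hp0
      have main : ∀ A B : ℂ × ℂ, ‖dt A B‖ = 1 → ‖dt B (ve ι p)‖ ≤ ‖dt A (ve ι p)‖ → m ≤ ‖dt A (ve ι p)‖ →
          (∀ w : O × O, w ≠ 0 → m ≤ max ‖dt A (ve ι w)‖ ‖dt B (ve ι w)‖) →
          ‖dt A (ve ι p)‖ ≤ C ^ 2 * m → m ^ 2 ≤ 2 * M * C := by
        intro A B hAB hBA hmA hw hAC
        rcases hm0.eq_or_lt with h0 | hmp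
        · rw [← h0, zero_pow two_ne_zero]; positivity
        have hA0 : dt A (ve ι p) ≠ 0 := by
          intro h; rw [h, norm_zero] at hmA; linarith
        obtain ⟨k, hk1, hk2, t, ht⟩ := hM (dt A (ve ι u) / dt A (ve ι p))
        let u' : O × O := (k * u.1 - t * p.1, k * u.2 - t * p.2)
        have hu' : ∀ z, dt z (ve ι u') = k * dt z (ve ι u) - ι t * dt z (ve ι p) := by
          intro z; simp only [dt, ve, u', map_sub, map_mul, map_natCast]; ring
        have hpu : dt (ve ι p) (ve ι u') = k * ι (dO p u) := by
          rw [hu', dt_self, dt_ve]; ring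
        have hk0 : (k : ℂ) ≠ 0 := by exact_mod_cast (by omega : k ≠ 0)
        have hu0 : u' ≠ 0 := by
          intro h; rw [h] at hpu
          have : dt (ve ι p) (ve ι 0) = 0 := by simp [dt, ve]
          rw [this] at hpu
          exact (mul_ne_zero hk0 (H.ne.2 h4)) hpu.symm
        have hAu : ‖dt A (ve ι u')‖ ≤ m / 2 := by
          have : dt A (ve ι u') = (k * (dt A (ve ι u) / dt A (ve ι p)) - ι t) * dt A (ve ι p) := by
            rw [hu']; field_simp
          rw [this, norm_mul]
          calc _ ≤ 1 / (2 * C ^ 2) * (C ^ 2 * m) := by gcongr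
            _ = m / 2 := by field_simp
        have hBu : m ≤ ‖dt B (ve ι u')‖ := by
          rcases le_max_iff.1 (hw u' hu0) with h | h
          · linarith
          · exact h
        have hpl : dt A B * dt (ve ι p) (ve ι u') =
            dt A (ve ι p) * dt B (ve ι u') - dt A (ve ι u') * dt B (ve ι p) := by
          simp only [dt]; ring
        have n1 : ‖dt A (ve ι p)‖ * ‖dt B (ve ι u')‖ - ‖dt A (ve ι u')‖ * ‖dt B (ve ι p)‖ ≤ k * C := by
          have := norm_sub_norm_le (dt A (ve ι p) * dt B (ve ι u')) (dt A (ve ι u') * dt B (ve ι p))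
          rw [← hpl, norm_mul, norm_mul, norm_mul, hAB, one_mul, hpu, norm_mul] at this
          refine this.trans ?_
          rw [Complex.norm_natCast]; gcongr
        have n2 : ‖dt A (ve ι u')‖ * ‖dt B (ve ι p)‖ ≤ m / 2 * ‖dt A (ve ι p)‖ := by gcongr
        have n3 : ‖dt A (ve ι p)‖ * m ≤ ‖dt A (ve ι p)‖ * ‖dt B (ve ι u')‖ := by gcongr
        have n4 : m * m ≤ ‖dt A (ve ι p)‖ * m := by gcongr
        have n5 : (k:ℝ) * C ≤ M * C := by gcongr
        nlinarith
      have hfp2 : max ‖dt X (ve ι p)‖ ‖dt Y (ve ι p)‖ ≤ C ^ 2 * m := by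
        rw [hpv, dt_smul_right, dt_smul_right, norm_mul (s * μ), norm_mul (s * μ)]
        exact max_le (mul_le_mul hsμ (le_max_left _ _) (norm_nonneg _) (by positivity))
          (mul_le_mul hsμ (le_max_right _ _) (norm_nonneg _) (by positivity))
      rcases le_total ‖dt Y (ve ι p)‖ ‖dt X (ve ι p)‖ with h | h
      · rw [max_eq_left h] at hfp hfp2
        exact main X Y (by rw [hXY, norm_one]) h hfp hvm hfp2
      · rw [max_eq_right h] at hfp hfp2
        refine main Y X (by rw [norm_dt_swap, hXY, norm_one]) h hfp (fun w hw => ?_) hfp2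
        rw [max_comm]; exact hvm w hw
    have hK : 1 ≤ 2 * M * C := by nlinarith
    have hm2 : m ≤ 2 * M * C := by
      by_contra hcon
      nlinarith [not_le.1 hcon]
    refine ⟨i, ?_, ?_⟩
    · rw [hμ, dt_smul_right, norm_mul]
      calc _ ≤ C * (2 * M * C) := by gcongr; exact (le_max_left _ _).trans hm2
        _ = C ^ 2 * (2 * M) := by ring
        _ ≤ _ := k2
    · rw [hμ, dt_smul_right, norm_mul]
      calc _ ≤ C * (2 * M * C) := by gcongr; exact (le_max_right _ _).trans hm2
        _ = C ^ 2 * (2 * M) := by ring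
        _ ≤ _ := k2
  · intro k y hky
    obtain ⟨s, p, u, h1, h2, h3, h4, h5⟩ := hg k
    have hs := good_sne h2
    have hs' : 0 < ‖s‖ := norm_pos_iff.2 hs
    obtain ⟨a, b, hab⟩ := hcov (- dt y (ve ι u) / s)
    set t : O := a + b * δ
    let u' : O × O := (u.1 - t * p.1, u.2 - t * p.2)
    have hu' : ∀ z, dt z (ve ι u') = dt z (ve ι u) - ι t * dt z (ve ι p) := by
      intro z; simp only [dt, ve, u', map_sub, map_mul]; ring
    have hpu : dt (ve ι p) (ve ι u') = ι (dO p u) := by rw [hu', dt_self, dt_ve]; ring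
    have hu0 : u' ≠ 0 := by
      intro h; rw [h] at hpu
      have : dt (ve ι p) (ve ι 0) = 0 := by simp [dt, ve]
      rw [this] at hpu
      exact (H.ne.2 h4) hpu.symm
    obtain ⟨l, μ, hμ, hμ0, hμC⟩ := hb u' hu0
    have e1 : dt (x k) (x l) = μ * ι (dO p u) / s := by
      rw [eq_div_iff hs, mul_comm _ s, ← dt_smul_left, h3, hμ, dt_smul_right, hpu]
    have e2 : dt y (x l) = μ * (s * (-(- dt y (ve ι u) / s - ι t))) := by
      rw [hμ, dt_smul_right, hu', ← h3, dt_smul_right, dt_swap y (x k), hky]; field_simp; ring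
    refine ⟨l, ?_, ?_, ?_⟩
    · rw [e1]; exact div_ne_zero (mul_ne_zero hμ0 (H.ne.2 h4)) hs
    · rw [e1, norm_div, norm_mul, div_le_iff₀ hs']
      calc ‖μ‖ * ‖ι (dO p u)‖ ≤ C * C := by gcongr
        _ ≤ C * C * (C * ‖s‖) := le_mul_of_one_le_right (by positivity) h2
        _ = C ^ 3 * ‖s‖ := by ring
        _ ≤ _ := by gcongr
    · rw [e2, norm_mul, norm_mul, norm_neg]
      calc _ ≤ C * (C * ρ) := by gcongr
        _ = C ^ 2 * ρ := by ring
        _ ≤ _ := k3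

end ring2

section ring
variable {O : Type} [CommRing O] {ι : O →+* ℂ}

def mp (ι : O →+* ℂ) : SL2 O →* SL2 ℂ := Matrix.SpecialLinearGroup.map ι
def pm : SL2 O →* PSL2 O := QuotientGroup.mk' _

lemma mp_ap (A : SL2 O) (i j : Fin 2) : mp ι A i j = ι (A i j) := rfl
lemma ve_ac (A : SL2 O) (p : O × O) : ve ι (ac A p) = ac (mp ι A) (ve ι p) := by
  simp only [ve, ac, mp_ap, map_add, map_mul]
lemma mp_Pg (v : O × O) (t : O) : mp ι (Pg v t) = Pg (ve ι v) (ι t) := by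
  apply sl_ext <;> simp only [mp_ap, Pg00, Pg01, Pg10, Pg11, ve, map_sub, map_add, map_mul, map_one,
    map_pow, map_neg]
lemma mp_neg (A : SL2 O) : mp ι (-A) = - mp ι A := by
  apply sl_ext <;> simp only [mp_ap, sl_neg, map_neg]
lemma pm_surj (g : PSL2 O) : ∃ A, pm A = g := QuotientGroup.mk'_surjective _ g

def Par (ι : O →+* ℂ) (g : PSL2 O) (x : ℂ × ℂ) : Prop :=
  x ≠ 0 ∧ ∃ X : SL2 O, pm X = g ∧ mp ι X = Pg x 1

lemma par_conj {g : PSL2 O} {x : ℂ × ℂ} (h : Par ι g x) (A : SL2 O) :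
    Par ι (pm A * g * (pm A)⁻¹) (ac (mp ι A) x) := by
  obtain ⟨h0, X, rfl, hX⟩ := h
  exact ⟨ac_ne_zero h0, A * X * A⁻¹, by simp, by rw [map_mul, map_mul, map_inv, hX, Pg_conj]⟩

lemma Pg_neg (x : ℂ × ℂ) (t : ℂ) : Pg (-x) t = Pg x t := by
  apply sl_ext <;> simp [Pg00, Pg01, Pg10, Pg11]

lemma Pg_smul (x : ℂ × ℂ) (c t : ℂ) : Pg (c • x) t = Pg x (c ^ 2 * t) := by
  apply sl_ext <;> simp [Pg00, Pg01, Pg10, Pg11] <;> ring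

lemma par_neg {g : PSL2 O} {x : ℂ × ℂ} (h : Par ι g x) : Par ι g (-x) := by
  obtain ⟨h0, X, rfl, hX⟩ := h
  exact ⟨neg_ne_zero.2 h0, X, rfl, by rw [Pg_neg, hX]⟩

lemma good_ac {C : ℝ} {x : ℂ × ℂ} (h : good ι C x) (A : SL2 O) : good ι C (ac (mp ι A) x) := by
  obtain ⟨s, p, u, h1, h2, h3, h4, h5⟩ := h
  refine ⟨s, ac A p, ac A u, h1, h2, ?_, by rwa [dO_ac], by rwa [dO_ac]⟩
  rw [← ac_smul, h3, ve_ac]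

lemma good_neg {C : ℝ} {x : ℂ × ℂ} (h : good ι C x) : good ι C (-x) := by
  obtain ⟨s, p, u, h1, h2, h3, h4, h5⟩ := h
  exact ⟨-s, p, u, by rwa [norm_neg], by rwa [norm_neg], by rw [neg_smul_neg, h3], h4, h5⟩

lemma par_sq {g : PSL2 O} {x : ℂ × ℂ} (h : Par ι g x) :
    (∃ a, ι a = x.1 * x.1) ∧ (∃ a, ι a = x.1 * x.2) ∧ (∃ a, ι a = x.2 * x.2) := by
  obtain ⟨h0, X, rfl, hX⟩ := h
  have e01 : ι (X 0 1) = Pg x 1 0 1 := by rw [← hX]; rfl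
  have e10 : ι (X 1 0) = Pg x 1 1 0 := by rw [← hX]; rfl
  have e11 : ι (X 1 1) = Pg x 1 1 1 := by rw [← hX]; rfl
  simp only [Pg01, Pg10, Pg11] at e01 e10 e11
  refine ⟨⟨X 0 1, by rw [e01]; ring⟩, ⟨X 1 1 - 1, by rw [map_sub, e11, map_one]; ring⟩,
    ⟨- X 1 0, by rw [map_neg, e10]; ring⟩⟩

variable (H : QRing O ι)
include H

lemma QRing.mp_inj : Function.Injective (mp ι) := by
  intro A B h
  have : ∀ i j, A i j = B i j := fun i j => H.inj (by rw [← mp_ap, ← mp_ap, h])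
  exact sl_ext (this _ _) (this _ _) (this _ _) (this _ _)

lemma QRing.pm_eq {A B : SL2 O} : pm A = pm B ↔ A = B ∨ A = -B := by
  have := H.dom
  have key : pm A = pm B ↔ A⁻¹ * B ∈ Subgroup.center (SL2 O) := QuotientGroup.eq
  rw [key, Matrix.SpecialLinearGroup.mem_center_iff]
  constructor
  · rintro ⟨r, hr, h⟩
    rw [Fintype.card_fin, sq_eq_one_iff] at hr
    have h' : ∀ i j, (Matrix.scalar (Fin 2) r) i j = (A⁻¹ * B) i j := fun i j => by rw [h]
    have h00 := h' 0 0
    have h01 := h' 0 1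
    have h10 := h' 1 0
    have h11 := h' 1 1
    simp at h00 h01 h10 h11
    rcases hr with rfl | rfl
    · left
      have : A⁻¹ * B = 1 := by apply sl_ext <;> simp [← h00, ← h01, ← h10, ← h11]
      exact (inv_mul_eq_one.1 this)
    · right
      have : A⁻¹ * B = -1 := by
        apply sl_ext <;> simp [← h00, ← h01, ← h10, ← h11, sl_neg]
      rw [inv_mul_eq_iff_eq_mul] at this
      rw [this]; simp
  · rintro (rfl | rfl)
    · exact ⟨1, by simp, by simp⟩
    · refine ⟨-1, by simp, ?_⟩
      have : (-B)⁻¹ * B = -1 := by rw [inv_mul_eq_iff_eq_mul]; simp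
      rw [this]; ext i j; fin_cases i <;> fin_cases j <;> simp

lemma QRing.pm_neg (A : SL2 O) : pm (-A) = pm A := by rw [H.pm_eq]; right; rfl

lemma QRing.par_ve {v : O × O} (hv : v ≠ 0) : Par ι (pm (Pg v 1)) (ve ι v) :=
  ⟨H.vec_ne hv, Pg v 1, rfl, by rw [mp_Pg, map_one]⟩

lemma QRing.par_unique {g : PSL2 O} {x y : ℂ × ℂ} (h : Par ι g x) (h' : Par ι g y) : x = y ∨ x = -y := by
  obtain ⟨h0, X, rfl, hX⟩ := h
  obtain ⟨h0', Y, hXY, hY⟩ := h'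
  rcases H.pm_eq.1 hXY with rfl | rfl
  · exact Pg_eq (hX.symm.trans hY)
  · rw [mp_neg, hX] at hY
    exact absurd hY.symm (Pg_ne_neg _ _)

lemma QRing.par_comm {g g' : PSL2 O} {x y : ℂ × ℂ} (h : Par ι g x) (h' : Par ι g' y) :
    g * g' = g' * g ↔ dt x y = 0 := by
  constructor
  · intro hc
    obtain ⟨h0, X, rfl, hX⟩ := h
    have := par_conj h' X
    rw [hc, mul_inv_cancel_right, hX] at this
    rcases H.par_unique this h' with e | e
    · rw [ac_Pg', one_mul] at e
      have := add_eq_left.1 e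
      exact (smul_eq_zero.1 this).resolve_right h0
    · rw [ac_Pg', one_mul] at e
      have := congrArg (dt x) e
      rw [dt_add_right, dt_smul_right, dt_self, dt_neg_right] at this
      linear_combination this / 2
  · intro hd
    obtain ⟨h0, X, rfl, hX⟩ := h
    obtain ⟨h0', Y, rfl, hY⟩ := h'
    obtain ⟨c, rfl⟩ := dt_eq_zero_smul h0 hd
    rw [← map_mul, ← map_mul]; congr 1
    apply H.mp_inj
    rw [map_mul, map_mul, hX, hY, Pg_smul, ← Pg_add, ← Pg_add, add_comm]

lemma QRing.par_V1 {g g' : PSL2 O} {x y : ℂ × ℂ} (h : Par ι g x) (h' : Par ι g' y)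
    (hd : dt x y ≠ 0) : 1 ≤ ‖dt x y‖ := by
  obtain ⟨⟨a, ha⟩, ⟨b, hb⟩, ⟨c, hc⟩⟩ := par_sq h
  obtain ⟨⟨a', ha'⟩, ⟨b', hb'⟩, ⟨c', hc'⟩⟩ := par_sq h'
  have e : ι (a * c' + c * a' - 2 * (b * b')) = dt x y ^ 2 := by
    simp only [map_sub, map_add, map_mul, ha, ha', hb, hb', hc, hc', dt, map_ofNat]; ring
  have : a * c' + c * a' - 2 * (b * b') ≠ 0 := by
    rw [← H.ne, e]; exact pow_ne_zero 2 hd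
  have h1 := H.disc _ this
  rw [e, norm_pow] at h1
  nlinarith [norm_nonneg (dt x y)]

lemma QRing.par_good {g : PSL2 O} {x : ℂ × ℂ} (h : Par ι g x) : ∃ C, good ι C x := by
  have key : ∀ s : ℂ, s ≠ 0 → ∀ p : O × O, s • x = ve ι p → ∃ C, good ι C x := by
    intro s hs p hp
    have hp0 : p ≠ 0 := by
      rintro rfl
      rcases smul_eq_zero.1 (hp.trans (by simp [ve] : ve ι 0 = 0)) with h1 | h1
      · exact hs h1
      · exact h.1 h1
    have hu : ∃ u, dO p u ≠ 0 := by
      by_contra hcon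
      push Not at hcon
      have h1 := hcon (0, 1); have h2 := hcon (1, 0)
      simp [dO] at h1 h2
      exact hp0 (Prod.ext h1 h2)
    obtain ⟨u, hu⟩ := hu
    have hs0 : 0 < ‖s‖ := norm_pos_iff.2 hs
    refine ⟨‖s‖ + ‖s‖⁻¹ + ‖ι (dO p u)‖, s, p, u, ?_, ?_, hp, hu, ?_⟩
    · have := norm_nonneg (ι (dO p u)); have := inv_pos.2 hs0; linarith
    · have : ‖s‖⁻¹ * ‖s‖ = 1 := inv_mul_cancel₀ hs0.ne'
      rw [add_mul, add_mul, this]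
      have : 0 ≤ ‖s‖ * ‖s‖ := by positivity
      have : 0 ≤ ‖ι (dO p u)‖ * ‖s‖ := by positivity
      linarith
    · have := inv_pos.2 hs0; linarith
  obtain ⟨⟨a, ha⟩, ⟨b, hb⟩, ⟨c, hc⟩⟩ := par_sq h
  by_cases h1 : x.1 = 0
  · have h2 : x.2 ≠ 0 := fun h2 => h.1 (Prod.ext h1 h2)
    refine key x.2 h2 (b, c) (Prod.ext ?_ ?_)
    · simp only [Prod.smul_fst, smul_eq_mul, ve, hb]; ring
    · simp only [Prod.smul_snd, smul_eq_mul, ve, hc]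
  · refine key x.1 h1 (a, b) (Prod.ext ?_ ?_)
    · simp only [Prod.smul_fst, smul_eq_mul, ve, ha]
    · simp only [Prod.smul_snd, smul_eq_mul, ve, hb]

lemma QRing.pg_faith {v : O × O} (hv : v ≠ 0) {s t : O} (h : pm (Pg v s) = pm (Pg v t)) : s = t := by
  have := H.dom
  rcases H.pm_eq.1 h with h | h
  · have h01 : Pg v s 0 1 = Pg v t 0 1 := by rw [h]
    have h10 : Pg v s 1 0 = Pg v t 1 0 := by rw [h]
    simp only [Pg01, Pg10] at h01 h10
    by_cases h1 : v.1 = 0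
    · have h2 : v.2 ≠ 0 := fun h2 => hv (Prod.ext h1 h2)
      exact neg_injective (mul_right_cancel₀ (pow_ne_zero 2 h2) h10)
    · exact mul_right_cancel₀ (pow_ne_zero 2 h1) h01
  · have h00 : Pg v s 0 0 = (-Pg v t) 0 0 := by rw [h]
    have h11 : Pg v s 1 1 = (-Pg v t) 1 1 := by rw [h]
    rw [sl_neg] at h00 h11
    simp only [Pg00, Pg11] at h00 h11
    have e : (4 : O) = 0 := by linear_combination h00 + h11
    have := congrArg ι e
    rw [map_ofNat, map_zero] at this; norm_num at this

end ring

lemma ac_pow_eig {A : SL2 ℂ} {x : ℂ × ℂ} {c : ℂ} (hc : c ≠ 0) (h : ac A x = c • x) (n : ℤ) :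
    ac (A ^ n) x = c ^ n • x := by
  have hinv : ac A⁻¹ x = c⁻¹ • x := by
    have := ac_inv_ac A x
    rw [h, ac_smul] at this
    rw [← smul_right_injective _ hc |>.eq_iff, this, smul_smul, mul_inv_cancel₀ hc, one_smul]
  induction n with
  | zero => simp [ac_one]
  | succ n ih => rw [zpow_add_one, ac_mul, h, ac_smul, ih, smul_smul, zpow_add_one₀ hc, mul_comm]
  | pred n ih => rw [zpow_sub_one, ac_mul, hinv, ac_smul, ih, smul_smul, zpow_sub_one₀ hc, mul_comm]

lemma eig_tr {A : SL2 ℂ} {x : ℂ × ℂ} {c : ℂ} (hx : x ≠ 0) (h : ac A x = c • x) :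
    c * c - (A 0 0 + A 1 1) * c + 1 = 0 := by
  have h1 := congrArg Prod.fst h
  have h2 := congrArg Prod.snd h
  simp only [ac, Prod.smul_fst, Prod.smul_snd, smul_eq_mul] at h1 h2
  have hd := sl_det A
  by_cases hx1 : x.1 = 0
  · have hx2 : x.2 ≠ 0 := fun hx2 => hx (Prod.ext hx1 hx2)
    apply mul_right_cancel₀ hx2
    linear_combination (-A 1 0) * h1 + (A 0 0 - c) * h2 - x.2 * hd
  · apply mul_right_cancel₀ hx1
    linear_combination (A 1 1 - c) * h1 - (A 0 1) * h2 - x.1 * hd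

lemma exists_eig (A : SL2 ℂ) {c : ℂ} (h : c * c - (A 0 0 + A 1 1) * c + 1 = 0) :
    ∃ x, x ≠ 0 ∧ ac A x = c • x := by
  have hd := sl_det A
  by_cases h01 : A 0 1 = 0
  · by_cases h11 : A 1 1 = c
    · exact ⟨(0, 1), by simp, by simp [ac, h01, h11]⟩
    · refine ⟨(c - A 1 1, A 1 0), ?_, ?_⟩
      · intro h0; exact h11 (sub_eq_zero.1 (congrArg Prod.fst h0)).symm
      · refine Prod.ext ?_ ?_ <;> simp only [ac, Prod.smul_fst, Prod.smul_snd, smul_eq_mul]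
        · linear_combination -h - hd
        · ring
  · refine ⟨(A 0 1, c - A 0 0), ?_, ?_⟩
    · intro h0; exact h01 (congrArg Prod.fst h0)
    · refine Prod.ext ?_ ?_ <;> simp only [ac, Prod.smul_fst, Prod.smul_snd, smul_eq_mul]
      · ring
      · linear_combination -h - hd

lemma sl_ext_basis {A B : SL2 ℂ} {x y : ℂ × ℂ} (hxy : dt x y ≠ 0) (hx : ac A x = ac B x)
    (hy : ac A y = ac B y) : A = B := by
  have key : ∀ z, ac A z = ac B z := by
    intro z
    have hz : z = (dt z y / dt x y) • x + (dt x z / dt x y) • y := by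
      ext
      · simp only [Prod.fst_add, Prod.smul_fst, smul_eq_mul]; field_simp; simp only [dt]; ring
      · simp only [Prod.snd_add, Prod.smul_snd, smul_eq_mul]; field_simp; simp only [dt]; ring
    rw [hz, ac_add, ac_smul, ac_smul, ac_add, ac_smul, ac_smul, hx, hy]
  have k1 := key (1, 0)
  have k2 := key (0, 1)
  simp only [ac, mul_one, mul_zero, add_zero, zero_add, Prod.mk.injEq] at k1 k2
  exact sl_ext k1.1 k2.1 k1.2 k2.2

lemma roots_fin (τ : ℂ) : {c : ℂ | c * c - τ * c + 1 = 0}.Finite := by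
  by_cases h : ∃ c, c * c - τ * c + 1 = 0
  · obtain ⟨c, hc⟩ := h
    refine (Set.toFinite {c, τ - c}).subset ?_
    intro b hb
    rw [Set.mem_ofPred_eq] at hb
    have : (b - c) * (b - (τ - c)) = 0 := by linear_combination hb - hc
    rcases mul_eq_zero.1 this with h | h
    · left; exact sub_eq_zero.1 h
    · right; exact sub_eq_zero.1 h
  · push Not at h
    convert Set.finite_empty
    ext c; simpa using h c

lemma exists_seq (a b : ℝ) : ∃ f : ℕ → ℤ × ℤ, Function.Injective f ∧
    ∀ k, |(f k).1 * a + (f k).2 * b| ≤ |b| := by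
  by_cases hb : b = 0
  · refine ⟨fun k => (0, k), ?_, ?_⟩
    · intro k l h; simpa using h
    · intro k; simp [hb]
  · refine ⟨fun k => (k, round (-(k * a / b))), ?_, ?_⟩
    · intro k l h; simpa using congrArg Prod.fst h
    · intro k
      have e : ((k:ℤ):ℝ) * a + (round (-(k * a / b)) : ℤ) * b =
        -((-(k * a / b)) - (round (-(k * a / b)) : ℤ)) * b := by field_simp; push_cast; ring
      simp only
      rw [e, abs_mul, abs_neg]
      have := abs_sub_round (-(k * a / b))
      nlinarith [abs_nonneg b]

section ring
variable {O : Type} [CommRing O] {ι : O →+* ℂ} (H : QRing O ι)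
include H

lemma QRing.no_loxo {X Y : SL2 O} (hc : X * Y = Y * X)
    (h2 : (mp ι X 0 0 + mp ι X 1 1) ^ 2 ≠ 4) :
    ∃ p q : ℤ × ℤ, p ≠ q ∧ X ^ p.1 * Y ^ p.2 = X ^ q.1 * Y ^ q.2 := by
  set A := mp ι X with hA
  set B := mp ι Y with hB
  have hAB : A * B = B * A := by rw [hA, hB, ← map_mul, hc, map_mul]
  obtain ⟨r, hr⟩ := IsAlgClosed.exists_eq_mul_self ((A 0 0 + A 1 1) ^ 2 - 4)
  set τ := A 0 0 + A 1 1 with hτ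
  have hl1 : ((τ + r) / 2) * ((τ + r) / 2) - τ * ((τ + r) / 2) + 1 = 0 := by linear_combination -hr / 4
  have hl2 : ((τ - r) / 2) * ((τ - r) / 2) - τ * ((τ - r) / 2) + 1 = 0 := by linear_combination -hr / 4
  set l := (τ + r) / 2
  set l' := (τ - r) / 2
  have hll : l * l' = 1 := by simp only [l, l']; linear_combination hr / 4
  have hl0 : l ≠ 0 := left_ne_zero_of_mul_eq_one hll
  have hl0' : l' ≠ 0 := right_ne_zero_of_mul_eq_one hll
  have hr0 : r ≠ 0 := by
    rintro rfl; apply h2; linear_combination hr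
  have hne : l - l' ≠ 0 := by
    have : l - l' = r := by simp only [l, l']; ring
    rwa [this]
  have hsq : ∀ c c' : ℂ, c * c' = 1 → c - c' ≠ 0 → c * c ≠ 1 := by
    intro c c' h1 h2 h3
    apply h2
    have hc0 : c ≠ 0 := left_ne_zero_of_mul_eq_one h1
    apply mul_left_cancel₀ hc0; linear_combination h3 - h1
  obtain ⟨x, hx0, hx⟩ := exists_eig A hl1
  obtain ⟨y, hy0, hy⟩ := exists_eig A hl2
  have heig : ∀ (z : ℂ × ℂ) (c : ℂ), z ≠ 0 → ac A z = c • z → c * c ≠ 1 → ∃ μ : ℂ, μ ≠ 0 ∧ ac B z = μ • z := by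
    intro z c hz0 hz hcc
    have e1 : ac A (ac B z) = c • ac B z := by rw [← ac_mul, hAB, ac_mul, hz, ac_smul]
    have e2 := dt_ac A z (ac B z)
    rw [hz, e1, dt_smul_left, dt_smul_right] at e2
    have e3 : dt z (ac B z) = 0 := by
      have : (c * c - 1) * dt z (ac B z) = 0 := by linear_combination e2
      exact (mul_eq_zero.1 this).resolve_left (sub_ne_zero.2 hcc)
    obtain ⟨μ, hμ⟩ := dt_eq_zero_smul hz0 e3
    refine ⟨μ, ?_, hμ⟩
    rintro rfl
    rw [zero_smul] at hμ; exact ac_ne_zero hz0 hμ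
  obtain ⟨m, hm0, hm⟩ := heig x l hx0 hx (hsq _ _ hll hne)
  obtain ⟨m', hm0', hm'⟩ := heig y l' hy0 hy (hsq _ _ (by rw [mul_comm, hll]) (by
    intro h; apply hne; linear_combination -h))
  have hxy : dt x y ≠ 0 := by
    intro h
    obtain ⟨c, hc⟩ := dt_eq_zero_smul hx0 h
    have hc0 : c ≠ 0 := by rintro rfl; exact hy0 (by rw [hc, zero_smul])
    have e : ac A y = l • y := by rw [hc, ac_smul, hx, smul_comm]
    rw [hy, ← sub_eq_zero, ← sub_smul] at e
    rcases smul_eq_zero.1 e with h | h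
    · apply hne; linear_combination -h
    · exact hy0 h
  obtain ⟨f, hf, hfb⟩ := exists_seq (Real.log ‖l‖) (Real.log ‖m‖)
  set K := Real.exp |Real.log ‖m‖|
  let c : ℕ → ℂ := fun k => l ^ (f k).1 * m ^ (f k).2
  let Z : ℕ → SL2 O := fun k => X ^ (f k).1 * Y ^ (f k).2
  have hZ : ∀ k, mp ι (Z k) = A ^ (f k).1 * B ^ (f k).2 := fun k => by
    simp only [Z, map_mul, map_zpow, hA, hB]
  have hc0 : ∀ k, c k ≠ 0 := fun k => mul_ne_zero (zpow_ne_zero _ hl0) (zpow_ne_zero _ hm0)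
  have hZx : ∀ k, ac (mp ι (Z k)) x = c k • x := by
    intro k
    rw [hZ, ac_mul, ac_pow_eig hm0 hm, ac_smul, ac_pow_eig hl0 hx, smul_smul, mul_comm]
  have hZy : ∀ k, ac (mp ι (Z k)) y = (c k)⁻¹ • y := by
    intro k
    have e : ac (mp ι (Z k)) y = (m' ^ (f k).2 * l' ^ (f k).1) • y := by
      rw [hZ, ac_mul, ac_pow_eig hm0' hm', ac_smul, ac_pow_eig hl0' hy, smul_smul]
    have e2 := dt_ac (mp ι (Z k)) x y
    rw [hZx, e, dt_smul_left, dt_smul_right, ← mul_assoc] at e2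
    have e3 := (mul_eq_right₀ hxy).1 e2
    rw [e, eq_inv_of_mul_eq_one_right e3]
  have hlog : ∀ k, Real.log ‖c k‖ = (f k).1 * Real.log ‖l‖ + (f k).2 * Real.log ‖m‖ := by
    intro k
    simp only [c, norm_mul, norm_zpow]
    rw [Real.log_mul (zpow_ne_zero _ (norm_ne_zero_iff.2 hl0)) (zpow_ne_zero _ (norm_ne_zero_iff.2 hm0)),
      Real.log_zpow, Real.log_zpow]
  have hcK : ∀ k, ‖c k‖ ≤ K ∧ ‖(c k)⁻¹‖ ≤ K := by
    intro k
    have h1 := hfb k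
    rw [← hlog, abs_le] at h1
    have h3 : 0 < ‖c k‖ := norm_pos_iff.2 (hc0 k)
    constructor
    · exact (Real.log_le_iff_le_exp h3).1 h1.2
    · rw [norm_inv]
      refine (Real.log_le_iff_le_exp (inv_pos.2 h3)).1 ?_
      rw [Real.log_inv]; linarith
  have hfin : (⋃ t ∈ {t : O | ‖ι t‖ ≤ 2 * K}, {c : ℂ | c * c - ι t * c + 1 = 0}).Finite :=
    (H.fin _).biUnion fun t _ => roots_fin _
  obtain ⟨i, -, j, -, hij, hcij⟩ := Set.infinite_univ.exists_ne_map_eq_of_mapsTo (f := c) (s := Set.univ)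
    (t := ⋃ t ∈ {t : O | ‖ι t‖ ≤ 2 * K}, {c : ℂ | c * c - ι t * c + 1 = 0}) (by
      intro k _
      have e := eig_tr hx0 (hZx k)
      have e' : ι (Z k 0 0 + Z k 1 1) = mp ι (Z k) 0 0 + mp ι (Z k) 1 1 := by
        rw [map_add]; rfl
      rw [← e'] at e
      simp only [Set.mem_iUnion]
      refine ⟨Z k 0 0 + Z k 1 1, ?_, e⟩
      rw [Set.mem_ofPred_eq]
      have e2 : ι (Z k 0 0 + Z k 1 1) = c k + (c k)⁻¹ := by
        have := hc0 k
        field_simp; linear_combination -e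
      rw [e2]
      refine (norm_add_le _ _).trans ?_
      have := hcK k; linarith) hfin
  refine ⟨f i, f j, fun h => hij (hf h), ?_⟩
  apply H.mp_inj
  change mp ι (Z i) = mp ι (Z j)
  exact sl_ext_basis hxy (by rw [hZx, hZx, hcij]) (by rw [hZy, hZy, hcij])

lemma QRing.lemmaA (φ : PSL2 O ≃* PSL2 O) {v : O × O} (hv : v ≠ 0) : ∃ x, Par ι (φ (pm (Pg v 1))) x := by
  have := H.dom
  obtain ⟨δ, ρ, hρ, -, hδ, -⟩ := H.cover
  obtain ⟨X, hX⟩ := pm_surj (φ (pm (Pg v 1)))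
  obtain ⟨Y, hY⟩ := pm_surj (φ (pm (Pg v δ)))
  have hZ : ∀ m n : ℤ, pm (X ^ m * Y ^ n) = φ (pm (Pg v (m + n * δ))) := by
    intro m n
    rw [map_mul, map_zpow, map_zpow, hX, hY, ← map_zpow, ← map_zpow, ← map_zpow, ← map_zpow,
      Pg_zpow, Pg_zpow, ← map_mul, ← map_mul, ← Pg_add, mul_one]
  have hcomm : X * Y = Y * X := by
    have e : pm (X * Y) = pm (Y * X) := by
      rw [map_mul, map_mul, hX, hY, ← map_mul, ← map_mul, ← map_mul, ← map_mul, ← Pg_add, ← Pg_add, add_comm]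
    rcases H.pm_eq.1 e with h | h
    · exact h
    · exfalso
      have h1 : X * Y * X⁻¹ = - Y := by rw [h]; simp
      have ht : Y 0 0 + Y 1 1 = 0 := by
        have e00 : (X * Y * X⁻¹) 0 0 = (-Y) 0 0 := by rw [h1]
        have e11 : (X * Y * X⁻¹) 1 1 = (-Y) 1 1 := by rw [h1]
        rw [sl_mul, sl_mul, sl_mul, sl_inv00, sl_inv10, sl_neg] at e00
        rw [sl_mul, sl_mul, sl_mul, sl_inv01, sl_inv11, sl_neg] at e11
        have h2 : (2:O) * (Y 0 0 + Y 1 1) = 0 := by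
          linear_combination e00 + e11 - (Y 0 0 + Y 1 1) * sl_det X
        refine (mul_eq_zero.1 h2).resolve_left ?_
        refine H.ne.1 ?_; rw [map_ofNat]; norm_num
      have hYY : Y * Y = -1 := by
        have hd := sl_det Y
        apply sl_ext <;> simp only [sl_mul, sl_neg, sl_one00, sl_one01, sl_one10, sl_one11, neg_zero]
        · linear_combination Y 0 0 * ht - hd
        · linear_combination Y 0 1 * ht
        · linear_combination Y 1 0 * ht
        · linear_combination Y 1 1 * ht - hd
      have h3 : pm (X ^ (0:ℤ) * Y ^ (2:ℤ)) = 1 := by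
        rw [zpow_zero, one_mul, zpow_ofNat, pow_two, hYY, H.pm_neg, map_one]
      rw [hZ, EmbeddingLike.map_eq_one_iff, ← map_one pm, ← Pg_zero v] at h3
      have := hδ 0 2 (by rw [H.pg_faith hv h3, map_zero])
      omega
  have htr : (mp ι X 0 0 + mp ι X 1 1) ^ 2 = 4 := by
    by_contra h2
    obtain ⟨p, q, hpq, h⟩ := H.no_loxo hcomm h2
    have h3 := congrArg pm h
    rw [hZ, hZ, EmbeddingLike.apply_eq_iff_eq] at h3
    have h4 := H.pg_faith hv h3
    have := hδ (p.1 - q.1) (p.2 - q.2) (by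
      have h5 := congrArg ι h4
      simp only [map_add, map_mul, map_intCast] at h5 ⊢
      push_cast; linear_combination h5)
    exact hpq (Prod.ext (by omega) (by omega))
  have hX' : ∃ X : SL2 O, pm X = φ (pm (Pg v 1)) ∧ mp ι X 0 0 + mp ι X 1 1 = 2 := by
    have : (mp ι X 0 0 + mp ι X 1 1 - 2) * (mp ι X 0 0 + mp ι X 1 1 + 2) = 0 := by linear_combination htr
    rcases mul_eq_zero.1 this with h | h
    · exact ⟨X, hX, by linear_combination h⟩
    · refine ⟨-X, by rw [H.pm_neg, hX], ?_⟩
      rw [mp_neg, sl_neg, sl_neg]; linear_combination -h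
  obtain ⟨X, hX, ht⟩ := hX'
  obtain ⟨w1, hw1⟩ := IsAlgClosed.exists_eq_mul_self (mp ι X 0 1)
  obtain ⟨w2, hw2⟩ := IsAlgClosed.exists_eq_mul_self (-(mp ι X 1 0))
  have hd := sl_det (mp ι X)
  have hw : ∃ w : ℂ × ℂ, w.1 * w.1 = mp ι X 0 1 ∧ w.2 * w.2 = - (mp ι X 1 0) ∧ w.1 * w.2 = 1 - mp ι X 0 0 := by
    have : (w1 * w2 - (1 - mp ι X 0 0)) * (w1 * w2 + (1 - mp ι X 0 0)) = 0 := by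
      linear_combination (-w2 * w2) * hw1 - (mp ι X 0 1) * hw2 - mp ι X 0 0 * ht + hd
    rcases mul_eq_zero.1 this with h | h
    · exact ⟨(w1, w2), hw1.symm, hw2.symm, by linear_combination h⟩
    · exact ⟨(-w1, w2), by simp only; linear_combination -hw1, hw2.symm, by simp only; linear_combination -h⟩
  obtain ⟨w, e1, e2, e3⟩ := hw
  have hXw : mp ι X = Pg w 1 := by
    apply sl_ext <;> simp only [Pg00, Pg01, Pg10, Pg11]
    · linear_combination e3
    · linear_combination -e1
    · linear_combination e2
    · linear_combination ht - e3
  refine ⟨w, ?_, X, hX, hXw⟩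
  rintro rfl
  have h1 : mp ι X = mp ι 1 := by
    rw [hXw, map_one]; apply sl_ext <;> simp [Pg00, Pg01, Pg10, Pg11]
  rw [H.mp_inj h1, map_one, eq_comm, EmbeddingLike.map_eq_one_iff, ← map_one pm, ← Pg_zero v] at hX
  have := congrArg ι (H.pg_faith hv hX)
  simp at this

end ring

def Wr {O : Type} [CommRing O] (ι : O →+* ℂ) (φ : PSL2 O ≃* PSL2 O) (v : O × O) (w : ℂ × ℂ) : Prop :=
  Par ι (φ (pm (Pg v 1))) w

section ring
variable {O : Type} [CommRing O] {ι : O →+* ℂ}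

lemma W_ac {φ : PSL2 O ≃* PSL2 O} {v : O × O} {w : ℂ × ℂ} (h : Wr ι φ v w) {γ Γ : SL2 O}
    (hΓ : pm Γ = φ (pm γ)) : Wr ι φ (ac γ v) (ac (mp ι Γ) w) := by
  unfold Wr at *
  rw [← Pg_conj, map_mul, map_mul, map_inv, map_mul, map_mul, map_inv, ← hΓ]
  exact par_conj h Γ

lemma W_ac_inv {φ : PSL2 O ≃* PSL2 O} {v : O × O} {w : ℂ × ℂ} {γ Γ : SL2 O} (h : Wr ι φ (ac γ v) w)
    (hΓ : pm Γ = φ (pm γ)) : Wr ι φ v (ac (mp ι Γ⁻¹) w) := by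
  have := W_ac h (γ := γ⁻¹) (Γ := Γ⁻¹) (by rw [map_inv, map_inv, map_inv, hΓ])
  rwa [ac_inv_ac] at this

lemma ac_mp_inv (Γ : SL2 O) (w : ℂ × ℂ) : ac (mp ι Γ) (ac (mp ι Γ⁻¹) w) = w := by
  rw [map_inv, ac_ac_inv]

lemma dO_ne_left {a b : O × O} (h : dO a b ≠ 0) : a ≠ 0 := by rintro rfl; simp [dO] at h
lemma dO_ne_right {a b : O × O} (h : dO a b ≠ 0) : b ≠ 0 := by rintro rfl; simp [dO] at h

variable (H : QRing O ι) (φ : PSL2 O ≃* PSL2 O)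
include H

lemma QRing.W_dt {a b : O × O} {x y : ℂ × ℂ} (ha : a ≠ 0) (hb : b ≠ 0) (hx : Wr ι φ a x) (hy : Wr ι φ b y) :
    dt (ve ι a) (ve ι b) = 0 ↔ dt x y = 0 := by
  rw [← H.par_comm (H.par_ve ha) (H.par_ve hb), ← H.par_comm hx hy, ← map_mul φ, ← map_mul φ,
    EmbeddingLike.apply_eq_iff_eq]

lemma QRing.unif_good (C : ℝ) : ∃ K : ℝ, 1 ≤ K ∧ ∀ v, Mn ι C v → ∀ w, Wr ι φ v w → good ι K w := by
  obtain ⟨K, hK, h⟩ := H.unif (fun a _ K => ∀ w, Wr ι φ a w → good ι K w)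
    (fun a b K K' hKK h w hw => good_mono hKK (h w hw))
    (fun γ a b K h w hw => by
      obtain ⟨Γ, hΓ⟩ := pm_surj (φ (pm γ))
      have := good_ac (h _ (W_ac_inv hw hΓ)) Γ
      rwa [ac_mp_inv] at this)
    (fun a b hab => by
      obtain ⟨w0, hw0⟩ := H.lemmaA φ (dO_ne_left hab)
      obtain ⟨K, hK⟩ := H.par_good hw0
      refine ⟨K, fun w hw => ?_⟩
      rcases H.par_unique hw hw0 with rfl | rfl
      · exact hK
      · exact good_neg hK) C
  refine ⟨K, hK, fun v hv => ?_⟩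
  obtain ⟨u, h1, h2⟩ := hv
  exact h v u h1 h2

lemma QRing.W_J2 (R : ℝ) : ∃ R' : ℝ, 1 ≤ R' ∧ ∀ a b x y, a ≠ 0 → b ≠ 0 → Wr ι φ a x → Wr ι φ b y →
    ‖ι (dO a b)‖ ≤ R → ‖dt x y‖ ≤ R' := by
  obtain ⟨K, hK, h⟩ := H.unif (fun a b K => ∀ x y, Wr ι φ a x → Wr ι φ b y → ‖dt x y‖ ≤ K)
    (fun a b K K' hKK h x y hx hy => (h x y hx hy).trans hKK)
    (fun γ a b K h x y hx hy => by
      obtain ⟨Γ, hΓ⟩ := pm_surj (φ (pm γ))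
      have := h _ _ (W_ac_inv hx hΓ) (W_ac_inv hy hΓ)
      rwa [dt_ac] at this)
    (fun a b hab => by
      obtain ⟨x0, hx0⟩ := H.lemmaA φ (dO_ne_left hab)
      obtain ⟨y0, hy0⟩ := H.lemmaA φ (dO_ne_right hab)
      refine ⟨‖dt x0 y0‖, fun x y hx hy => ?_⟩
      rcases H.par_unique hx hx0 with rfl | rfl <;> rcases H.par_unique hy hy0 with rfl | rfl <;>
        simp only [dt_neg_left, dt_neg_right, norm_neg, le_refl]) R
  refine ⟨K, hK, fun a b x y ha hb hx hy hR => ?_⟩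
  by_cases h0 : dO a b = 0
  · rw [(H.W_dt φ ha hb hx hy).1 (by rw [dt_ve, h0, map_zero]), norm_zero]; linarith
  · exact h a b h0 hR x y hx hy

lemma QRing.W_beta (δ : O) (R : ℝ) : ∃ K : ℝ, 1 ≤ K ∧ ∀ a b, dO a b ≠ 0 → ‖ι (dO a b)‖ ≤ R →
    ∀ x, Wr ι φ a x → ∃ β : ℂ, ‖β‖ ≤ K ∧ ∃ Γ, pm Γ = φ (pm (Pg a δ)) ∧ mp ι Γ = Pg x β := by
  refine H.unif (fun a _ K => ∀ x, Wr ι φ a x → ∃ β : ℂ, ‖β‖ ≤ K ∧ ∃ Γ, pm Γ = φ (pm (Pg a δ)) ∧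
    mp ι Γ = Pg x β) ?_ ?_ ?_ R
  · intro a b K K' hKK h x hx
    obtain ⟨β, h1, h2⟩ := h x hx
    exact ⟨β, h1.trans hKK, h2⟩
  · intro γ a b K h x hx
    obtain ⟨Γ, hΓ⟩ := pm_surj (φ (pm γ))
    obtain ⟨β, h1, G, h2, h3⟩ := h _ (W_ac_inv hx hΓ)
    refine ⟨β, h1, Γ * G * Γ⁻¹, ?_, ?_⟩
    · rw [← Pg_conj, map_mul, map_mul, map_inv, map_mul, map_mul, map_inv, h2, hΓ, map_mul, map_mul, map_inv]
    · rw [map_mul, map_mul, h3, map_inv, Pg_conj, ← map_inv, ac_mp_inv]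
  · intro a b hab
    obtain ⟨x0, hx0⟩ := H.lemmaA φ (dO_ne_left hab)
    have key : ∃ β : ℂ, ∃ Γ, pm Γ = φ (pm (Pg a δ)) ∧ mp ι Γ = Pg x0 β := by
      obtain ⟨Γ, hΓ⟩ := pm_surj (φ (pm (Pg a δ)))
      obtain ⟨y, hy⟩ := exists_dual hx0.1
      have h1 := W_ac hx0 hΓ
      have h2 : ac (Pg a δ) a = a := by
        rw [ac_Pg, mul_comm a.1, sub_self, mul_zero, zero_smul, add_zero]
      rw [h2] at h1
      rcases H.par_unique h1 hx0 with h | h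
      · obtain ⟨β, hβ⟩ := fix_Pg hy h
        exact ⟨β, Γ, hΓ, hβ⟩
      · obtain ⟨β, hβ⟩ := fix_Pg (A := mp ι (-Γ)) hy (by rw [mp_neg, ac_neg, h, neg_neg])
        exact ⟨β, -Γ, by rw [H.pm_neg, hΓ], hβ⟩
    obtain ⟨β, Γ, h1, h2⟩ := key
    refine ⟨‖β‖, fun x hx => ⟨β, le_rfl, Γ, h1, ?_⟩⟩
    rcases H.par_unique hx hx0 with rfl | rfl
    · exact h2
    · rw [Pg_neg, h2]

lemma QRing.W_J3 (R : ℝ) : ∃ R' : ℝ, ∀ a b c x y z, a ≠ 0 → b ≠ 0 → c ≠ 0 → Wr ι φ a x → Wr ι φ b y → Wr ι φ c z →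
    dO a b ≠ 0 → dO a c ≠ 0 → ‖ι (dO a b)‖ ≤ R → ‖ι (dO a c)‖ ≤ R →
    ‖dt y z‖ ≤ R' * (1 + ‖ι (dO b c)‖) := by
  obtain ⟨δ, ρ, hρ, hcov, -, hmn⟩ := H.cover
  obtain ⟨K, hK, hβ⟩ := H.W_beta φ δ R
  obtain ⟨R1, hR1, h1⟩ := H.W_J2 φ R
  obtain ⟨R2, hR2, h2⟩ := H.W_J2 φ (ρ * (R * R))
  refine ⟨R2 + (1 + K) * ρ * (R1 * R1), fun a b c x y z ha hb hc hx hy hz hab hac hRb hRc => ?_⟩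
  have hR0 : 0 ≤ R := (norm_nonneg _).trans hRb
  have hab' := H.ne.2 hab
  have hac' := H.ne.2 hac
  obtain ⟨m, n, hmn'⟩ := hcov (ι (dO b c) / (ι (dO a c) * ι (dO a b)))
  obtain ⟨β, hβK, Γ, hΓ, hΓβ⟩ := hβ a b hab hRb x hx
  set t : O := m + n * δ with ht
  obtain ⟨X, hX, hXx⟩ := hx.2
  have hG : pm (X ^ m * Γ ^ n) = φ (pm (Pg a t)) := by
    rw [map_mul, map_zpow, map_zpow, hX, hΓ, ← map_zpow, ← map_zpow, ← map_zpow, ← map_zpow,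
      Pg_zpow, Pg_zpow, ← map_mul, ← map_mul, ← Pg_add, mul_one]
  have hGm : mp ι (X ^ m * Γ ^ n) = Pg x (m + n * β) := by
    rw [map_mul, map_zpow, map_zpow, hXx, hΓβ, Pg_zpow, Pg_zpow, ← Pg_add, mul_one]
  have hz' := W_ac hz hG
  rw [hGm] at hz'
  have e1 : dO b (ac (Pg a t) c) = dO b c - t * (dO a c * dO a b) := by
    rw [ac_Pg]; simp only [dO, Prod.fst_add, Prod.snd_add, Prod.smul_fst, Prod.smul_snd, smul_eq_mul]; ring
  have e2 : ι (dO b (ac (Pg a t) c)) =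
      (ι (dO b c) / (ι (dO a c) * ι (dO a b)) - ι t) * (ι (dO a c) * ι (dO a b)) := by
    rw [e1]; simp only [map_sub, map_mul]; field_simp
  have n1 : ‖ι (dO b (ac (Pg a t) c))‖ ≤ ρ * (R * R) := by
    rw [e2, norm_mul, norm_mul]; gcongr
  have n2 := h2 _ _ _ _ hb (ac_ne_zero hc) hy hz' n1
  rw [ac_Pg', dt_add_right, dt_smul_right] at n2
  have nt : ‖ι t‖ ≤ ρ * (1 + ‖ι (dO b c)‖) := by
    have i1 := norm_sub_norm_le (ι t) (ι (dO b c) / (ι (dO a c) * ι (dO a b)))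
    rw [norm_sub_rev] at i1
    have i2 : ‖ι (dO b c) / (ι (dO a c) * ι (dO a b))‖ ≤ ‖ι (dO b c)‖ := by
      rw [norm_div, norm_mul]
      exact div_le_self (norm_nonneg _) (one_le_mul_of_one_le_of_one_le (H.disc _ hac) (H.disc _ hab))
    nlinarith [norm_nonneg (ι (dO b c))]
  have nb : ‖(m:ℂ) + n * β‖ ≤ (1 + K) * (ρ * (1 + ‖ι (dO b c)‖)) := by
    have := hmn m n
    rw [← ht] at this
    refine (norm_add_le _ _).trans ?_
    rw [norm_mul, Complex.norm_intCast, Complex.norm_intCast]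
    calc _ ≤ ‖ι t‖ + ‖ι t‖ * K := by gcongr; exacts [this.1, this.2]
      _ = (1 + K) * ‖ι t‖ := by ring
      _ ≤ _ := by gcongr
  have nx1 := h1 a c x z ha hc hx hz hRc
  have nx2 := h1 a b x y ha hb hx hy hRb
  have n3 : ‖((m:ℂ) + n * β) * dt x z * dt y x‖ ≤ (1 + K) * (ρ * (1 + ‖ι (dO b c)‖)) * R1 * R1 := by
    rw [norm_mul, norm_mul, norm_dt_swap y x]; gcongr
  have n4 : ‖dt y z‖ ≤ R2 + (1 + K) * (ρ * (1 + ‖ι (dO b c)‖)) * R1 * R1 := by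
    have := norm_sub_le (dt y z + ((m:ℂ) + n * β) * dt x z * dt y x) (((m:ℂ) + n * β) * dt x z * dt y x)
    rw [add_sub_cancel_right] at this
    linarith
  nlinarith [norm_nonneg (ι (dO b c))]

lemma QRing.halfJ {I : Type} (a : I → O × O) (w : I → ℂ × ℂ) (ha : ∀ i, a i ≠ 0)
    (hw : ∀ i, Wr ι φ (a i) (w i)) : JointSys (fun i => ve ι (a i)) w := by
  constructor
  · intro i j h
    exact (H.W_dt φ (ha i) (ha j) (hw i) (hw j)).1 h
  · intro R
    obtain ⟨R', -, h⟩ := H.W_J2 φ R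
    refine ⟨R', fun i j hR => ?_⟩
    rw [dt_ve] at hR
    exact h _ _ _ _ (ha i) (ha j) (hw i) (hw j) hR
  · intro R
    obtain ⟨R', h⟩ := H.W_J3 φ R
    refine ⟨R', fun i j k h1 h2 h3 h4 => ?_⟩
    simp only [dt_ve] at h1 h2 h3 h4 ⊢
    exact h _ _ _ _ _ _ (ha i) (ha j) (ha k) (hw i) (hw j) (hw k) (fun h => h1 (by rw [h, map_zero]))
      (fun h => h2 (by rw [h, map_zero])) h3 h4

end ring

lemma joint_scale {I : Type} {X Z x z : I → ℂ × ℂ} (h : JointSys X Z) {K : ℝ} (hK : 1 ≤ K) (s c : I → ℂ)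
    (hX : ∀ i, X i = s i • x i) (hs0 : ∀ i, s i ≠ 0) (hs : ∀ i, ‖s i‖ ≤ K)
    (hz : ∀ i, z i = c i • Z i) (hc : ∀ i, ‖c i‖ ≤ K) : JointSys x z := by
  have eX : ∀ i j, dt (X i) (X j) = s i * s j * dt (x i) (x j) := fun i j => by
    rw [hX, hX, dt_smul_left, dt_smul_right]; ring
  have ez : ∀ i j, dt (z i) (z j) = c i * c j * dt (Z i) (Z j) := fun i j => by
    rw [hz, hz, dt_smul_left, dt_smul_right]; ring
  have nX : ∀ i j, ‖dt (X i) (X j)‖ ≤ K * K * ‖dt (x i) (x j)‖ := fun i j => by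
    rw [eX, norm_mul, norm_mul]
    gcongr
    · exact hs i
    · exact hs j
  have nz : ∀ i j, ‖dt (z i) (z j)‖ ≤ K * K * ‖dt (Z i) (Z j)‖ := fun i j => by
    rw [ez, norm_mul, norm_mul]
    gcongr
    · exact hc i
    · exact hc j
  have KK : 1 ≤ K * K := by nlinarith
  refine ⟨fun i j hij => ?_, fun R => ?_, fun R => ?_⟩
  · rw [ez, h.J0 i j (by rw [eX, hij, mul_zero]), mul_zero]
  · obtain ⟨R', hR'⟩ := h.J2 (K * K * R)
    refine ⟨K * K * R', fun i j hij => (nz i j).trans ?_⟩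
    gcongr
    exact hR' i j ((nX i j).trans (by gcongr))
  · obtain ⟨R', hR'⟩ := h.J3 (K * K * R)
    refine ⟨K * K * (|R'| * (K * K)), fun i j k h1 h2 h3 h4 => (nz j k).trans ?_⟩
    rw [mul_assoc (K * K)]
    gcongr
    refine (hR' i j k ?_ ?_ ((nX i j).trans (by gcongr)) ((nX i k).trans (by gcongr))).trans ?_
    · rw [eX]; exact mul_ne_zero (mul_ne_zero (hs0 _) (hs0 _)) h1
    · rw [eX]; exact mul_ne_zero (mul_ne_zero (hs0 _) (hs0 _)) h2
    rw [mul_assoc]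
    refine mul_le_mul (le_abs_self _) ?_ (by positivity) (abs_nonneg _)
    have := nX j k
    nlinarith [norm_nonneg (dt (x j) (x k))]

section ring
variable {O : Type} [CommRing O] {ι : O →+* ℂ}
variable (H : QRing O ι) (φ : PSL2 O ≃* PSL2 O)
include H

lemma Wr_cross {p y : O × O} {w z : ℂ × ℂ} (hp : p ≠ 0) (hy : y ≠ 0) (hw : Wr ι φ p w) (hz : Wr ι φ.symm y z) :
    dt w (ve ι y) = 0 ↔ dt (ve ι p) z = 0 := by
  rw [← H.par_comm hw (H.par_ve hy), ← H.par_comm (H.par_ve hp) hz]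
  conv_rhs => rw [← φ.apply_eq_iff_eq]
  simp only [map_mul, MulEquiv.apply_symm_apply]

lemma QRing.full {C0 : ℝ} (hC0 : 1 ≤ C0)
    (hmin : ∀ y : O × O, y ≠ 0 → ∃ v, ∃ μ : ℂ, ve ι v = μ • ve ι y ∧ μ ≠ 0 ∧ ‖μ‖ ≤ 1 ∧ Mn ι C0 v)
    (w : {v // Mn ι C0 v} → ℂ × ℂ) (hw : ∀ i, Wr ι φ i.1 (w i)) :
    ∃ C, FullSys (fun i : {v // Mn ι C0 v} => ve ι i.1) w C := by
  obtain ⟨K, hK1, hK⟩ := H.unif_good φ C0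
  obtain ⟨K2, hK21, hK2⟩ := H.unif_good φ.symm (max K C0)
  have v0 : ∀ i : {v // Mn ι C0 v}, i.1 ≠ 0 := fun i => Mn_ne i.2
  set L := max (max K K2) C0 with hL
  have hL1 : 1 ≤ L := hC0.trans (le_max_right _ _)
  have hKL : K ≤ L := (le_max_left _ _).trans (le_max_left _ _)
  have hK2L : K2 ≤ L := (le_max_right _ _).trans (le_max_left _ _)
  have hCL : C0 ≤ L := le_max_right _ _
  have hLL : L ≤ L ^ 3 := by nlinarith [mul_self_nonneg (L - 1)]
  have gw : ∀ i, good ι L (w i) := fun i => good_mono hKL (hK _ i.2 _ (hw i))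
  have gv : ∀ i : {v // Mn ι C0 v}, good ι L (ve ι i.1) := fun i => good_mono hCL (good_ve hC0 i.2)
  have hmin' : ∀ y : O × O, y ≠ 0 → ∃ i : {v // Mn ι C0 v}, ∃ μ : ℂ, ve ι i.1 = μ • ve ι y ∧ μ ≠ 0 ∧ ‖μ‖ ≤ 1 := by
    intro y hy
    obtain ⟨v, μ, h1, h2, h3, h4⟩ := hmin y hy
    exact ⟨⟨v, h4⟩, μ, h1, h2, h3⟩
  obtain ⟨C', hC', hside⟩ := H.side (L ^ 3) (hL1.trans hLL)
  have J1 : JointSys (fun i : {v // Mn ι C0 v} => ve ι i.1) w := H.halfJ φ _ w v0 hw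
  have J2 : JointSys w (fun i : {v // Mn ι C0 v} => ve ι i.1) := by
    have hg : ∀ i, good ι K (w i) := fun i => hK _ i.2 _ (hw i)
    choose s p u h1 h2 h3 h4 h5 using hg
    have hp0 : ∀ i, p i ≠ 0 := fun i => dO_ne_left (h4 i)
    choose z hz using fun i => H.lemmaA φ.symm (hp0 i)
    have gz : ∀ i, good ι L (z i) := fun i =>
      good_mono hK2L (hK2 _ (Mn_mono ⟨u i, h4 i, h5 i⟩ (le_max_left _ _)) _ (hz i))
    have hpar : ∀ i, dt (z i) (ve ι i.1) = 0 := fun i => by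
      rw [dt_swap, (Wr_cross H φ (v0 i) (hp0 i) (hw i) (hz i)).1, neg_zero]
      rw [← h3, dt_smul_right, dt_self, mul_zero]
    choose c hc1 hc2 hc3 using fun i => H.good_par hL1 (gz i) (gv i) (hpar i)
    exact joint_scale (H.halfJ φ.symm p z hp0 hz) (hL1.trans hLL) s c (fun i => (h3 i).symm)
      (fun i => good_sne (h2 i)) (fun i => (h1 i).trans (hKL.trans hLL)) hc1 hc3
  refine ⟨C', (hL1.trans hLL).trans hC', hside _ _ ?_ ?_ fun i => good_mono hLL (gv i),
    hside _ _ ?_ ?_ fun i => good_mono hLL (gw i), J1, J2⟩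
  · exact fun i j hij => H.par_V1 (H.par_ve (v0 i)) (H.par_ve (v0 j)) hij
  · intro y hy
    obtain ⟨i, μ, h1, h2, h3⟩ := hmin' y hy
    exact ⟨i, μ, h1, h2, h3.trans (hL1.trans hLL)⟩
  · exact fun i j hij => H.par_V1 (hw i) (hw j) hij
  · intro y hy
    obtain ⟨y1, μ, h1, h2, h3⟩ := hmin' y hy
    obtain ⟨z, hz⟩ := H.lemmaA φ.symm (v0 y1)
    obtain ⟨s, p, u, g1, g2, g3, g4, g5⟩ := hK2 _ (Mn_mono y1.2 (le_max_right _ _)) z hz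
    obtain ⟨i, ν, k1, k2, k3⟩ := hmin' p (dO_ne_left g4)
    have hd : dt (ve ι y1.1) (w i) = 0 := by
      rw [dt_swap, (Wr_cross H φ (v0 i) (v0 y1) (hw i) hz).2, neg_zero]
      rw [k1, ← g3, dt_smul_left, dt_smul_left, dt_self, mul_zero, mul_zero]
    obtain ⟨c, c1, c2, c3⟩ := H.good_par hL1 (gv y1) (gw i) hd
    refine ⟨i, c * μ, by rw [c1, h1, smul_smul], mul_ne_zero c2 h2, ?_⟩
    rw [norm_mul]
    calc ‖c‖ * ‖μ‖ ≤ L ^ 3 * 1 := by gcongr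
      _ = L ^ 3 := mul_one _

end ring

lemma zc_ac (A : SL2 ℂ) (p y x : ℂ × ℂ) : zc (ac A p) (ac A y) (ac A x) = zc p y x := by
  rw [zc, zc, dt_ac, dt_ac]
lemma zc_neg (p y x : ℂ × ℂ) : zc p y (-x) = zc p y x := by
  rw [zc, zc, dt_neg_left, dt_neg_right, neg_div_neg_eq]
lemma zc_negneg (p y x : ℂ × ℂ) : zc (-p) (-y) x = zc p y x := by
  rw [zc, zc, dt_neg_left, dt_neg_right, neg_div_neg_eq]
lemma zc_Pg {p y x : ℂ × ℂ} (t : ℂ) (h : dt p y = 1) (hx : dt p x ≠ 0) :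
    zc p y (ac (Pg p t) x) = zc p y x + t := by
  rw [zc, zc, ac_Pg', dt_add_left, dt_smul_left, dt_add_right, dt_smul_right, dt_self, h, mul_zero, add_zero]
  field_simp
lemma dt_Pg (p x : ℂ × ℂ) (t : ℂ) : dt p (ac (Pg p t) x) = dt p x := by
  rw [ac_Pg', dt_add_right, dt_smul_right, dt_self, mul_zero, add_zero]

section ring
variable {O : Type} [CommRing O] {ι : O →+* ℂ}
variable (H : QRing O ι) (φ : PSL2 O ≃* PSL2 O)
include H

lemma QRing.rigid : ∃ C0 : ℝ, 1 ≤ C0 ∧ ∃ w : {v // Mn ι C0 v} → ℂ × ℂ, (∀ i, Wr ι φ i.1 (w i)) ∧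
    ∃ (k : {v // Mn ι C0 v}) (y y' : ℂ × ℂ), dt (ve ι k.1) y = 1 ∧ dt (w k) y' = 1 ∧ ∃ a b : ℂ, a ≠ 0 ∧
      ((∀ i : {v // Mn ι C0 v}, dt (ve ι k.1) (ve ι i.1) ≠ 0 →
          zc (w k) y' (w i) = a * zc (ve ι k.1) y (ve ι i.1) + b) ∨
       (∀ i : {v // Mn ι C0 v}, dt (ve ι k.1) (ve ι i.1) ≠ 0 →
          zc (w k) y' (w i) = a * (starRingEnd ℂ) (zc (ve ι k.1) y (ve ι i.1)) + b)) := by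
  have := H.dom
  have := H.ctbl
  obtain ⟨C0, hC0, hmin⟩ := H.exists_min
  choose w hw using fun i : {v // Mn ι C0 v} => H.lemmaA φ (Mn_ne i.2)
  refine ⟨C0, hC0, w, hw, ?_⟩
  obtain ⟨C, hF⟩ := H.full φ hC0 hmin w hw
  obtain ⟨o, -, -, -, -, ho⟩ := hmin (1, 0) (by simp)
  obtain ⟨T, hTf, hT1, hT2⟩ := H.fin_orb C0
  have : Finite T := hTf
  obtain ⟨m, ⟨e⟩⟩ := Finite.exists_equiv_fin T
  obtain ⟨δ, r, hr, hcov, -, -⟩ := H.cover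
  let act : SL2 O → {v // Mn ι C0 v} → {v // Mn ι C0 v} := fun γ i => ⟨ac γ i.1, Mn_ac γ i.2⟩
  have act1 : ∀ γ i, ve ι (act γ i).1 = ac (mp ι γ) (ve ι i.1) := fun γ i => ve_ac _ _
  have act2 : ∀ γ Γ i, pm Γ = φ (pm γ) → w (act γ i) = ac (mp ι Γ) (w i) ∨ w (act γ i) = - ac (mp ι Γ) (w i) :=
    fun γ Γ i h => H.par_unique (hw (act γ i)) (W_ac (hw i) h)
  let R : Fin m → {v // Mn ι C0 v} := fun ρ => ⟨(e.symm ρ).1.1, (e.symm ρ).1.2, hT1 _ (e.symm ρ).2⟩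
  choose ur hur using fun ρ => exists_dual (H.vec_ne (Mn_ne (R ρ).2))
  choose ur' hur' using fun ρ => exists_dual (hw (R ρ)).1
  refine rigidity hF ⟨o, ho⟩ R ur ur' hur hur' r ?_ ?_
  · intro k
    obtain ⟨u0, hu1, hu2⟩ := k.2
    obtain ⟨t, ht, γ, hγ1, hγ2⟩ := hT2 _ _ hu1 hu2
    obtain ⟨ρ, hρ⟩ : ∃ ρ, (R ρ).1 = t.1 := ⟨e ⟨t, ht⟩, by simp [R]⟩
    obtain ⟨s, hs⟩ : ∃ s : O, ‖zc (ve ι (R ρ).1) (ur ρ) (ve ι (ac γ⁻¹ o)) - ι s‖ ≤ r := by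
      obtain ⟨m, n, h⟩ := hcov (zc (ve ι (R ρ).1) (ur ρ) (ve ι (ac γ⁻¹ o)))
      exact ⟨_, h⟩
    obtain ⟨γ', hγ'⟩ : ∃ γ', γ' = γ * Pg (R ρ).1 s := ⟨_, rfl⟩
    obtain ⟨Γ, hΓ⟩ := pm_surj (φ (pm γ'))
    have hk : act γ' (R ρ) = k := by
      apply Subtype.ext
      change ac γ' (R ρ).1 = k.1
      rw [hγ', ac_mul, ac_Pg, ← hγ1, hρ]
      congr 1
      have : t.1.1 * t.1.2 - t.1.2 * t.1.1 = 0 := by ring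
      rw [this, mul_zero, zero_smul, add_zero]
    have hvk : ve ι k.1 = ac (mp ι γ') (ve ι (R ρ).1) := by rw [← act1, hk]
    obtain ⟨u', hu', hzw⟩ : ∃ u', dt (w k) u' = 1 ∧ ∀ x, zc (w k) u' (ac (mp ι Γ) x) = zc (w (R ρ)) (ur' ρ) x := by
      rcases act2 γ' Γ (R ρ) hΓ with h | h
      · rw [hk] at h
        exact ⟨ac (mp ι Γ) (ur' ρ), by rw [h, dt_ac, hur'], fun x => by rw [h, zc_ac]⟩
      · rw [hk] at h
        exact ⟨-ac (mp ι Γ) (ur' ρ), by rw [h, dt_neg_left, dt_neg_right, dt_ac, hur', neg_neg],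
          fun x => by rw [h, zc_negneg, zc_ac]⟩
    refine ⟨ρ, ac (mp ι γ') (ur ρ), u', ?_, hu', ?_, ?_⟩
    · rw [hvk, dt_ac, hur]
    · have e1 : ve ι o = ac (mp ι γ') (ac (Pg (ve ι (R ρ).1) (-ι s)) (ve ι (ac γ⁻¹ o))) := by
        rw [hγ', map_mul, mp_Pg, ac_mul, ← ac_mul (Pg _ _), ← Pg_add, add_neg_cancel, Pg_zero, ac_one, ← ve_ac,
          ac_ac_inv]
      change ‖zc (ve ι k.1) _ (ve ι o)‖ ≤ r
      rw [e1, hvk, zc_ac]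
      by_cases hd : dt (ve ι (R ρ).1) (ve ι (ac γ⁻¹ o)) = 0
      · rw [zc, dt_Pg, hd, div_zero, norm_zero]; linarith
      · rw [zc_Pg _ (hur ρ) hd, ← sub_eq_add_neg]; exact hs
    · intro i hi
      have hij : act γ' (act γ'⁻¹ i) = i := Subtype.ext (ac_ac_inv _ _)
      have hvi : ve ι i.1 = ac (mp ι γ') (ve ι (act γ'⁻¹ i).1) := by rw [← act1, hij]
      refine ⟨act γ'⁻¹ i, ?_, ?_, ?_⟩
      · rwa [hvk, hvi, dt_ac] at hi
      · rw [hvk, hvi, zc_ac]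
      · rcases act2 γ' Γ (act γ'⁻¹ i) hΓ with h | h
        · rw [hij] at h; rw [h, hzw]
        · rw [hij] at h; rw [h, zc_neg, hzw]
  · intro ρ
    refine ⟨1, fun i hi => ⟨act (Pg (R ρ).1 1) i, ?_⟩⟩
    obtain ⟨h0, X, hX1, hX2⟩ := hw (R ρ)
    rw [act1, mp_Pg, map_one]
    refine ⟨by rwa [dt_Pg], zc_Pg _ (hur ρ) hi, ?_⟩
    have hi' : dt (w (R ρ)) (w i) ≠ 0 := fun h => hi ((H.W_dt φ (Mn_ne (R ρ).2) (Mn_ne i.2) (hw _) (hw _)).2 h)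
    rcases act2 _ X i hX1 with h | h
    · rw [h, hX2, zc_Pg _ (hur' ρ) hi']
    · rw [h, zc_neg, hX2, zc_Pg _ (hur' ρ) hi']

end ring

lemma exists_sl {V Y P Q : ℂ × ℂ} (h1 : dt V Y = 1) (h2 : dt P Q = 1) :
    ∃ g : SL2 ℂ, ∀ x, ac g x = dt x Y • P + dt V x • Q := by
  refine ⟨⟨!![Y.2 * P.1 - V.2 * Q.1, -Y.1 * P.1 + V.1 * Q.1; Y.2 * P.2 - V.2 * Q.2, -Y.1 * P.2 + V.1 * Q.2], ?_⟩, ?_⟩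
  · rw [Matrix.det_fin_two_of]
    simp only [dt] at h1 h2
    linear_combination h1 * (P.1 * Q.2 - P.2 * Q.1) + h2
  · intro x
    ext <;> simp [ac, dt] <;> ring

lemma zc_star (s : ℂ →+* ℂ) (p y x : ℂ × ℂ) : s (zc p y x) = zc (ve s p) (ve s y) (ve s x) := by
  simp only [zc, dt, ve, map_div₀, map_sub, map_mul]

lemma dt_star (s : ℂ →+* ℂ) (p x : ℂ × ℂ) : dt (ve s p) (ve s x) = s (dt p x) := by
  simp only [dt, ve, map_sub, map_mul]

section ring
variable {O : Type} [CommRing O] {ι : O →+* ℂ}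
variable (H : QRing O ι) (φ : PSL2 O ≃* PSL2 O)
include H

lemma QRing.geo : ∃ s : ℂ →+* ℂ, (s = RingHom.id ℂ ∨ s = starRingEnd ℂ) ∧ ∃ g : SL2 ℂ,
    ∀ v w, Mn ι 1 v → Wr ι φ v w → dt w (ac g (ve s (ve ι v))) = 0 := by
  obtain ⟨C0, hC0, w, hw, k, y, y', hy, hy', a, b, ha, h⟩ := H.rigid φ
  obtain ⟨s, hs, h⟩ : ∃ s : ℂ →+* ℂ, (s = RingHom.id ℂ ∨ s = starRingEnd ℂ) ∧
      ∀ i : {v // Mn ι C0 v}, dt (ve ι k.1) (ve ι i.1) ≠ 0 →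
          zc (w k) y' (w i) = a * s (zc (ve ι k.1) y (ve ι i.1)) + b := by
    rcases h with h | h
    · exact ⟨_, Or.inl rfl, h⟩
    · exact ⟨_, Or.inr rfl, h⟩
  refine ⟨s, hs, ?_⟩
  obtain ⟨l, hl⟩ := IsAlgClosed.exists_pow_nat_eq a⁻¹ (n := 2) (by norm_num)
  have hVY : dt (ve s (ve ι k.1)) (ve s y) = 1 := by rw [dt_star, hy, map_one]
  obtain ⟨g, hg⟩ := exists_sl (P := (l * a) • w k) (Q := l • (b • w k + y')) hVY (by
    rw [dt_smul_left, dt_smul_right, dt_add_right, dt_smul_right, dt_self, hy', mul_zero, zero_add, mul_one]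
    rw [mul_right_comm, ← pow_two, hl, inv_mul_cancel₀ ha])
  refine ⟨g, fun v w' hv hw' => ?_⟩
  let i : {v // Mn ι C0 v} := ⟨v, Mn_mono hv hC0⟩
  have key : dt (w i) (ac g (ve s (ve ι v))) = 0 := by
    rw [hg, dt_add_right, dt_smul_right, dt_smul_right, dt_smul_right, dt_smul_right, dt_add_right,
      dt_smul_right, dt_swap (w i) (w k)]
    by_cases hd : dt (ve ι k.1) (ve ι v) = 0
    · have := (H.W_dt φ (Mn_ne k.2) (Mn_ne i.2) (hw k) (hw i)).1 hd
      rw [this, dt_star s (ve ι k.1), hd]; simp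
    · have h1 := h i hd
      have hd' : dt (w k) (w i) ≠ 0 := fun h0 => hd ((H.W_dt φ (Mn_ne k.2) (Mn_ne i.2) (hw k) (hw i)).2 h0)
      have hd2 : dt (ve s (ve ι k.1)) (ve s (ve ι v)) ≠ 0 := by
        rw [dt_star]; exact (map_ne_zero s).2 hd
      rw [zc_star, zc, zc] at h1
      change dt (w i) y' / dt (w k) (w i) = a * (dt (ve s (ve ι v)) _ / dt _ (ve s (ve ι v))) + b at h1
      field_simp at h1
      linear_combination l * h1
  rcases H.par_unique hw' (hw i) with h0 | h0
  · rw [h0, key]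
  · rw [h0, dt_neg_left, key, neg_zero]

lemma lines_pm {B : SL2 ℂ} (h1 : dt (ac B (1, 0)) (1, 0) = 0) (h2 : dt (ac B (0, 1)) (0, 1) = 0)
    (h3 : dt (ac B (1, 1)) (1, 1) = 0) : B = 1 ∨ B = -1 := by
  have := sl_det B
  simp only [dt, ac] at h1 h2 h3
  ring_nf at h1 h2 h3
  have e10 : B 1 0 = 0 := by linear_combination -h1
  have e01 : B 0 1 = 0 := by linear_combination h2
  have e : B 0 0 = B 1 1 := by linear_combination h3 - e01 + e10
  rw [e01, e, zero_mul, sub_zero, mul_self_eq_one_iff] at this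
  rcases this with h | h
  · left; apply sl_ext <;> simp [e10, e01, e, h]
  · right; apply sl_ext <;> simp [sl_neg, e10, e01, e, h]

lemma QRing.conjg : ∃ s : ℂ →+* ℂ, (s = RingHom.id ℂ ∨ s = starRingEnd ℂ) ∧ ∃ g : SL2 ℂ,
    ∀ γ Γ : SL2 O, pm Γ = φ (pm γ) → mp ι Γ = g * mp s (mp ι γ) * g⁻¹ ∨ mp ι Γ = -(g * mp s (mp ι γ) * g⁻¹) := by
  have := H.dom
  obtain ⟨s, hs, g, hg⟩ := H.geo φ
  refine ⟨s, hs, g, fun γ Γ hΓ => ?_⟩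
  have key : ∀ v : O × O, Mn ι 1 v →
      dt (ac (g⁻¹ * mp ι Γ * g * (mp s (mp ι γ))⁻¹) (ve s (ve ι v))) (ve s (ve ι v)) = 0 := by
    intro v hv
    have hu : Mn ι 1 (ac γ⁻¹ v) := Mn_ac _ hv
    obtain ⟨w, hw⟩ := H.lemmaA φ (Mn_ne hu)
    have hw' := W_ac hw hΓ
    rw [ac_ac_inv] at hw'
    have a1 := hg _ _ hu hw
    have a2 := hg _ _ hv hw'
    obtain ⟨c, hc⟩ := dt_eq_zero_smul hw.1 a1
    rw [ac_mul, ac_mul, ac_mul, ← map_inv, ← map_inv, ← ve_ac, ← ve_ac, hc, ac_smul, ac_smul, dt_smul_left]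
    rw [← dt_ac g, ac_ac_inv, a2, mul_zero]
  have n1 : (1 : O) ≠ 0 := one_ne_zero
  have m1 := key (1, 0) ⟨(0, 1), by simp [dO], by simp [dO]⟩
  have m2 := key (0, 1) ⟨(1, 0), by simp [dO], by simp [dO]⟩
  have m3 := key (1, 1) ⟨(0, 1), by simp [dO], by simp [dO]⟩
  simp only [ve, map_one, map_zero] at m1 m2 m3
  rcases lines_pm H m1 m2 m3 with h | h
  · left
    rw [mul_inv_eq_one] at h
    rw [← h]; group
  · right
    rw [mul_inv_eq_iff_eq_mul] at h
    have : mp ι Γ = g * (g⁻¹ * mp ι Γ * g) * g⁻¹ := by group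
    rw [this, h]; simp

end ring

section ring
variable {O : Type} [CommRing O] {ι : O →+* ℂ}
variable (H : QRing O ι) (φ : PSL2 O ≃* PSL2 O)
include H

lemma QRing.par_g {s : ℂ →+* ℂ} {g : SL2 ℂ}
    (hg : ∀ γ Γ : SL2 O, pm Γ = φ (pm γ) →
      mp ι Γ = g * mp s (mp ι γ) * g⁻¹ ∨ mp ι Γ = -(g * mp s (mp ι γ) * g⁻¹)) {v : O × O} (hv : v ≠ 0) :
    Par ι (φ (pm (Pg v 1))) (ac g (ve s (ve ι v))) := by
  have h0 : ac g (ve s (ve ι v)) ≠ 0 := by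
    apply ac_ne_zero
    intro h
    apply H.vec_ne hv
    simp only [ve, Prod.mk_eq_zero, map_eq_zero] at h
    exact Prod.ext h.1 h.2
  have e : g * mp s (mp ι (Pg v 1)) * g⁻¹ = Pg (ac g (ve s (ve ι v))) 1 := by
    rw [mp_Pg, mp_Pg, Pg_conj, map_one, map_one]
  obtain ⟨Γ, hΓ⟩ := pm_surj (φ (pm (Pg v 1)))
  rcases hg _ _ hΓ with h | h
  · exact ⟨h0, Γ, hΓ, by rw [h, e]⟩
  · exact ⟨h0, -Γ, by rw [H.pm_neg, hΓ], by rw [mp_neg, h, e, neg_neg]⟩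

lemma QRing.prod_g {s : ℂ →+* ℂ} {g : SL2 ℂ}
    (hg : ∀ γ Γ : SL2 O, pm Γ = φ (pm γ) →
      mp ι Γ = g * mp s (mp ι γ) * g⁻¹ ∨ mp ι Γ = -(g * mp s (mp ι γ) * g⁻¹)) :
    ∀ i j k l, ∃ c, ι c = g i j * g k l := by
  have := H.dom
  obtain ⟨⟨a1, h1⟩, ⟨a2, h2⟩, ⟨a3, h3⟩⟩ := par_sq (H.par_g φ hg (v := (1, 0)) (by simp))
  obtain ⟨⟨b1, k1⟩, ⟨b2, k2⟩, ⟨b3, k3⟩⟩ := par_sq (H.par_g φ hg (v := (0, 1)) (by simp))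
  obtain ⟨⟨c1, l1⟩, ⟨c2, l2⟩, ⟨c3, l3⟩⟩ := par_sq (H.par_g φ hg (v := (1, 1)) (by simp))
  have hd := sl_det g
  simp only [ac, ve, map_one, map_zero, mul_one, mul_zero, add_zero, zero_add] at h1 h2 h3 k1 k2 k3 l1 l2 l3
  have sq : ∀ i j, ∃ a, ι a = g i j ^ 2 := by
    intro i j
    fin_cases i <;> fin_cases j
    · exact ⟨a1, by simp only [h1]; simp [pow_two]⟩
    · exact ⟨b1, by simp only [k1]; simp [pow_two]⟩
    · exact ⟨a3, by simp only [h3]; simp [pow_two]⟩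
    · exact ⟨b3, by simp only [k3]; simp [pow_two]⟩
  have two : ∀ i j k l, ∃ b, ι b = ι 2 * (g i j * g k l) := by
    have f1 : ι (2 * a1) = ι 2 * (g 0 0 * g 0 0) := by rw [map_mul, h1]
    have f2 : ι (2 * a2) = ι 2 * (g 0 0 * g 1 0) := by rw [map_mul, h2]
    have f3 : ι (2 * a3) = ι 2 * (g 1 0 * g 1 0) := by rw [map_mul, h3]
    have f4 : ι (2 * b1) = ι 2 * (g 0 1 * g 0 1) := by rw [map_mul, k1]
    have f5 : ι (2 * b2) = ι 2 * (g 0 1 * g 1 1) := by rw [map_mul, k2]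
    have f6 : ι (2 * b3) = ι 2 * (g 1 1 * g 1 1) := by rw [map_mul, k3]
    have f7 : ι (c1 - a1 - b1) = ι 2 * (g 0 0 * g 0 1) := by
      simp only [map_sub, l1, h1, k1, map_ofNat]; ring
    have f8 : ι (c3 - a3 - b3) = ι 2 * (g 1 0 * g 1 1) := by
      simp only [map_sub, l3, h3, k3, map_ofNat]; ring
    have f9 : ι (c2 - a2 - b2 + 1) = ι 2 * (g 0 0 * g 1 1) := by
      simp only [map_sub, map_add, l2, h2, k2, map_ofNat, map_one]; linear_combination -hd
    have f10 : ι (c2 - a2 - b2 - 1) = ι 2 * (g 0 1 * g 1 0) := by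
      simp only [map_sub, map_add, l2, h2, k2, map_ofNat, map_one]; linear_combination hd
    intro i j k l
    fin_cases i <;> fin_cases j <;> fin_cases k <;> fin_cases l <;>
      first
      | exact ⟨_, f1⟩ | exact ⟨_, f2⟩ | exact ⟨_, f3⟩ | exact ⟨_, f4⟩ | exact ⟨_, f5⟩ | exact ⟨_, f6⟩
      | exact ⟨_, f7⟩ | exact ⟨_, f8⟩ | exact ⟨_, f9⟩ | exact ⟨_, f10⟩
      | exact ⟨_, f2.trans (congrArg _ (mul_comm _ _))⟩ | exact ⟨_, f5.trans (congrArg _ (mul_comm _ _))⟩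
      | exact ⟨_, f7.trans (congrArg _ (mul_comm _ _))⟩ | exact ⟨_, f8.trans (congrArg _ (mul_comm _ _))⟩
      | exact ⟨_, f9.trans (congrArg _ (mul_comm _ _))⟩ | exact ⟨_, f10.trans (congrArg _ (mul_comm _ _))⟩
  intro i j k l
  refine H.closed _ 2 ?_ ?_ (two i j k l)
  · intro h
    have := congrArg ι h
    rw [map_ofNat ι 2, map_zero] at this
    exact two_ne_zero this
  · obtain ⟨a, ha⟩ := sq i j
    obtain ⟨b, hb⟩ := sq k l
    exact ⟨a * b, by rw [map_mul, ha, hb]; ring⟩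

lemma QRing.prod_conj {g : SL2 ℂ} (hp : ∀ i j k l, ∃ c, ι c = g i j * g k l) :
    ∀ i j k l, ∃ c, ι c = g i j * starRingEnd ℂ (g k l) := by
  obtain ⟨c, hc⟩ := H.conj
  obtain ⟨i0, j0, h0⟩ : ∃ i j, g i j ≠ 0 := by
    by_contra! h
    have := sl_det g
    simp [h] at this
  choose P hP using hp
  have hP0 : P i0 j0 i0 j0 ≠ 0 := by
    intro h
    have := hP i0 j0 i0 j0
    rw [h, map_zero] at this
    exact mul_ne_zero h0 h0 this.symm
  obtain ⟨n, hn⟩ := H.sqn (Ideal.span {P i0 j0 0 0, P i0 j0 0 1, P i0 j0 1 0, P i0 j0 1 1}) (P i0 j0 i0 j0) (by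
    have hmem : ∀ i j, P i0 j0 i j ∈ ({P i0 j0 0 0, P i0 j0 0 1, P i0 j0 1 0, P i0 j0 1 1} : Set O) := by
      intro i j; fin_cases i <;> fin_cases j <;> simp
    apply le_antisymm
    · rw [Ideal.span_mul_span', Ideal.span_le]
      rintro _ ⟨x, hx, y, hy, rfl⟩
      have hx' : ∃ i j, x = P i0 j0 i j := by
        simp only [Set.mem_insert_iff, Set.mem_singleton_iff] at hx
        rcases hx with h | h | h | h <;> exact ⟨_, _, h⟩
      have hy' : ∃ i j, y = P i0 j0 i j := by
        simp only [Set.mem_insert_iff, Set.mem_singleton_iff] at hy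
        rcases hy with h | h | h | h <;> exact ⟨_, _, h⟩
      obtain ⟨i, j, rfl⟩ := hx'
      obtain ⟨k, l, rfl⟩ := hy'
      rw [SetLike.mem_coe, Ideal.mem_span_singleton]
      refine ⟨P i j k l, H.inj ?_⟩
      simp only [map_mul, hP]; ring
    · rw [Ideal.span_singleton_le_iff_mem]
      have : P i0 j0 i0 j0 = P i0 j0 0 0 * P i0 j0 1 1 - P i0 j0 0 1 * P i0 j0 1 0 := by
        apply H.inj
        simp only [map_sub, map_mul, hP]
        linear_combination -(g i0 j0 * g i0 j0) * sl_det g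
      rw [this]
      exact Ideal.sub_mem _ (Ideal.mul_mem_mul (Ideal.subset_span (hmem _ _)) (Ideal.subset_span (hmem _ _)))
        (Ideal.mul_mem_mul (Ideal.subset_span (hmem _ _)) (Ideal.subset_span (hmem _ _))))
  have hn2 : (n : ℂ) = g i0 j0 * starRingEnd ℂ (g i0 j0) := by
    rw [hP, norm_mul, ← pow_two] at hn
    rw [Complex.mul_conj, Complex.normSq_eq_norm_sq, hn]; simp
  intro i j k l
  refine H.closed _ (n : O) ?_ ⟨P i j i j * c (P k l k l), ?_⟩ ⟨P i0 j0 i j * c (P i0 j0 k l), ?_⟩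
  · intro h
    have := congrArg ι h
    rw [map_natCast, hn2, map_zero] at this
    exact mul_ne_zero h0 ((map_ne_zero _).2 h0) this
  · rw [map_mul, hc, hP, hP, map_mul]; ring
  · rw [map_mul, hc, hP, hP, map_natCast, hn2, map_mul]; ring

theorem QRing.main : ∃ g, ∀ x, φ (φ x) = g * x * g⁻¹ := by
  obtain ⟨s, hs, g, hg⟩ := H.conjg φ
  have hp := H.prod_g φ hg
  have hps : ∀ i j k l, ∃ c, ι c = g i j * s (g k l) := by
    rcases hs with rfl | rfl
    · exact hp
    · exact H.prod_conj hp
  have hss : ∀ A : SL2 ℂ, mp s (mp s A) = A := by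
    intro A
    apply sl_ext <;> rcases hs with rfl | rfl <;> simp [mp_ap]
  choose P hP using hps
  obtain ⟨X, hX⟩ : ∃ X : SL2 O, mp ι X = g * mp s g := by
    have hent : ∀ i j, ι (P i 0 0 j + P i 1 1 j) = (g * mp s g) i j := by
      intro i j
      rw [sl_mul, map_add, hP, hP]; rfl
    refine ⟨⟨!![P 0 0 0 0 + P 0 1 1 0, P 0 0 0 1 + P 0 1 1 1; P 1 0 0 0 + P 1 1 1 0, P 1 0 0 1 + P 1 1 1 1], ?_⟩, ?_⟩
    · apply H.inj
      rw [Matrix.det_fin_two_of, map_sub, map_mul, map_mul, hent, hent, hent, hent, sl_det, map_one]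
    · exact sl_ext (hent _ _) (hent _ _) (hent _ _) (hent _ _)
  refine ⟨pm X, fun x => ?_⟩
  obtain ⟨γ, rfl⟩ := pm_surj x
  obtain ⟨Γ, hΓ⟩ := pm_surj (φ (pm γ))
  obtain ⟨Γ', hΓ'⟩ := pm_surj (φ (pm Γ))
  have neg_mp : ∀ A : SL2 ℂ, mp s (-A) = - mp s A := fun A => mp_neg A
  have e : g * mp s (g * mp s (mp ι γ) * g⁻¹) * g⁻¹ = mp ι (X * γ * X⁻¹) := by
    rw [map_mul, map_mul, hss, map_mul, map_mul, map_inv, map_inv, hX]; group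
  have key : Γ' = X * γ * X⁻¹ ∨ Γ' = -(X * γ * X⁻¹) := by
    rcases hg _ _ hΓ with h | h <;> rcases hg _ _ hΓ' with h' | h' <;> rw [h] at h'
    · left; apply H.mp_inj; rw [h', e]
    · right; apply H.mp_inj; rw [h', mp_neg, e]
    · right; apply H.mp_inj; rw [h', neg_mp, mp_neg, ← e]; simp
    · left; apply H.mp_inj; rw [h', ← e, neg_mp]; simp
  rw [← hΓ, ← hΓ', H.pm_eq.2 key, map_mul, map_mul, map_inv]

end ring

section quad
variable (d : ℕ)

noncomputable def al : ℂ := Complex.I * (Real.sqrt d : ℂ)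

lemma al_sq : al d * al d = -(d : ℂ) := by
  have h : ((Real.sqrt d : ℝ) : ℂ) * (Real.sqrt d : ℝ) = d := by
    rw [← Complex.ofReal_mul, Real.mul_self_sqrt (Nat.cast_nonneg d)]; simp
  rw [al]; linear_combination (Complex.I * Complex.I) * h + (d : ℂ) * Complex.I_mul_I

lemma al_conj : starRingEnd ℂ (al d) = - al d := by simp [al]

lemma al_mem : al d ∈ Qd d := IntermediateField.mem_adjoin_simple_self ℚ _

lemma al_int : IsIntegral ℤ (al d) := by
  refine IsIntegral.of_pow (n := 2) (by norm_num) ?_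
  rw [pow_two, al_sq]
  exact (isIntegral_algebraMap (R := ℤ) (A := ℂ) (x := (d : ℤ))).neg |> fun h => by simpa using h

lemma Qd_form {x : ℂ} (hx : x ∈ Qd d) : ∃ p q : ℚ, x = p + q * al d := by
  refine IntermediateField.adjoin_induction (F := ℚ) (p := fun x _ => ∃ p q : ℚ, x = p + q * al d) ?_ ?_ ?_ ?_ ?_ hx
  · intro x hx
    exact ⟨0, 1, by rw [Set.mem_singleton_iff.1 hx]; simp [al]⟩
  · intro x; exact ⟨x, 0, by simp⟩
  · rintro x y - - ⟨p, q, rfl⟩ ⟨p', q', rfl⟩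
    exact ⟨p + p', q + q', by push_cast; ring⟩
  · rintro x - ⟨p, q, rfl⟩
    by_cases h : (p : ℂ) + q * al d = 0
    · exact ⟨0, 0, by rw [h]; simp⟩
    have h' : (p : ℂ) - q * al d ≠ 0 := by
      have := (map_ne_zero (starRingEnd ℂ)).2 h
      simpa [al_conj, ← sub_eq_add_neg] using this
    have e : ((p : ℂ) ^ 2 + d * q ^ 2) = (p + q * al d) * (p - q * al d) := by
      linear_combination (q : ℂ) ^ 2 * al_sq d
    refine ⟨p / (p ^ 2 + d * q ^ 2), -q / (p ^ 2 + d * q ^ 2), ?_⟩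
    push_cast
    rw [e]
    field_simp
    ring
  · rintro x y - - ⟨p, q, rfl⟩ ⟨p', q', rfl⟩
    exact ⟨p * p' - d * q * q', p * q' + q * p', by push_cast; linear_combination (q * q' : ℂ) * al_sq d⟩

lemma rat_int {r : ℚ} (h : IsIntegral ℤ (r : ℂ)) : ∃ n : ℤ, (n : ℂ) = r := by
  have h' : IsIntegral ℤ r := by
    have : IsIntegral ℤ (algebraMap ℚ ℂ r) := by simpa using h
    exact (isIntegral_algebraMap_iff (algebraMap ℚ ℂ).injective).1 this
  obtain ⟨n, hn⟩ := IsIntegrallyClosed.isIntegral_iff.1 h'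
  refine ⟨n, ?_⟩
  rw [← hn]; simp

noncomputable def io : Od d →+* ℂ := (algebraMap (Qd d) ℂ).comp (algebraMap (Od d) (Qd d))

lemma io_inj : Function.Injective (io d) :=
  (algebraMap (Qd d) ℂ).injective.comp NumberField.RingOfIntegers.coe_injective

lemma io_mem (x : Od d) : io d x ∈ Qd d := ((x : Qd d)).2

lemma io_int (x : Od d) : IsIntegral ℤ (io d x) :=
  (NumberField.RingOfIntegers.isIntegral_coe x).map (IsScalarTower.toAlgHom ℤ (Qd d) ℂ)

lemma io_mk {z : ℂ} (h : z ∈ Qd d) (hz : IsIntegral ℤ z) : ∃ c, io d c = z := by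
  have h' : IsIntegral ℤ (⟨z, h⟩ : Qd d) :=
    (isIntegral_algebraMap_iff (A := Qd d) (B := ℂ) (algebraMap (Qd d) ℂ).injective).1 hz
  exact ⟨⟨⟨z, h⟩, h'⟩, rfl⟩

lemma Qd_conj {x : ℂ} (hx : x ∈ Qd d) : starRingEnd ℂ x ∈ Qd d := by
  obtain ⟨p, q, rfl⟩ := Qd_form d hx
  have e : starRingEnd ℂ (p + q * al d) = algebraMap ℚ ℂ p + algebraMap ℚ ℂ (-q) * al d := by
    simp [al_conj]
  rw [e]
  exact add_mem (IntermediateField.algebraMap_mem _ _) (mul_mem (IntermediateField.algebraMap_mem _ _) (al_mem d))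

lemma int_conj {x : ℂ} (hx : IsIntegral ℤ x) : IsIntegral ℤ (starRingEnd ℂ x) :=
  hx.map (starRingEnd ℂ).toIntAlgHom

lemma io_tr (x : Od d) : ∃ a b n : ℤ, (a : ℂ) = io d x + starRingEnd ℂ (io d x) ∧
    (b : ℂ) = al d * (io d x - starRingEnd ℂ (io d x)) ∧ (n : ℂ) = io d x * starRingEnd ℂ (io d x) := by
  obtain ⟨p, q, h⟩ := Qd_form d (io_mem d x)
  have hx := io_int d x
  have hx' := int_conj hx
  have e1 : io d x + starRingEnd ℂ (io d x) = ((2 * p : ℚ) : ℂ) := by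
    rw [h]; simp [al_conj]; ring
  have e2 : al d * (io d x - starRingEnd ℂ (io d x)) = ((-2 * q * d : ℚ) : ℂ) := by
    rw [h]; simp [al_conj]; linear_combination 2 * (q : ℂ) * al_sq d
  have e3 : io d x * starRingEnd ℂ (io d x) = ((p ^ 2 + d * q ^ 2 : ℚ) : ℂ) := by
    rw [h]; simp [al_conj]; linear_combination -(q : ℂ) ^ 2 * al_sq d
  obtain ⟨a, ha⟩ := rat_int (e1 ▸ hx.add hx')
  obtain ⟨b, hb⟩ := rat_int (e2 ▸ (al_int d).mul (hx.sub hx'))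
  obtain ⟨n, hn⟩ := rat_int (e3 ▸ hx.mul hx')
  exact ⟨a, b, n, ha.trans e1.symm, hb.trans e2.symm, hn.trans e3.symm⟩

lemma al_ne (hd : 0 < d) : al d ≠ 0 := by
  intro h
  have := al_sq d
  rw [h] at this
  simp at this
  omega

lemma io_disc (x : Od d) (hx : x ≠ 0) : 1 ≤ ‖io d x‖ := by
  obtain ⟨-, -, n, -, -, hn⟩ := io_tr d x
  have h0 : io d x ≠ 0 := (map_ne_zero_iff _ (io_inj d)).2 hx
  rw [Complex.mul_conj, Complex.normSq_eq_norm_sq] at hn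
  have hn' : (n : ℝ) = ‖io d x‖ ^ 2 := by exact_mod_cast hn
  have hp : 0 < ‖io d x‖ := norm_pos_iff.2 h0
  have : 0 < n := by
    have : (0 : ℝ) < n := by rw [hn']; positivity
    exact_mod_cast this
  have h1 : (1 : ℝ) ≤ n := by exact_mod_cast this
  nlinarith

lemma io_fin (hd : 0 < d) (R : ℝ) : {x | ‖io d x‖ ≤ R}.Finite := by
  choose a b n ha hb hn using io_tr d
  set N : ℤ := ⌈(1 + ‖al d‖) * (2 * R)⌉
  have hinj : Function.Injective (fun x => (a x, b x)) := by
    intro x y hxy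
    simp only [Prod.mk.injEq] at hxy
    apply io_inj
    have h1 := ha x
    have h2 := hb x
    rw [hxy.1, ha y] at h1
    rw [hxy.2, hb y] at h2
    have h3 := mul_left_cancel₀ (al_ne d hd) h2
    linear_combination -(1/2 : ℂ) * h1 - (1/2 : ℂ) * h3
  refine (((Set.finite_Icc (-N) N).prod (Set.finite_Icc (-N) N)).preimage hinj.injOn).subset ?_
  intro x hx
  have hx : ‖io d x‖ ≤ R := hx
  have hR : 0 ≤ R := (norm_nonneg _).trans hx
  have hc : ‖starRingEnd ℂ (io d x)‖ ≤ R := by rwa [RCLike.norm_conj]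
  have hal := norm_nonneg (al d)
  have e : ∀ m : ℤ, ‖(m : ℂ)‖ ≤ (1 + ‖al d‖) * (2 * R) → m ∈ Set.Icc (-N) N := by
    intro m hm
    rw [Complex.norm_intCast] at hm
    have := abs_le.1 (hm.trans (Int.le_ceil _))
    exact ⟨by exact_mod_cast this.1, by exact_mod_cast this.2⟩
  refine ⟨e _ ?_, e _ ?_⟩
  · rw [ha]
    refine (norm_add_le _ _).trans ?_
    nlinarith
  · rw [hb, norm_mul]
    have := norm_sub_le (io d x) (starRingEnd ℂ (io d x))
    nlinarith [norm_nonneg (io d x - starRingEnd ℂ (io d x))]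

lemma io_nf : NumberField (Qd d) :=
  { to_charZero := inferInstance
    to_finiteDimensional := IntermediateField.adjoin.finiteDimensional (al_int d).tower_top }

lemma Qd_finrank (hd : 0 < d) : Module.finrank ℚ (Qd d) = 2 := by
  have hi : IsIntegral ℚ (al d) := (al_int d).tower_top
  have h1 : Module.finrank ℚ (Qd d) = (minpoly ℚ (al d)).natDegree := IntermediateField.adjoin.finrank hi
  rw [h1]
  apply le_antisymm
  · have hdeg : (Polynomial.X ^ 2 + Polynomial.C (d : ℚ)).natDegree = 2 := Polynomial.natDegree_X_pow_add_C
    rw [← hdeg]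
    apply Polynomial.natDegree_le_of_dvd
    · apply minpoly.dvd
      simp [pow_two, al_sq]
    · exact (Polynomial.monic_X_pow_add_C _ (by norm_num)).ne_zero
  · rw [minpoly.two_le_natDegree_iff hi]
    rintro ⟨r, hr⟩
    have := al_conj d
    rw [← hr] at this
    simp at this
    have h0 : (r : ℂ) = 0 := by linear_combination (1/2 : ℂ) * this
    exact al_ne d hd (by rw [← hr]; simpa using h0)

lemma io_emb (σ : Qd d →ₐ[ℚ] ℂ) (x : Qd d) : ‖σ x‖ = ‖(x : ℂ)‖ := by
  obtain ⟨p, q, h⟩ := Qd_form d x.2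
  have hx : x = algebraMap ℚ _ p + algebraMap ℚ _ q * ⟨al d, al_mem d⟩ := by
    apply Subtype.ext
    rw [h]; simp
  have hσ : σ x = p + q * σ ⟨al d, al_mem d⟩ := by
    rw [hx]; simp
  have h2 : σ ⟨al d, al_mem d⟩ * σ ⟨al d, al_mem d⟩ = al d * al d := by
    rw [← map_mul]
    have : (⟨al d, al_mem d⟩ : Qd d) * ⟨al d, al_mem d⟩ = -(d : Qd d) := by
      apply Subtype.ext
      simp [al_sq]
    rw [this, al_sq]; simp
  rcases mul_self_eq_mul_self_iff.1 h2 with h3 | h3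
  · rw [hσ, h, h3]
  · rw [hσ, h, h3, ← RCLike.norm_conj]
    simp [al_conj]

lemma io_sqn (hd : 0 < d) (a : Ideal (Od d)) (s : Od d) (h : a * a = Ideal.span {s}) :
    ∃ n : ℕ, ‖io d s‖ = n := by
  have := io_nf d
  refine ⟨Ideal.absNorm a, ?_⟩
  have h1 := congrArg Ideal.absNorm h
  rw [map_mul, Ideal.absNorm_span_singleton] at h1
  have h2 : ((Algebra.norm ℤ s : ℤ) : ℚ) = Algebra.norm ℚ (s : Qd d) := Algebra.coe_norm_int s
  have h3 := Algebra.norm_eq_prod_embeddings ℚ ℂ (s : Qd d)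
  rw [← h2] at h3
  have h4 := congrArg norm h3
  rw [norm_prod, Finset.prod_congr rfl (fun σ _ => io_emb d σ _), Finset.prod_const, Finset.card_univ,
    AlgHom.card, Qd_finrank d hd] at h4
  have h5 : ‖algebraMap ℚ ℂ ((Algebra.norm ℤ s : ℤ) : ℚ)‖ = (((Algebra.norm ℤ s).natAbs : ℕ) : ℝ) := by
    rw [Nat.cast_natAbs, eq_ratCast, Rat.cast_intCast, Complex.norm_intCast, Int.cast_abs]
  rw [h5, ← h1] at h4
  change _ = ‖io d s‖ ^ 2 at h4
  push_cast at h4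
  rw [← pow_two] at h4
  exact ((pow_left_inj₀ (Nat.cast_nonneg _) (norm_nonneg _) two_ne_zero).1 h4).symm

theorem Od_QRing (hd : 0 < d) : QRing (Od d) (io d) where
  inj := io_inj d
  disc := io_disc d
  fin := io_fin d hd
  conj := by
    choose c hc using fun x : Od d => io_mk d (Qd_conj d (io_mem d x)) (int_conj (io_int d x))
    refine ⟨⟨⟨⟨c, ?_⟩, ?_⟩, ?_, ?_⟩, hc⟩
    · apply io_inj; simp [hc]
    · intro x y; apply io_inj; simp [hc]
    · apply io_inj; simp [hc]
    · intro x y; apply io_inj; simp [hc]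
  del := by
    obtain ⟨δ, hδ⟩ := io_mk d (al_mem d) (al_int d)
    refine ⟨δ, Real.sqrt d, ?_, by rw [hδ, al, mul_comm]⟩
    rw [Real.one_le_sqrt]; exact_mod_cast hd
  quot := by
    intro Δ hΔ
    have := io_nf d
    exact Ideal.finiteQuotientOfFreeOfNeBot _ (by simpa using hΔ)
  closed := by
    rintro z n hn ⟨a, ha⟩ ⟨b, hb⟩
    have h0 : io d n ≠ 0 := (map_ne_zero_iff _ (io_inj d)).2 hn
    apply io_mk
    · have : z = io d b / io d n := by rw [hb]; field_simp
      rw [this]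
      exact div_mem (io_mem d b) (io_mem d n)
    · exact IsIntegral.of_pow (n := 2) (by norm_num) (ha ▸ io_int d a)
  sqn := io_sqn d hd

end quad

/-- The outer automorphism group of a Bianchi group `PSL₂(O_d)` is an elementary abelian
2-group: the square of every automorphism of `PSL₂(O_d)` is inner. -/
theorem bianchi_outer_automorphisms_elementary_abelian_two (d : ℕ)
    (hd : Squarefree d) (hd0 : 0 < d) (φ : PSL2 (Od d) ≃* PSL2 (Od d)) :
    ∃ g : PSL2 (Od d), ∀ x : PSL2 (Od d), φ (φ x) = g * x * g⁻¹ := by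
  exact (Od_QRing d hd0).main φ
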